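/- arXiv:1703.01215 — 4 statements merged into one kernel-verified Lean document; each statement's English description precedes it below -/
import Mathlib

section
/- Let p be an odd prime and α, z ∈ ℤ_p such that z(1+z) is a unit of ℤ_p. Set λ = λ_p^{(2)}(α). Then ∑_{k=0}^{p−1} (α)_k²/(k!)² · z^{2k} + z^{1−2λ} · ∑_{k=0}^{p−1} (α)_k²/(k!)² · z^{−2k} ≡ (1+z)^{1−2λ} · ∑_{k=0}^{p−1} (α)_k(1/2)_k/(k!)² · (4z/(1+z)²)^k (mod p²). -/
open scoped BigOperators

/-- The Pochhammer symbol `(x)_k = x(x+1)⋯(x+k-1)` in `ℚ_[p]`. -/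
noncomputable def poch (p : ℕ) [Fact p.Prime] (x : ℚ_[p]) (k : ℕ) : ℚ_[p] :=
  (ascPochhammer ℚ_[p] k).eval x

/-- The least non-negative residue `⟨α⟩_p ∈ {0,…,p-1}` of `α ∈ ℤ_[p]` modulo `p`. -/
noncomputable def res (p : ℕ) [Fact p.Prime] (α : ℤ_[p]) : ℕ :=
  (PadicInt.toZMod α).val

/-- The least non-negative residue `⟨α⟩_{p²} ∈ {0,…,p²-1}` of `α ∈ ℤ_[p]` modulo `p²`. -/
noncomputable def res2 (p : ℕ) [Fact p.Prime] (α : ℤ_[p]) : ℕ :=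
  (PadicInt.toZModPow 2 α).val

/-- `λ_p^{(2)}(α) = ((⟨−α⟩_p − ⟨−α⟩_{p²})/p)·(p−1) − ⟨−α⟩_p`, an integer congruent mod `p²`
to the exponent `λ_p(α)` of the paper on units. -/
noncomputable def lam2 (p : ℕ) [Fact p.Prime] (α : ℤ_[p]) : ℤ :=
  (((res p (-α) : ℤ) - (res2 p (-α) : ℤ)) / (p : ℤ)) * ((p : ℤ) - 1) - (res p (-α) : ℤ)

section
open Polynomial Finset

/-- The Euler derivation `X · d/dX`. -/
noncomputable def eulerDeriv (R : Type*) [CommRing R] : Derivation R R[X] R[X] :=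
  (X : R[X]) • (Polynomial.derivative' : Derivation R R[X] R[X])

/-- The differential operator `θ² - X² (θ - 2a)²`, annihilating `∑ (a choose k)² X^(2k)`. -/
noncomputable def hypOp (R : Type*) [CommRing R] (a : ℕ) : R[X] →ₗ[R] R[X] :=
  (eulerDeriv R).toLinearMap ∘ₗ (eulerDeriv R).toLinearMap
    - LinearMap.mulLeft R (X ^ 2 : R[X]) ∘ₗ
      ((eulerDeriv R).toLinearMap ∘ₗ (eulerDeriv R).toLinearMap
        - (4 * a : R) • (eulerDeriv R).toLinearMap + (4 * a ^ 2 : R) • LinearMap.id)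

variable {R : Type*} [CommRing R]

theorem eulerDeriv_apply (f : R[X]) : eulerDeriv R f = X * derivative f := rfl

theorem hypOp_apply (a : ℕ) (f : R[X]) :
    hypOp R a f = eulerDeriv R (eulerDeriv R f)
      - X ^ 2 * (eulerDeriv R (eulerDeriv R f) - 4 * (a : R[X]) * eulerDeriv R f
        + 4 * (a : R[X]) ^ 2 * f) := by
  simp only [hypOp, LinearMap.sub_apply, LinearMap.add_apply, LinearMap.comp_apply,
    LinearMap.smul_apply, LinearMap.mulLeft_apply, LinearMap.id_apply, smul_eq_C_mul]
  simp [map_ofNat]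

theorem eulerDeriv_mul (f g : R[X]) :
    eulerDeriv R (f * g) = eulerDeriv R f * g + f * eulerDeriv R g := by
  rw [Derivation.leibniz]; simp only [smul_eq_mul]; ring

theorem eulerDeriv_X_pow (n : ℕ) : eulerDeriv R (X ^ n) = (n : R[X]) * X ^ n := by
  rw [eulerDeriv_apply]
  rcases n with _ | n
  · simp
  · simp; ring

theorem eulerDeriv_natCast (n : ℕ) : eulerDeriv R (n : R[X]) = 0 := by
  rw [eulerDeriv_apply]; simp

theorem eulerDeriv_C (r : R) : eulerDeriv R (C r) = 0 := by
  rw [eulerDeriv_apply]; simp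

theorem eulerDeriv_one_add_X_pow_succ (n : ℕ) :
    eulerDeriv R ((1 + X) ^ (n + 1)) = (n + 1 : R[X]) * X * (1 + X) ^ n := by
  rw [eulerDeriv_apply, derivative_pow]
  simp; ring

theorem one_add_X_mul_eulerDeriv_pow (n : ℕ) :
    (1 + X) * eulerDeriv R ((1 + X) ^ n) = (n : R[X]) * X * (1 + X) ^ n := by
  rcases n with _ | n
  · simp
  · rw [eulerDeriv_one_add_X_pow_succ]; push_cast; ring

theorem coeff_eulerDeriv (f : R[X]) (m : ℕ) : (eulerDeriv R f).coeff m = m * f.coeff m := by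
  rw [eulerDeriv_apply]
  rcases m with _ | m
  · simp
  · rw [coeff_X_mul, coeff_derivative]; push_cast; ring

theorem coeff_one_hypOp (a : ℕ) (f : R[X]) : (hypOp R a f).coeff 1 = f.coeff 1 := by
  rw [hypOp_apply, coeff_sub, coeff_X_pow_mul', coeff_eulerDeriv, coeff_eulerDeriv]
  simp

theorem coeff_add_two_hypOp (a : ℕ) (f : R[X]) (m : ℕ) :
    (hypOp R a f).coeff (m + 2)
      = (m + 2 : R) ^ 2 * f.coeff (m + 2) - (m - 2 * a : R) ^ 2 * f.coeff m := by
  have h1 : (4 * (a : R[X]) * eulerDeriv R f) = C (4 * a : R) * eulerDeriv R f := by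
    simp [map_ofNat]
  have h2 : (4 * (a : R[X]) ^ 2 * f) = C (4 * a ^ 2 : R) * f := by
    simp [map_ofNat]
  rw [hypOp_apply, coeff_sub, coeff_X_pow_mul, h1, h2]
  simp only [coeff_add, coeff_sub, coeff_C_mul, coeff_eulerDeriv]
  push_cast; ring

theorem hypOp_X_pow (a n : ℕ) :
    hypOp R a (X ^ n) = (n : R[X]) ^ 2 * X ^ n - (n - 2 * a : R[X]) ^ 2 * X ^ (n + 2) := by
  simp only [hypOp_apply, eulerDeriv_X_pow, eulerDeriv_mul, eulerDeriv_natCast]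
  ring

theorem hypOp_C_mul (a : ℕ) (r : R) (f : R[X]) : hypOp R a (C r * f) = C r * hypOp R a f := by
  rw [← smul_eq_C_mul, map_smul, smul_eq_C_mul]

theorem hypOp_mul_of_eulerDeriv_eq_zero (a : ℕ) {g : R[X]} (hg : eulerDeriv R g = 0) (f : R[X]) :
    hypOp R a (g * f) = g * hypOp R a f := by
  simp only [hypOp_apply, eulerDeriv_mul, hg, zero_mul, zero_add]
  ring

theorem hypOp_mul_of_hypOp_eq_zero (a : ℕ) {S : R[X]} (hS : hypOp R a S = 0) (L : R[X]) :
    hypOp R a (S * L)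
      = 2 * eulerDeriv R L * ((1 - X ^ 2) * eulerDeriv R S + 2 * (a : R[X]) * X ^ 2 * S)
        + (1 - X ^ 2) * S * eulerDeriv R (eulerDeriv R L) := by
  rw [hypOp_apply] at hS ⊢
  simp only [eulerDeriv_mul, map_add]
  linear_combination L * hS

theorem hypOp_X_pow_mul_one_add_X_pow (a k j : ℕ) (h : (j : R) + 2 = 2 * a - 2 * k) :
    hypOp R a (X ^ k * (1 + X) ^ (j + 2))
      = (1 - X ^ 2) * ((k : R[X]) ^ 2 * (X ^ k * (1 + X) ^ (j + 2))
          - (k - a : R[X]) * (4 * k + 2 : R[X]) * (X ^ (k + 1) * (1 + X) ^ j)) := by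
  have h' : (j : R[X]) = 2 * a - 2 * k - 2 := by
    have := congrArg (C : R → R[X]) h
    simp only [map_add, map_sub, map_mul, map_natCast, map_ofNat] at this
    linear_combination this
  have hX : eulerDeriv R (X : R[X]) = X := by simpa using eulerDeriv_X_pow (R := R) 1
  have h2 : eulerDeriv R (2 : R[X]) = 0 := by simpa using eulerDeriv_natCast (R := R) 2
  have e1 : eulerDeriv R ((1 + X : R[X]) ^ (j + 2))
      = (2 * a - 2 * k : R[X]) * X * (1 + X) ^ (j + 1) := by
    rw [eulerDeriv_one_add_X_pow_succ (j + 1)]; push_cast; rw [h']; ring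
  have e2 : eulerDeriv R ((1 + X : R[X]) ^ (j + 1))
      = (2 * a - 2 * k - 1 : R[X]) * X * (1 + X) ^ j := by
    rw [eulerDeriv_one_add_X_pow_succ j, h']; ring
  simp only [hypOp_apply, eulerDeriv_mul, e1, e2, eulerDeriv_X_pow, map_add, map_sub,
    eulerDeriv_natCast, hX, h2]
  ring

theorem natCast_succ_mul_choose_succ (a k : ℕ) :
    ((k : R) + 1) * (a.choose (k + 1) : R) = (a - k : R) * (a.choose k : R) := by
  rcases le_or_gt k a with h | h
  · have := Nat.choose_succ_right_eq a k
    have := congrArg (Nat.cast : ℕ → R) this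
    push_cast [Nat.cast_sub h] at this
    linear_combination this
  · simp [Nat.choose_eq_zero_of_lt h, Nat.choose_eq_zero_of_lt (Nat.lt_succ_of_lt h)]

theorem natCast_succ_mul_centralBinom_succ (k : ℕ) :
    ((k : R) + 1) * (Nat.centralBinom (k + 1) : R) = (4 * k + 2 : R) * (Nat.centralBinom k : R) := by
  have := congrArg (Nat.cast : ℕ → R) (Nat.succ_mul_centralBinom_succ k)
  push_cast at this
  linear_combination this

theorem hypOp_sum_mul_X_pow (a : ℕ) (τ : R) (x y : ℕ → R) (n : ℕ)
    (h : ∀ k < n, ((k : R) + 1) ^ 2 * x (k + 1) = (a - k : R) ^ 2 * x k + τ * (a - k) * y k) :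
    hypOp R a (∑ k ∈ range (n + 1), C (x k) * X ^ (2 * k))
      = 4 * C τ * ∑ k ∈ range n, (a - k : R[X]) * C (y k) * X ^ (2 * k + 2)
        - 4 * (a - n : R[X]) ^ 2 * C (x n) * X ^ (2 * n + 2) := by
  induction n with
  | zero =>
    simp only [zero_add, sum_range_one, sum_range_zero, hypOp_C_mul, hypOp_X_pow]
    push_cast; ring
  | succ n ih =>
    rw [sum_range_succ, map_add, ih fun k hk => h k (by omega), hypOp_C_mul, hypOp_X_pow,
      sum_range_succ _ n]
    have := congrArg (C : R → R[X]) (h n (by omega))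
    simp only [map_add, map_sub, map_mul, map_pow, map_natCast, map_one] at this
    push_cast
    linear_combination (4 * X ^ (2 * n + 2)) * this

theorem hypOp_sum_mul_X_pow_reverse (a : ℕ) (τ : R) (x y : ℕ → R) (n : ℕ) (hn : n ≤ a)
    (h : ∀ k < n, ((k : R) + 1) ^ 2 * x (k + 1) = (a - k : R) ^ 2 * x k + τ * (a - k) * y k) :
    hypOp R a (∑ k ∈ range (n + 1), C (x k) * X ^ (2 * (a - k)))
      = 4 * (a - n : R[X]) ^ 2 * C (x n) * X ^ (2 * (a - n))
        - 4 * C τ * ∑ k ∈ range n, (a - k : R[X]) * C (y k) * X ^ (2 * (a - k)) := by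
  induction n with
  | zero =>
    simp only [zero_add, sum_range_one, sum_range_zero, hypOp_C_mul, hypOp_X_pow, Nat.sub_zero]
    push_cast; ring
  | succ n ih =>
    rw [sum_range_succ, map_add, ih (by omega) fun k hk => h k (by omega), hypOp_C_mul,
      hypOp_X_pow, sum_range_succ _ n]
    have := congrArg (C : R → R[X]) (h n (by omega))
    simp only [map_add, map_sub, map_mul, map_pow, map_natCast, map_one] at this
    obtain ⟨b, rfl⟩ := Nat.exists_eq_add_of_le hn
    have e1 : n + 1 + b - (n + 1) = b := by omega
    have e2 : n + 1 + b - n = b + 1 := by omega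
    rw [e1, e2]
    push_cast at this ⊢
    linear_combination (-4 * X ^ (2 * b + 2)) * this

theorem hypOp_sum_sq_choose (a : ℕ) :
    hypOp R a (∑ k ∈ range (a + 1), C ((a.choose k : R) ^ 2) * X ^ (2 * k)) = 0 := by
  rw [hypOp_sum_mul_X_pow a 0 _ 0]
  · simp
  · intro k _
    have := natCast_succ_mul_choose_succ (R := R) a k
    rw [← mul_pow, this]; simp; ring

theorem hypOp_sum_mul_X_pow_mul_one_add_X_pow (a N : ℕ) (hN : (N : R) = 2 * a) (τ : R)
    (e f : ℕ → R) (n : ℕ) (hn : 2 * n + 2 ≤ N)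
    (h : ∀ k < n, ((k : R) + 1) ^ 2 * e (k + 1)
      = (k - a : R) * (4 * k + 2) * e k - τ * (4 * k + 2) * f k) :
    hypOp R a (∑ k ∈ range (n + 1), C (e k) * (X ^ k * (1 + X) ^ (N - 2 * k)))
      = (1 - X ^ 2) * (-C τ * (∑ k ∈ range n,
            (4 * k + 2 : R[X]) * C (f k) * (X ^ (k + 1) * (1 + X) ^ (N - 2 * (k + 1))))
          - (n - a : R[X]) * (4 * n + 2 : R[X]) * C (e n)
            * (X ^ (n + 1) * (1 + X) ^ (N - 2 * (n + 1)))) := by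
  have key : ∀ k, 2 * k + 2 ≤ N → hypOp R a (X ^ k * (1 + X) ^ (N - 2 * k))
      = (1 - X ^ 2) * ((k : R[X]) ^ 2 * (X ^ k * (1 + X) ^ (N - 2 * k))
          - (k - a : R[X]) * (4 * k + 2 : R[X]) * (X ^ (k + 1) * (1 + X) ^ (N - 2 * (k + 1)))) := by
    intro k hk
    obtain ⟨j, rfl⟩ := Nat.exists_eq_add_of_le hk
    have e1 : 2 * k + 2 + j - 2 * k = j + 2 := by omega
    have e2 : 2 * k + 2 + j - 2 * (k + 1) = j := by omega
    rw [e1, e2]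
    apply hypOp_X_pow_mul_one_add_X_pow
    push_cast at hN
    linear_combination hN
  induction n with
  | zero =>
    simp only [zero_add, sum_range_one, sum_range_zero, hypOp_C_mul, key 0 (by omega)]
    push_cast; ring
  | succ n ih =>
    rw [sum_range_succ, map_add, ih (by omega) fun k hk => h k (by omega), hypOp_C_mul,
      key (n + 1) hn, sum_range_succ _ n]
    have := congrArg (C : R → R[X]) (h n (by omega))
    simp only [map_add, map_sub, map_mul, map_pow, map_natCast, map_one, map_ofNat] at this
    push_cast
    linear_combination (1 - X ^ 2) * (X ^ (n + 1) * (1 + X) ^ (N - 2 * (n + 1))) * this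

theorem eq_zero_of_hypOp_int (a : ℕ) {f : ℤ[X]} (hf : hypOp ℤ a f = 0) (h0 : f.coeff 0 = 0) :
    f = 0 := by
  ext m
  rw [coeff_zero]
  induction m using Nat.strong_induction_on with
  | _ m ih =>
    match m with
    | 0 => exact h0
    | 1 => rw [← coeff_one_hypOp a, hf, coeff_zero]
    | m + 2 =>
      have := coeff_add_two_hypOp a f m
      rw [hf, coeff_zero, ih m (by omega)] at this
      have h2 : ((m : ℤ) + 2) ^ 2 ≠ 0 := by positivity
      simpa [h2] using this

theorem eq_zero_of_hypOp_zmod (p : ℕ) [Fact p.Prime] (hp : Odd p) (a : ℕ) (ha : a < p)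
    {f : (ZMod p)[X]} (hf : hypOp (ZMod p) a f = 0) (h0 : f.coeff 0 = 0)
    (hdeg : ∀ m, 2 * a + p ≤ m → f.coeff m = 0) : f = 0 := by
  have rec2 : ∀ m : ℕ, ((m : ZMod p) + 2) ^ 2 * f.coeff (m + 2)
      = (m - 2 * a : ZMod p) ^ 2 * f.coeff m := by
    intro m
    have := coeff_add_two_hypOp a f m
    rw [hf, coeff_zero] at this
    linear_combination -this
  have up : ∀ m, (m < p ∨ (Even m ∧ m ≤ 2 * a)) → f.coeff m = 0 := by
    intro m
    induction m using Nat.strong_induction_on with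
    | _ m ih =>
      intro hm
      match m with
      | 0 => exact h0
      | 1 => rw [← coeff_one_hypOp a, hf, coeff_zero]
      | m + 2 =>
        have hr := rec2 m
        rw [ih m (by omega) (by
          rcases hm with hm | ⟨h1, h2⟩
          · left; omega
          · right; exact ⟨by simpa [Nat.even_add] using h1, by omega⟩), mul_zero] at hr
        have hne : ((m : ZMod p) + 2) ≠ 0 := by
          intro h
          have h' : ((m + 2 : ℕ) : ZMod p) = 0 := by push_cast; exact h
          rw [ZMod.natCast_eq_zero_iff] at h'
          obtain ⟨c, hc⟩ := h'
          have hc1 : c ≠ 0 := by rintro rfl; omega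
          rcases hm with hm | ⟨h1, h2⟩
          · have : p * 1 ≤ p * c := Nat.mul_le_mul_left _ (by omega)
            omega
          · have hc2 : c < 2 := by
              by_contra hc2
              have : p * 2 ≤ p * c := Nat.mul_le_mul_left _ (by omega)
              omega
            have : c = 1 := by omega
            subst this
            rw [hc, mul_one] at h1
            exact (Nat.not_even_iff_odd.2 hp) h1
        simpa [hne] using hr
  have down : ∀ j m, m + j = 2 * a + p + 1 → ((p ≤ m ∧ Odd m) ∨ 2 * a < m) →
      f.coeff m = 0 := by
    intro j
    induction j using Nat.strong_induction_on with
    | _ j ih =>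
      intro m hmj hm
      rcases le_or_gt (2 * a + p) m with h | h
      · exact hdeg m h
      have hr := rec2 m
      have hz : f.coeff (m + 2) = 0 := by
        rcases le_or_gt (2 * a + p) (m + 2) with h' | h'
        · exact hdeg _ h'
        · refine ih (j - 2) (by omega) (m + 2) (by omega) ?_
          rcases hm with ⟨h1, h2⟩ | h1
          · left; exact ⟨by omega, by rw [Nat.odd_add]; simp [h2]⟩
          · right; omega
      rw [hz, mul_zero] at hr
      have hne : ((m : ZMod p) - 2 * a) ≠ 0 := by
        intro h'
        have h'' : (((m : ℤ) - 2 * a : ℤ) : ZMod p) = 0 := by push_cast; exact h'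
        rw [ZMod.intCast_zmod_eq_zero_iff_dvd] at h''
        have := Int.eq_zero_of_abs_lt_dvd h'' (by rw [abs_lt]; constructor <;> omega)
        rcases hm with ⟨h1, h2⟩ | h1
        · rcases h2 with ⟨r, hr⟩; omega
        · omega
      have := hr.symm
      simpa [hne] using this
  ext m
  rw [coeff_zero]
  rcases lt_or_ge m p with h | h
  · exact up m (Or.inl h)
  rcases le_or_gt (2 * a + p) m with h' | h'
  · exact hdeg m h'
  rcases Nat.even_or_odd m with he | ho
  · rcases le_or_gt m (2 * a) with h2 | h2
    · exact up m (Or.inr ⟨he, h2⟩)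
    · exact down (2 * a + p + 1 - m) m (by omega) (Or.inr h2)
  · exact down (2 * a + p + 1 - m) m (by omega) (Or.inl ⟨h, ho⟩)

theorem sum_sq_choose_int (a : ℕ) :
    ∑ k ∈ range (a + 1), C ((a.choose k : ℤ) ^ 2) * X ^ (2 * k)
      = ∑ k ∈ range (a + 1), C ((-1) ^ k * (Nat.centralBinom k : ℤ) * (a.choose k : ℤ))
          * (X ^ k * (1 + X) ^ (2 * a - 2 * k)) := by
  rw [← sub_eq_zero]
  apply eq_zero_of_hypOp_int a
  · rw [map_sub, hypOp_sum_sq_choose, zero_sub, neg_eq_zero]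
    rcases a with _ | a
    · simp [hypOp_apply, eulerDeriv_apply]
    · rw [sum_range_succ, map_add, hypOp_sum_mul_X_pow_mul_one_add_X_pow (a + 1) (2 * (a + 1))
        (by push_cast; ring) 0 _ 0 a (by omega), Nat.sub_self, pow_zero, mul_one, hypOp_C_mul,
        hypOp_X_pow]
      · have h1 := congrArg (C : ℤ → ℤ[X]) (natCast_succ_mul_choose_succ (R := ℤ) (a + 1) a)
        have h2 := congrArg (C : ℤ → ℤ[X]) (natCast_succ_mul_centralBinom_succ (R := ℤ) a)
        simp only [map_add, map_sub, map_mul, map_natCast, map_one, map_ofNat] at h1 h2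
        simp only [map_mul, map_pow, map_natCast, map_one, map_neg, map_zero]
        push_cast at h1 h2 ⊢
        linear_combination ((-1) ^ (a + 1) * X ^ (a + 1) * (1 - X ^ 2) * (a + 1))
            * (((a + 1).choose (a + 1) : ℤ[X]) * h2)
        + ((-1) ^ (a + 1) * X ^ (a + 1) * (1 - X ^ 2))
            * ((4 * a + 2) * (Nat.centralBinom a : ℤ[X])) * h1
      · intro k _
        have h1 := natCast_succ_mul_choose_succ (R := ℤ) (a + 1) k
        have h2 := natCast_succ_mul_centralBinom_succ (R := ℤ) k
        simp only [zero_mul, sub_zero]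
        rw [pow_succ (-1 : ℤ)]
        linear_combination ((-1) ^ (k + 1) * (k + 1) * ((a + 1).choose (k + 1) : ℤ)) * h2
          + ((-1) ^ (k + 1) * (4 * k + 2) * (Nat.centralBinom k : ℤ)) * h1
  · rw [coeff_sub, coeff_zero_eq_eval_zero, coeff_zero_eq_eval_zero, eval_finsetSum,
      eval_finsetSum, sum_range_succ', sum_range_succ']
    simp

theorem sum_sq_choose (a : ℕ) :
    ∑ k ∈ range (a + 1), C ((a.choose k : R) ^ 2) * X ^ (2 * k)
      = ∑ k ∈ range (a + 1), C ((-1) ^ k * (Nat.centralBinom k : R) * (a.choose k : R))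
          * (X ^ k * (1 + X) ^ (2 * a - 2 * k)) := by
  have := congrArg (Polynomial.map (Int.castRingHom R)) (sum_sq_choose_int a)
  simpa [Polynomial.map_sum] using this
end

section
open Polynomial Finset
variable {R : Type*} [CommRing R]

theorem centralBinom_cast_eq_zero (p : ℕ) [Fact p.Prime] {k : ℕ} (hk : k < p) (h : p ≤ 2 * k) :
    (Nat.centralBinom k : ZMod p) = 0 := by
  rw [ZMod.natCast_eq_zero_iff]
  exact (Fact.out : p.Prime).dvd_choose hk (by omega) h

/-- The sum `∑ (a choose k)² X^(2k)`. -/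
noncomputable def sqChoosePoly (R : Type*) [CommRing R] (a : ℕ) : R[X] :=
  ∑ k ∈ range (a + 1), C ((a.choose k : R) ^ 2) * X ^ (2 * k)

theorem hypOp_sum_choose_mul (a : ℕ) (τ : R) (d : ℕ → R)
    (hd : ∀ k < a, ((k : R) + 1) * d (k + 1) = (a - k : R) * d k + τ * a.choose k) :
    hypOp R a (2 * ∑ k ∈ range (a + 1), C (a.choose k * d k) * X ^ (2 * k))
      = 4 * C τ * X ^ 2 * (2 * (a : R[X]) * sqChoosePoly R a - eulerDeriv R (sqChoosePoly R a)) := by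
  have h2 : (2 : R[X]) = C 2 := by simp [map_ofNat]
  rw [h2, hypOp_C_mul, hypOp_sum_mul_X_pow a τ _ fun k => (a.choose k : R) ^ 2]
  · have e : 2 * (a : R[X]) * sqChoosePoly R a - eulerDeriv R (sqChoosePoly R a)
        = 2 * ∑ k ∈ range (a + 1), (a - k : R[X]) * C ((a.choose k : R) ^ 2) * X ^ (2 * k) := by
      rw [sqChoosePoly, map_sum, mul_sum, mul_sum, ← sum_sub_distrib]
      refine sum_congr rfl fun k _ => ?_
      rw [eulerDeriv_mul, eulerDeriv_C, eulerDeriv_X_pow]; push_cast; ring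
    rw [← h2, e, sum_range_succ _ a]
    have : ∑ k ∈ range a, (a - k : R[X]) * C ((a.choose k : R) ^ 2) * X ^ (2 * k + 2)
        = X ^ 2 * ∑ k ∈ range a, (a - k : R[X]) * C ((a.choose k : R) ^ 2) * X ^ (2 * k) := by
      rw [mul_sum]; exact sum_congr rfl fun k _ => by ring
    rw [this]; ring
  · intro k hk
    have h1 := natCast_succ_mul_choose_succ (R := R) a k
    linear_combination ((k : R) + 1) * d (k + 1) * h1 + ((a - k : R) * a.choose k) * hd k hk

theorem hypOp_sum_choose_mul_reverse (a : ℕ) (τ : R) (d : ℕ → R)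
    (hd : ∀ k < a, ((k : R) + 1) * d (k + 1) = (a - k : R) * d k + τ * a.choose k) :
    hypOp R a (2 * ∑ k ∈ range (a + 1), C (a.choose k * d k) * X ^ (2 * (a - k)))
      = -4 * C τ * eulerDeriv R (sqChoosePoly R a) := by
  have h2 : (2 : R[X]) = C 2 := by simp [map_ofNat]
  rw [h2, hypOp_C_mul, hypOp_sum_mul_X_pow_reverse a τ _ (fun k => (a.choose k : R) ^ 2) a le_rfl]
  · have e : eulerDeriv R (sqChoosePoly R a)
        = 2 * ∑ k ∈ range (a + 1), (a - k : R[X]) * C ((a.choose k : R) ^ 2) * X ^ (2 * (a - k)) := by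
      rw [sqChoosePoly, map_sum, mul_sum, ← sum_flip]
      refine sum_congr rfl fun k hk => ?_
      have hk : k ≤ a := by simpa [Nat.lt_succ_iff] using hk
      rw [eulerDeriv_mul, eulerDeriv_C, eulerDeriv_X_pow, Nat.choose_symm hk]
      push_cast [Nat.cast_sub hk]; ring
    rw [e, sum_range_succ _ a, ← h2]
    ring
  · intro k hk
    have h1 := natCast_succ_mul_choose_succ (R := R) a k
    linear_combination ((k : R) + 1) * d (k + 1) * h1 + ((a - k : R) * a.choose k) * hd k hk

theorem one_sub_X_mul_sum (a : ℕ) :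
    (1 - X) * ∑ k ∈ range (a + 1), (4 * k + 2 : R[X]) *
        C ((-1) ^ k * (Nat.centralBinom k : R) * (a.choose k : R))
          * (X ^ k * (1 + X) ^ (2 * a - 2 * k))
      = 4 * (1 + X) * eulerDeriv R (sqChoosePoly R a) - 8 * (a : R[X]) * X * sqChoosePoly R a
        + 2 * (1 - X) * sqChoosePoly R a := by
  rw [sqChoosePoly, sum_sq_choose, map_sum, mul_sum, mul_sum, mul_sum, mul_sum, ← sum_sub_distrib,
    ← sum_add_distrib]
  refine sum_congr rfl fun k hk => ?_
  have hk : k ≤ a := by simpa [Nat.lt_succ_iff] using hk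
  have h := one_add_X_mul_eulerDeriv_pow (R := R) (2 * a - 2 * k)
  rw [Nat.cast_sub (by omega)] at h
  push_cast at h
  rw [eulerDeriv_mul, eulerDeriv_mul, eulerDeriv_C, eulerDeriv_X_pow]
  linear_combination (-4 * C ((-1) ^ k * (Nat.centralBinom k : R) * (a.choose k : R)) * X ^ k) * h

theorem hypOp_sum_centralBinom (p : ℕ) [Fact p.Prime] (hp : Odd p) (a : ℕ) (ha : a < p)
    (τ : ZMod p) (d : ℕ → ZMod p)
    (hd : ∀ k, k + 1 < p → ((k : ZMod p) + 1) * d (k + 1) = (a - k : ZMod p) * d k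
      + τ * a.choose k) :
    (1 + X) * hypOp (ZMod p) a (∑ k ∈ range p, C ((-1) ^ k * (Nat.centralBinom k : ZMod p) * d k)
        * (X ^ k * (1 + X) ^ (2 * a + 3 * p - 2 * k)))
      = -C τ * (1 + X) ^ (3 * p) * X * (4 * (1 + X) * eulerDeriv (ZMod p) (sqChoosePoly (ZMod p) a)
        - 8 * (a : (ZMod p)[X]) * X * sqChoosePoly (ZMod p) a
        + 2 * (1 - X) * sqChoosePoly (ZMod p) a) := by
  have hp2 : p ≠ 2 := by rintro rfl; exact absurd hp (by decide)
  have hp3 : 3 ≤ p := by have := (Fact.out : p.Prime).two_le; omega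
  obtain ⟨n, rfl⟩ : ∃ n, p = n + 1 := ⟨p - 1, by omega⟩
  have hcb : (Nat.centralBinom n : ZMod (n + 1)) = 0 :=
    centralBinom_cast_eq_zero _ (by omega) (by omega)
  rw [hypOp_sum_mul_X_pow_mul_one_add_X_pow a (2 * a + 3 * (n + 1)) ?_ τ _
    (fun k => (-1) ^ k * (Nat.centralBinom k : ZMod (n + 1)) * (a.choose k : ZMod (n + 1))) n
    (by omega)]
  · rw [hcb, ← one_sub_X_mul_sum]
    have e : ∑ k ∈ range n, (4 * k + 2 : (ZMod (n + 1))[X]) *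
          C ((-1) ^ k * (Nat.centralBinom k : ZMod (n + 1)) * (a.choose k : ZMod (n + 1)))
          * (X ^ (k + 1) * (1 + X) ^ (2 * a + 3 * (n + 1) - 2 * (k + 1)))
        = ∑ k ∈ range (a + 1), (4 * k + 2 : (ZMod (n + 1))[X]) *
          C ((-1) ^ k * (Nat.centralBinom k : ZMod (n + 1)) * (a.choose k : ZMod (n + 1)))
          * (X ^ (k + 1) * (1 + X) ^ (2 * a + 3 * (n + 1) - 2 * (k + 1))) := by
      have h1 := sum_range_succ (fun k => (4 * k + 2 : (ZMod (n + 1))[X]) *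
          C ((-1) ^ k * (Nat.centralBinom k : ZMod (n + 1)) * (a.choose k : ZMod (n + 1)))
          * (X ^ (k + 1) * (1 + X) ^ (2 * a + 3 * (n + 1) - 2 * (k + 1)))) n
      rw [hcb] at h1
      simp only [mul_zero, zero_mul, map_zero, add_zero] at h1
      rw [← h1]
      symm
      apply sum_subset (range_subset_range.2 (by omega))
      intro k _ hk
      rw [Nat.choose_eq_zero_of_lt (by simpa using hk)]
      simp
    rw [e]
    have e2 : (1 + X) ^ 2 * ∑ k ∈ range (a + 1), (4 * k + 2 : (ZMod (n + 1))[X]) *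
          C ((-1) ^ k * (Nat.centralBinom k : ZMod (n + 1)) * (a.choose k : ZMod (n + 1)))
          * (X ^ (k + 1) * (1 + X) ^ (2 * a + 3 * (n + 1) - 2 * (k + 1)))
        = (1 + X) ^ (3 * (n + 1)) * X * ∑ k ∈ range (a + 1), (4 * k + 2 : (ZMod (n + 1))[X]) *
        C ((-1) ^ k * (Nat.centralBinom k : ZMod (n + 1)) * (a.choose k : ZMod (n + 1)))
          * (X ^ k * (1 + X) ^ (2 * a - 2 * k)) := by
      rw [mul_sum, mul_sum]
      refine sum_congr rfl fun k hk => ?_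
      have hk : k ≤ a := by simpa [Nat.lt_succ_iff] using hk
      obtain ⟨b, rfl⟩ := Nat.exists_eq_add_of_le hk
      have e1 : 2 * (k + b) + 3 * (n + 1) - 2 * (k + 1) = 2 * b + 3 * n + 1 := by omega
      have e2 : 2 * (k + b) - 2 * k = 2 * b := by omega
      rw [e1, e2]
      ring
    simp only [mul_zero, zero_mul, map_zero, sub_zero]
    linear_combination (-C τ * (1 - X)) * e2
  · intro k hk
    have h1 := hd k (by omega)
    have h2 := natCast_succ_mul_centralBinom_succ (R := ZMod (n + 1)) k
    rw [pow_succ (-1 : ZMod (n + 1))]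
    linear_combination ((-1) ^ (k + 1) * (k + 1) * d (k + 1)) * h2
      + ((-1) ^ (k + 1) * (4 * k + 2) * (Nat.centralBinom k : ZMod (n + 1))) * h1
  · have : ((n + 1 : ℕ) : ZMod (n + 1)) = 0 := ZMod.natCast_self _
    rw [Nat.cast_add, Nat.cast_mul, Nat.cast_mul, this]; simp

theorem first_order_identity (p : ℕ) [Fact p.Prime] (hp : Odd p) (a : ℕ) (ha : a < p)
    (τ : ZMod p) (d : ℕ → ZMod p) (hd0 : d 0 = 0)
    (hd : ∀ k, k + 1 < p → ((k : ZMod p) + 1) * d (k + 1) = (a - k : ZMod p) * d k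
      + τ * a.choose k)
    (L : (ZMod p)[X]) (hL : (1 + X) * eulerDeriv (ZMod p) L = X - X ^ p) (hL0 : L.coeff 0 = 0)
    (hLdeg : L.degree < p) :
    2 * ∑ k ∈ range (a + 1), C (a.choose k * d k) * X ^ (2 * k)
        + X ^ p * (2 * ∑ k ∈ range (a + 1), C (a.choose k * d k) * X ^ (2 * (a - k)))
        - C (2 * τ) * (sqChoosePoly (ZMod p) a * L)
      = ∑ k ∈ range p, C ((-1) ^ k * (Nat.centralBinom k : ZMod p) * d k)
        * (X ^ k * (1 + X) ^ (2 * a + p - 2 * k)) := by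
  have hp0 : (p : (ZMod p)[X]) = 0 := by
    rw [← map_natCast C, ZMod.natCast_self, map_zero]
  have hXp : eulerDeriv (ZMod p) (X ^ p) = 0 := by rw [eulerDeriv_X_pow, hp0]; ring
  have h1Xp : eulerDeriv (ZMod p) ((1 + X) ^ (2 * p)) = 0 := by
    rw [eulerDeriv_apply, derivative_pow]; simp
  rw [← sub_eq_zero]
  apply eq_zero_of_hypOp_zmod p hp a ha
  · have hne : ((1 + X) ^ (2 * p) * (1 + X) ^ 2 : (ZMod p)[X]) ≠ 0 := by
      rw [← pow_add]
      apply pow_ne_zero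
      intro h
      have := congrArg (fun f => coeff f 0) h
      simp at this
    apply mul_left_cancel₀ hne
    have hG : (1 + X) ^ (2 * p) * ∑ k ∈ range p,
          C ((-1) ^ k * (Nat.centralBinom k : ZMod p) * d k) * (X ^ k * (1 + X) ^ (2 * a + p - 2 * k))
        = ∑ k ∈ range p, C ((-1) ^ k * (Nat.centralBinom k : ZMod p) * d k)
          * (X ^ k * (1 + X) ^ (2 * a + 3 * p - 2 * k)) := by
      rw [mul_sum]
      refine sum_congr rfl fun k hk => ?_
      have hk : k < p := by simpa using hk
      rcases lt_or_ge (2 * k) p with h | h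
      · have : 2 * a + 3 * p - 2 * k = 2 * p + (2 * a + p - 2 * k) := by omega
        rw [this, pow_add]; ring
      · rw [centralBinom_cast_eq_zero p hk h]; simp
    have hG' := hypOp_sum_centralBinom p hp a ha τ d hd
    rw [← hG, hypOp_mul_of_eulerDeriv_eq_zero a h1Xp] at hG'
    have hS : hypOp (ZMod p) a (sqChoosePoly (ZMod p) a) = 0 := hypOp_sum_sq_choose a
    have hL2 : X * eulerDeriv (ZMod p) L + (1 + X) * eulerDeriv (ZMod p) (eulerDeriv (ZMod p) L)
        = X := by
      have := congrArg (eulerDeriv (ZMod p)) hL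
      rw [eulerDeriv_mul, map_sub, hXp, map_add] at this
      have hX : eulerDeriv (ZMod p) (X : (ZMod p)[X]) = X := by
        simpa using eulerDeriv_X_pow (R := ZMod p) 1
      rw [hX] at this
      simpa using this
    rw [map_sub, map_sub, map_add, hypOp_mul_of_eulerDeriv_eq_zero a hXp, hypOp_C_mul,
      hypOp_mul_of_hypOp_eq_zero a hS,
      hypOp_sum_choose_mul a τ d fun k hk => hd k (by omega),
      hypOp_sum_choose_mul_reverse a τ d fun k hk => hd k (by omega), C_mul]
    have h2 : (C 2 : (ZMod p)[X]) = 2 := by simp [map_ofNat]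
    rw [h2]
    have h3p : ((1 + X) ^ (3 * p) : (ZMod p)[X]) = (1 + X) ^ (2 * p) * (1 + X ^ p) := by
      rw [show 3 * p = 2 * p + p by ring, pow_add, add_pow_char _ _ p, one_pow]
    rw [h3p] at hG'
    set S := sqChoosePoly (ZMod p) a
    set T := eulerDeriv (ZMod p) S
    set L1 := eulerDeriv (ZMod p) L
    set L2 := eulerDeriv (ZMod p) L1
    linear_combination (-(1 + X)) * hG'
      - (1 + X) ^ (2 * p) * (2 * C τ) * ((1 + X) * (1 - X ^ 2) * S) * hL2
      - (1 + X) ^ (2 * p) * (2 * C τ) * (2 * (1 + X) * ((1 - X ^ 2) * T + 2 * a * X ^ 2 * S)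
        - (1 - X ^ 2) * X * S) * hL
  · simp only [coeff_zero_eq_eval_zero] at hL0 ⊢
    simp only [eval_sub, eval_add, eval_mul, eval_finsetSum, hL0, eval_pow, eval_X, eval_C,
      zero_pow (Fact.out : p.Prime).ne_zero, zero_mul, mul_zero, add_zero, sub_zero]
    rw [sum_eq_zero, sum_eq_zero, mul_zero, sub_zero]
    · intro k _
      rcases k with _ | k <;> simp [hd0]
    · intro k _
      rcases k with _ | k <;> simp [hd0]
  · intro m hm
    have hp1 := (Fact.out : p.Prime).pos
    have h2 : (2 : (ZMod p)[X]) = C 2 := by simp [map_ofNat]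
    have hSdeg : (sqChoosePoly (ZMod p) a).natDegree ≤ 2 * a := by
      refine natDegree_sum_le_of_forall_le _ _ fun k hk => ?_
      have hk : k ≤ a := by simpa [Nat.lt_succ_iff] using hk
      exact (natDegree_C_mul_X_pow_le _ _).trans (by omega)
    have hSL : (sqChoosePoly (ZMod p) a * L).coeff m = 0 := by
      rcases eq_or_ne L 0 with rfl | hL0
      · simp
      · have := (natDegree_lt_iff_degree_lt hL0).2 hLdeg
        have := natDegree_mul_le (p := sqChoosePoly (ZMod p) a) (q := L)
        exact coeff_eq_zero_of_natDegree_lt (by omega)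
    rw [coeff_sub, coeff_sub, coeff_add, h2, coeff_C_mul, coeff_X_pow_mul', if_pos (by omega),
      coeff_C_mul, coeff_C_mul, hSL, finsetSum_coeff, finsetSum_coeff, finsetSum_coeff,
      sum_eq_zero, sum_eq_zero, sum_eq_zero]
    · simp
    · intro k hk
      have hk : k < p := by simpa using hk
      rcases lt_or_ge (2 * k) p with h | h
      · rcases Nat.eq_zero_or_pos k with rfl | hk0
        · simp [hd0]
        · rw [coeff_C_mul]
          have : (X ^ k * (1 + X) ^ (2 * a + p - 2 * k) : (ZMod p)[X]).natDegree
              ≤ k + (2 * a + p - 2 * k) * 1 :=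
            natDegree_mul_le_of_le (natDegree_X_pow_le k) (natDegree_pow_le_of_le _
              (natDegree_add_le_of_degree_le (by simp) natDegree_X_le))
          rw [coeff_eq_zero_of_natDegree_lt (by omega), mul_zero]
      · rw [centralBinom_cast_eq_zero p hk h]; simp
    · intro k hk
      have hk : k ≤ a := by simpa [Nat.lt_succ_iff] using hk
      rcases Nat.eq_zero_or_pos k with rfl | hk0
      · simp [hd0]
      · rw [coeff_C_mul_X_pow, if_neg (by omega)]
    · intro k hk
      have hk : k ≤ a := by simpa [Nat.lt_succ_iff] using hk
      rw [coeff_C_mul_X_pow, if_neg (by omega)]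

theorem exists_one_add_X_pow_eq (p : ℕ) [Fact p.Prime] :
    ∃ L : ℤ[X], (1 + X) ^ p = 1 + X ^ p + (p : ℤ[X]) * L ∧ L.coeff 0 = 0 ∧ L.degree < p ∧
      (1 + X) * eulerDeriv (ZMod p) (L.map (Int.castRingHom (ZMod p))) = X - X ^ p := by
  obtain ⟨r, hr⟩ := exists_add_pow_prime_eq (Fact.out : p.Prime) (1 : ℤ[X]) X
  have hp1 := (Fact.out : p.Prime).pos
  have hpZ : (p : ℤ) ≠ 0 := by exact_mod_cast hp1.ne'
  have hpP : (p : ℤ[X]) ≠ 0 := by exact_mod_cast hp1.ne'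
  have hL : (1 + X : ℤ[X]) ^ p = 1 + X ^ p + (p : ℤ[X]) * (X * r) := by
    rw [hr, one_pow]; ring
  refine ⟨X * r, hL, by simp, ?_, ?_⟩
  · rw [degree_lt_iff_coeff_zero]
    intro m hm
    have h := congrArg (fun f => coeff f m) hL
    have hc : (p : ℤ[X]) = C (p : ℤ) := by simp
    simp only [coeff_add, hc, coeff_C_mul, coeff_one_add_X_pow, coeff_X_pow, coeff_one] at h
    rw [if_neg (show m ≠ 0 by omega)] at h
    rcases eq_or_lt_of_le hm with h1 | h1
    · subst h1
      simpa [hp1.ne'] using h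
    · rw [Nat.choose_eq_zero_of_lt h1, if_neg (by omega)] at h
      simpa [hp1.ne'] using h
  · have h : (1 + X) * eulerDeriv ℤ (X * r) = X * (1 + X) ^ p - X ^ p * (1 + X) := by
      apply mul_left_cancel₀ hpP
      have h1 := congrArg (eulerDeriv ℤ) hL
      rw [map_add, map_add, eulerDeriv_mul, eulerDeriv_natCast, eulerDeriv_X_pow,
        Derivation.map_one_eq_zero] at h1
      linear_combination one_add_X_mul_eulerDeriv_pow (R := ℤ) p - (1 + X) * h1
    have := congrArg (Polynomial.map (Int.castRingHom (ZMod p))) h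
    rw [eulerDeriv_apply] at this ⊢
    rw [derivative_map]
    simp only [Polynomial.map_mul, Polynomial.map_add, Polynomial.map_sub, Polynomial.map_pow,
      Polynomial.map_one, map_X] at this ⊢
    rw [this, add_pow_char _ _ p, one_pow]
    ring
end

section
open Polynomial Finset

theorem toZMod_eq_zero_iff {p : ℕ} [Fact p.Prime] (x : ℤ_[p]) :
    PadicInt.toZMod x = 0 ↔ (p : ℤ_[p]) ∣ x := by
  rw [← RingHom.mem_ker, PadicInt.ker_toZMod, PadicInt.maximalIdeal_eq_span_p,
    Ideal.mem_span_singleton]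

theorem natCast_dvd_one_sub_pow {p : ℕ} [Fact p.Prime] {u : ℤ_[p]} (hu : IsUnit u) :
    ∃ q : ℤ_[p], u ^ (p - 1) = 1 + p * q := by
  have h : (p : ℤ_[p]) ∣ u ^ (p - 1) - 1 := by
    rw [← toZMod_eq_zero_iff, map_sub, map_pow, map_one,
      ZMod.pow_card_sub_one_eq_one (hu.map PadicInt.toZMod).ne_zero, sub_self]
  obtain ⟨q, hq⟩ := h
  exact ⟨q, by linear_combination hq⟩

theorem exists_neg_eq_res_add {p : ℕ} [Fact p.Prime] (α : ℤ_[p]) :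
    ∃ (t : ℕ) (τ : ℤ_[p]), -α = res p (-α) + p * τ ∧ PadicInt.toZMod τ = t ∧
      1 - 2 * lam2 p α = ((1 + 2 * res p (-α) + 2 * t * (p - 1) : ℕ) : ℤ) := by
  have hp1 := (Fact.out : p.Prime).pos
  have hpP : (p : ℤ_[p]) ≠ 0 := by exact_mod_cast hp1.ne'
  obtain ⟨y, hy⟩ : ∃ y, -α = res2 p (-α) + p ^ 2 * y := by
    have : -α - res2 p (-α) ∈ RingHom.ker (PadicInt.toZModPow (p := p) 2) := by
      have : NeZero (p ^ 2) := ⟨by positivity⟩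
      rw [RingHom.mem_ker, map_sub, map_natCast, res2, ZMod.natCast_zmod_val, sub_self]
    rw [PadicInt.ker_toZModPow, Ideal.mem_span_singleton] at this
    obtain ⟨y, hy⟩ := this
    exact ⟨y, by linear_combination hy⟩
  have hmod : res p (-α) = res2 p (-α) % p := by
    have h := congrArg PadicInt.toZMod hy
    rw [map_add, map_mul, map_pow, map_natCast, map_natCast, ZMod.natCast_self,
      zero_pow two_ne_zero, zero_mul, add_zero] at h
    rw [res, h, ZMod.val_natCast]
  have hdiv := Nat.mod_add_div (res2 p (-α)) p
  rw [← hmod] at hdiv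
  refine ⟨res2 p (-α) / p, (res2 p (-α) / p : ℕ) + p * y, ?_, by simp, ?_⟩
  · have := congrArg (Nat.cast : ℕ → ℤ_[p]) hdiv
    push_cast at this
    linear_combination hy - this
  · have h := congrArg (Nat.cast : ℕ → ℤ) hdiv
    simp only [Nat.cast_add, Nat.cast_mul] at h
    have h2 : ((res p (-α) : ℤ) - (res2 p (-α) : ℤ)) / (p : ℤ) = -((res2 p (-α) / p : ℕ) : ℤ) := by
      apply Int.ediv_eq_of_eq_mul_left (by exact_mod_cast hp1.ne')
      linear_combination h
    rw [lam2, h2]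
    simp only [Nat.cast_add, Nat.cast_mul, Nat.cast_sub (show 1 ≤ p from hp1), Nat.cast_one,
      Nat.cast_ofNat]
    ring

theorem isUnit_natCast_of_pos_of_lt {p : ℕ} [Fact p.Prime] {n : ℕ} (h0 : 0 < n) (h : n < p) :
    IsUnit (n : ℤ_[p]) := by
  rw [PadicInt.isUnit_iff, PadicInt.norm_natCast_eq_one_iff]
  exact Nat.coprime_of_lt_prime h0.ne' h Fact.out

theorem isUnit_factorial_of_lt {p : ℕ} [Fact p.Prime] {n : ℕ} (h : n < p) :
    IsUnit (n.factorial : ℤ_[p]) := by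
  rw [PadicInt.isUnit_iff, PadicInt.norm_natCast_eq_one_iff]
  exact (Fact.out : p.Prime).coprime_factorial_of_lt h

/-- The binomial coefficients `(-α choose k)`, `k < p`, expanded to first order in `p` around
`(a choose k)` when `-α = a + p τ`. -/
theorem exists_ascPochhammer_eq {p : ℕ} [Fact p.Prime] (α τ : ℤ_[p]) (a : ℕ)
    (hα : -α = a + p * τ) :
    ∃ δ : ℕ → ℤ_[p], δ 0 = 0 ∧
      (∀ k < p, (ascPochhammer ℤ_[p] k).eval α
        = (-1) ^ k * k.factorial * ((a.choose k : ℤ_[p]) + p * δ k)) ∧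
      ∀ k, k + 1 < p → ((k : ZMod p) + 1) * PadicInt.toZMod (δ (k + 1))
        = (a - k : ZMod p) * PadicInt.toZMod (δ k) + PadicInt.toZMod τ * a.choose k := by
  have hp1 := (Fact.out : p.Prime).pos
  have hpP : (p : ℤ_[p]) ≠ 0 := by exact_mod_cast hp1.ne'
  have main : ∀ k, ∃ δ : ℤ_[p], (k = 0 → δ = 0) ∧ (k < p → (ascPochhammer ℤ_[p] k).eval α
        = (-1) ^ k * k.factorial * ((a.choose k : ℤ_[p]) + p * δ)) := by
    intro k
    induction k with
    | zero => exact ⟨0, by simp⟩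
    | succ k ih =>
      obtain ⟨δ, -, hδ⟩ := ih
      rcases lt_or_ge (k + 1) p with h | h
      · obtain ⟨u, hu⟩ := (isUnit_natCast_of_pos_of_lt (p := p) (Nat.succ_pos k) h).exists_right_inv
        refine ⟨u * ((a - k) * δ + τ * a.choose k + p * τ * δ), by simp, fun _ => ?_⟩
        rw [ascPochhammer_succ_eval, hδ (by omega), Nat.factorial_succ]
        have hc := natCast_succ_mul_choose_succ (R := ℤ_[p]) a k
        push_cast at hu ⊢
        rw [pow_succ (-1 : ℤ_[p])]
        have hα' : α = -(a + p * τ) := by rw [← hα, neg_neg]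
        rw [hα']
        linear_combination ((-1) ^ k * k.factorial) * hc + ((-1) ^ k * k.factorial
          * p * ((a - k) * δ + τ * a.choose k + p * τ * δ)) * hu
      · exact ⟨0, by simp, fun h' => by omega⟩
  choose δ hδ0 hδ using main
  refine ⟨δ, hδ0 0 rfl, hδ, fun k hk => ?_⟩
  have h1 := hδ (k + 1) hk
  rw [ascPochhammer_succ_eval, hδ k (by omega), Nat.factorial_succ] at h1
  have hα' : α = -(a + p * τ) := by rw [← hα, neg_neg]
  have hc := natCast_succ_mul_choose_succ (R := ℤ_[p]) a k
  have hu : (-1) ^ k * (k.factorial : ℤ_[p]) * p ≠ 0 :=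
    mul_ne_zero (mul_ne_zero (by simp) (isUnit_factorial_of_lt (by omega)).ne_zero) hpP
  have h2 : ((k : ℤ_[p]) + 1) * δ (k + 1)
      = (a - k) * δ k + τ * a.choose k + p * τ * δ k := by
    apply mul_left_cancel₀ hu
    push_cast at h1
    rw [pow_succ (-1 : ℤ_[p]), hα'] at h1
    linear_combination h1 - ((-1) ^ k * k.factorial) * hc
  have := congrArg PadicInt.toZMod h2
  simpa using this

theorem sum_range_prime_eq {R : Type*} [CommRing R] {a p : ℕ} (ha : a < p) (g : ℕ → R) :
    ∑ k ∈ range p, (a.choose k : R) * g k = ∑ k ∈ range (a + 1), (a.choose k : R) * g k := by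
  symm
  apply sum_subset (range_subset_range.2 ha)
  intro k _ hk
  rw [Nat.choose_eq_zero_of_lt (by simpa using hk)]
  simp

theorem eval_sqChoosePoly {R : Type*} [CommRing R] (a : ℕ) (x : R) :
    (sqChoosePoly R a).eval x = ∑ k ∈ range (a + 1), (a.choose k : R) ^ 2 * x ^ (2 * k) := by
  simp [sqChoosePoly, eval_finsetSum]

theorem sq_dvd_padicInt {p : ℕ} [Fact p.Prime] (hp : Odd p) (a t : ℕ) (ha : a < p)
    (z u v : ℤ_[p]) (hu : z * u = 1) (hv : (1 + z) * v = 1) (δ : ℕ → ℤ_[p]) (hδ0 : δ 0 = 0)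
    (hδ : ∀ k, k + 1 < p → ((k : ZMod p) + 1) * PadicInt.toZMod (δ (k + 1))
        = (a - k : ZMod p) * PadicInt.toZMod (δ k) + t * a.choose k) :
    (p : ℤ_[p]) ^ 2 ∣ ∑ k ∈ range p, ((a.choose k : ℤ_[p]) + p * δ k) ^ 2 * z ^ (2 * k)
      + z ^ (1 + 2 * a + 2 * t * (p - 1))
        * ∑ k ∈ range p, ((a.choose k : ℤ_[p]) + p * δ k) ^ 2 * u ^ (2 * k)
      - (1 + z) ^ (1 + 2 * a + 2 * t * (p - 1))
        * ∑ k ∈ range p, (-1) ^ k * (Nat.centralBinom k : ℤ_[p])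
          * ((a.choose k : ℤ_[p]) + p * δ k) * (z * v ^ 2) ^ k := by
  have hp1 := (Fact.out : p.Prime).pos
  have hpP : (p : ℤ_[p]) ≠ 0 := by exact_mod_cast hp1.ne'
  obtain ⟨Q, hQ⟩ := natCast_dvd_one_sub_pow (IsUnit.of_mul_eq_one _ hu)
  obtain ⟨R, hR⟩ := natCast_dvd_one_sub_pow (IsUnit.of_mul_eq_one _ hv)
  obtain ⟨L, hL, hL0, hLdeg, hLD⟩ := exists_one_add_X_pow_eq p
  have hkey := first_order_identity p hp a ha t (fun k => PadicInt.toZMod (δ k)) (by simp [hδ0]) hδ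
    (L.map (Int.castRingHom (ZMod p))) hLD (by simp [hL0]) (degree_map_le.trans_lt hLdeg)
  set S : ℤ_[p] := ∑ k ∈ range (a + 1), (a.choose k : ℤ_[p]) ^ 2 * z ^ (2 * k) with hS
  set D : ℤ_[p] := ∑ k ∈ range (a + 1), (a.choose k : ℤ_[p]) * δ k * z ^ (2 * k) with hD
  set D' : ℤ_[p] := ∑ k ∈ range (a + 1), (a.choose k : ℤ_[p]) * δ k * z ^ (2 * (a - k)) with hD'
  set G : ℤ_[p] := (1 + z) ^ (2 * a) * ∑ k ∈ range p, (-1) ^ k * (Nat.centralBinom k : ℤ_[p])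
    * δ k * (z * v ^ 2) ^ k with hG
  set l : ℤ_[p] := L.eval₂ (Int.castRingHom ℤ_[p]) z with hl
  have hA : ∑ k ∈ range p, ((a.choose k : ℤ_[p]) + p * δ k) ^ 2 * z ^ (2 * k)
      = S + 2 * p * D + p ^ 2 * ∑ k ∈ range p, δ k ^ 2 * z ^ (2 * k) := by
    have h1 := sum_range_prime_eq ha fun k => (a.choose k : ℤ_[p]) * z ^ (2 * k)
    have h2 := sum_range_prime_eq ha fun k => δ k * z ^ (2 * k)
    simp only [← mul_assoc, ← sq] at h1 h2
    rw [hS, hD, ← h1, ← h2, mul_sum, mul_sum, ← sum_add_distrib, ← sum_add_distrib]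
    exact sum_congr rfl fun k _ => by ring
  have hzu : ∀ k, k ≤ a → z ^ (2 * a) * u ^ (2 * k) = z ^ (2 * (a - k)) := by
    intro k hk
    have : 2 * a = 2 * (a - k) + 2 * k := by omega
    rw [this, pow_add, mul_assoc, ← mul_pow, hu, one_pow, mul_one]
  have hA' : z ^ (2 * a) * ∑ k ∈ range p, ((a.choose k : ℤ_[p]) + p * δ k) ^ 2 * u ^ (2 * k)
      = S + 2 * p * D' + p ^ 2 * (z ^ (2 * a) * ∑ k ∈ range p, δ k ^ 2 * u ^ (2 * k)) := by
    have h1 := sum_range_prime_eq ha fun k => (a.choose k : ℤ_[p]) * (z ^ (2 * a) * u ^ (2 * k))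
    have h2 := sum_range_prime_eq ha fun k => δ k * (z ^ (2 * a) * u ^ (2 * k))
    have h3 : S = ∑ k ∈ range (a + 1),
        (a.choose k : ℤ_[p]) * ((a.choose k : ℤ_[p]) * (z ^ (2 * a) * u ^ (2 * k))) := by
      rw [hS, ← sum_flip]
      refine sum_congr rfl fun k hk => ?_
      have hk : k ≤ a := by simpa [Nat.lt_succ_iff] using hk
      rw [hzu k hk, Nat.choose_symm hk]; ring
    have h4 : D' = ∑ k ∈ range (a + 1),
        (a.choose k : ℤ_[p]) * (δ k * (z ^ (2 * a) * u ^ (2 * k))) := by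
      refine sum_congr rfl fun k hk => ?_
      have hk : k ≤ a := by simpa [Nat.lt_succ_iff] using hk
      rw [hzu k hk]; ring
    rw [h3, h4, ← h1, ← h2, mul_sum, mul_sum, mul_sum, mul_sum, ← sum_add_distrib,
      ← sum_add_distrib]
    exact sum_congr rfl fun k _ => by ring
  have hT : (1 + z) ^ (2 * a) * ∑ k ∈ range p, (-1) ^ k * (Nat.centralBinom k : ℤ_[p])
      * ((a.choose k : ℤ_[p]) + p * δ k) * (z * v ^ 2) ^ k = S + p * G := by
    have h1 := sum_range_prime_eq ha fun k => (-1) ^ k * (Nat.centralBinom k : ℤ_[p])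
      * ((1 + z) ^ (2 * a) * (z * v ^ 2) ^ k)
    have h2 : S = ∑ k ∈ range (a + 1), (a.choose k : ℤ_[p]) * ((-1) ^ k
        * (Nat.centralBinom k : ℤ_[p]) * ((1 + z) ^ (2 * a) * (z * v ^ 2) ^ k)) := by
      rw [hS, ← eval_sqChoosePoly, sqChoosePoly, sum_sq_choose, eval_finsetSum]
      refine sum_congr rfl fun k hk => ?_
      have hk : k ≤ a := by simpa [Nat.lt_succ_iff] using hk
      have : (1 + z) ^ (2 * a) * (z * v ^ 2) ^ k = z ^ k * (1 + z) ^ (2 * a - 2 * k) := by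
        obtain ⟨b, rfl⟩ := Nat.exists_eq_add_of_le hk
        have e : 2 * (k + b) - 2 * k = 2 * b := by omega
        rw [e, mul_add, pow_add, mul_pow]
        have h5 : (1 + z) ^ (2 * k) * (v ^ 2) ^ k = 1 := by
          rw [← pow_mul, ← mul_pow, hv, one_pow]
        linear_combination (z ^ k * (1 + z) ^ (2 * b)) * h5
      rw [this]
      simp
      ring
    rw [h2, hG, ← h1, mul_sum, mul_sum, mul_sum, ← sum_add_distrib]
    exact sum_congr rfl fun k _ => by ring
  have hQR : (1 + z) * R - z * Q = l := by
    apply mul_left_cancel₀ hpP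
    have h1 := congrArg (eval₂ (Int.castRingHom ℤ_[p]) z) hL
    simp only [eval₂_add, eval₂_mul, eval₂_pow, eval₂_X, eval₂_one, eval₂_natCast] at h1
    have e : p = p - 1 + 1 := by omega
    have h2 : z ^ p = (1 + p * Q) * z := by rw [← hQ, ← pow_succ, ← e]
    have h3 : (1 + z) ^ p = (1 + p * R) * (1 + z) := by rw [← hR, ← pow_succ, ← e]
    rw [h2, h3] at h1
    linear_combination h1
  have hB : (p : ℤ_[p]) ∣ 2 * D + 2 * z * D' - 2 * t * (S * l) - (1 + z) * G := by
    rw [← toZMod_eq_zero_iff]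
    have hx := congrArg (eval (PadicInt.toZMod z)) hkey
    set x := PadicInt.toZMod z with hxz
    have hxv : (1 + x) * PadicInt.toZMod v = 1 := by
      rw [hxz, ← map_one PadicInt.toZMod, ← map_add, ← map_mul, hv]
    have hl' : PadicInt.toZMod l = (L.map (Int.castRingHom (ZMod p))).eval x := by
      rw [hl, hom_eval₂, eval_map]
      congr 1
      exact RingHom.ext_int _ _
    have hS' : PadicInt.toZMod S = (sqChoosePoly (ZMod p) a).eval x := by
      rw [eval_sqChoosePoly, hS]; simp [hxz]
    have hG' : PadicInt.toZMod ((1 + z) * G) = (∑ k ∈ range p,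
        C ((-1) ^ k * (Nat.centralBinom k : ZMod p) * PadicInt.toZMod (δ k))
          * (X ^ k * (1 + X) ^ (2 * a + p - 2 * k))).eval x := by
      rw [eval_finsetSum, hG, ← mul_assoc, map_mul, map_sum, mul_sum]
      refine sum_congr rfl fun k hk => ?_
      have hk : k < p := by simpa using hk
      rcases lt_or_ge (2 * k) p with h | h
      · obtain ⟨b, hb⟩ : ∃ b, 2 * a + p = 2 * k + b :=
          ⟨2 * a + p - 2 * k, by omega⟩
        have e : 2 * a + p - 2 * k = b := by omega
        have h6 : (1 + x) * (1 + x) ^ (2 * a) = (1 + x) ^ (2 * k) * (1 + x) ^ b := by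
          rw [← pow_add, ← hb, pow_add, ZMod.pow_card]; ring
        have h5 : (1 + x) ^ (2 * k) * ((PadicInt.toZMod v) ^ 2) ^ k = 1 := by
          rw [← pow_mul, ← mul_pow, hxv, one_pow]
        rw [e]
        simp only [map_mul, map_add, map_pow, map_one, map_neg, map_natCast, ← hxz, eval_mul,
          eval_C, eval_pow, eval_X, eval_add, eval_one, h6, mul_pow x]
        simp only [eval_neg, eval_one, eval_natCast]
        linear_combination ((-1) ^ k * (Nat.centralBinom k : ZMod p) * PadicInt.toZMod (δ k)
          * x ^ k * (1 + x) ^ b) * h5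
      · simp [centralBinom_cast_eq_zero p hk h]
    rw [map_sub, hG', ← hx]
    simp only [eval_sub, eval_add, eval_mul, eval_C, eval_pow, eval_X, eval_finsetSum,
      eval_ofNat, ZMod.pow_card]
    simp only [map_sub, map_add, map_mul, hS', hl', ← hxz, hD, hD', map_sum, map_pow,
      map_natCast, map_ofNat]
    ring
  obtain ⟨b, hb⟩ := hB
  obtain ⟨q, hq⟩ := powAddExpansion 1 (p * Q) (2 * t)
  obtain ⟨r, hr⟩ := powAddExpansion 1 (p * R) (2 * t)
  have hz : z ^ (1 + 2 * a + 2 * t * (p - 1)) = z * (1 + p * Q) ^ (2 * t) * z ^ (2 * a) := by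
    rw [← hQ, ← pow_mul]; ring
  have h1z : (1 + z) ^ (1 + 2 * a + 2 * t * (p - 1))
      = (1 + z) * (1 + p * R) ^ (2 * t) * (1 + z) ^ (2 * a) := by
    rw [← hR, ← pow_mul]; ring
  rw [hz, h1z, mul_assoc _ (z ^ (2 * a)), mul_assoc _ ((1 + z) ^ (2 * a)), hA, hA', hT, hq, hr]
  simp only [one_pow, mul_one, Nat.cast_mul, Nat.cast_ofNat]
  set r1 := ∑ k ∈ range p, δ k ^ 2 * z ^ (2 * k)
  set r2 := z ^ (2 * a) * ∑ k ∈ range p, δ k ^ 2 * u ^ (2 * k)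
  refine ⟨b + r1 + z * (r2 * (1 + 2 * t * (p * Q) + q * (p * Q) ^ 2) + 2 * t * Q * (2 * D')
    + q * Q ^ 2 * (S + 2 * p * D')) - (1 + z) * (2 * t * R * G + r * R ^ 2 * (S + p * G)), ?_⟩
  linear_combination (p : ℤ_[p]) * hb - (2 * t * p * S) * hQR

theorem four_pow_mul_poch_half (p : ℕ) [Fact p.Prime] (k : ℕ) :
    4 ^ k * poch p ((1 : ℚ_[p]) / 2) k = k.factorial * Nat.centralBinom k := by
  induction k with
  | zero => simp [poch]
  | succ k ih =>
    have h := natCast_succ_mul_centralBinom_succ (R := ℚ_[p]) k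
    rw [poch] at ih ⊢
    rw [ascPochhammer_succ_eval, Nat.factorial_succ]
    push_cast
    linear_combination (4 * (1 / 2 + k : ℚ_[p])) * ih - (k.factorial : ℚ_[p]) * h

theorem poch_coe (p : ℕ) [Fact p.Prime] (α : ℤ_[p]) (k : ℕ) :
    poch p (α : ℚ_[p]) k = ((ascPochhammer ℤ_[p] k).eval α : ℤ_[p]) := by
  rw [poch]
  induction k with
  | zero => simp
  | succ k ih => rw [ascPochhammer_succ_eval, ascPochhammer_succ_eval, ih]; push_cast; rfl

end

/-- p-adic analogue of `₂F₁[α,α;1|z²] = (1+z)^{−2α} ₂F₁[α,1/2;1|4z/(1+z)²]` mod `p²`. -/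
theorem padic_quadratic_transformation_V
    (p : ℕ) [Fact p.Prime] (hp : Odd p) (α z : ℤ_[p]) (hz : IsUnit (z * (1 + z))) :
    ‖(∑ k ∈ Finset.range p,
        poch p (α : ℚ_[p]) k ^ 2 / (Nat.factorial k : ℚ_[p]) ^ 2 * (z : ℚ_[p]) ^ (2 * k))
      + (z : ℚ_[p]) ^ (1 - 2 * lam2 p α) *
          ∑ k ∈ Finset.range p,
            poch p (α : ℚ_[p]) k ^ 2 / (Nat.factorial k : ℚ_[p]) ^ 2 * (z : ℚ_[p]) ^ (-(2 * k : ℤ))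
      - (1 + (z : ℚ_[p])) ^ (1 - 2 * lam2 p α) *
          ∑ k ∈ Finset.range p,
            poch p (α : ℚ_[p]) k * poch p ((1 : ℚ_[p]) / 2) k / (Nat.factorial k : ℚ_[p]) ^ 2
              * (4 * (z : ℚ_[p]) / (1 + (z : ℚ_[p])) ^ 2) ^ k‖
      ≤ (p : ℝ) ^ (-2 : ℤ) := by
  obtain ⟨t, τ, hα, hτ, hlam⟩ := exists_neg_eq_res_add α
  obtain ⟨δ, hδ0, hpoch, hδ⟩ := exists_ascPochhammer_eq α τ _ hα
  obtain ⟨u, hu⟩ := (isUnit_of_mul_isUnit_left hz).exists_right_inv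
  obtain ⟨v, hv⟩ := (isUnit_of_mul_isUnit_right hz).exists_right_inv
  rw [hτ] at hδ
  have ha : res p (-α) < p := ZMod.val_lt _
  have h := sq_dvd_padicInt hp (res p (-α)) t ha z u v hu hv δ hδ0 hδ
  rw [← Ideal.mem_span_singleton, ← PadicInt.norm_le_pow_iff_mem_span_pow, PadicInt.norm_def] at h
  have hu' : (z : ℚ_[p]) * u = 1 := by exact_mod_cast congrArg ((↑) : ℤ_[p] → ℚ_[p]) hu
  have hv' : (1 + z : ℚ_[p]) * v = 1 := by exact_mod_cast congrArg ((↑) : ℤ_[p] → ℚ_[p]) hv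
  have hu'' : (z : ℚ_[p])⁻¹ = u := inv_eq_of_mul_eq_one_right hu'
  have hv'' : (1 + z : ℚ_[p])⁻¹ = v := inv_eq_of_mul_eq_one_right hv'
  have hf : ∀ k : ℕ, (k.factorial : ℚ_[p]) ≠ 0 := fun k => by exact_mod_cast k.factorial_ne_zero
  have hsq : ∀ k ∈ Finset.range p, poch p (α : ℚ_[p]) k ^ 2 / (Nat.factorial k : ℚ_[p]) ^ 2
      = (((res p (-α)).choose k : ℚ_[p]) + p * δ k) ^ 2 := by
    intro k hk
    rw [poch_coe, hpoch k (by simpa using hk), div_eq_iff (pow_ne_zero 2 (hf k))]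
    push_cast
    rw [mul_pow, mul_pow, ← pow_mul, mul_comm k 2, pow_mul]
    ring
  rw [show (-2 : ℤ) = -((2 : ℕ) : ℤ) from rfl]
  convert h using 2
  rw [hlam, zpow_natCast, zpow_natCast]
  simp only [PadicInt.coe_add, PadicInt.coe_sub, PadicInt.coe_mul, PadicInt.coe_pow,
    PadicInt.coe_one, PadicInt.coe_sum, PadicInt.coe_natCast, PadicInt.coe_neg]
  congr 1
  · congr 1
    · exact Finset.sum_congr rfl fun k hk => by rw [hsq k hk]
    · congr 1
      refine Finset.sum_congr rfl fun k hk => ?_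
      rw [hsq k hk, ← hu'', zpow_neg, inv_pow]
      norm_cast
  · congr 1
    refine Finset.sum_congr rfl fun k hk => ?_
    have h4 := four_pow_mul_poch_half p k
    have h5 : (4 * (z : ℚ_[p]) / (1 + z) ^ 2) ^ k = 4 ^ k * (z * v ^ 2 : ℚ_[p]) ^ k := by
      rw [div_eq_mul_inv, ← inv_pow, hv'', mul_assoc, mul_pow]
    rw [poch_coe, hpoch k (by simpa using hk), h5, div_mul_eq_mul_div,
      div_eq_iff (pow_ne_zero 2 (hf k))]
    push_cast
    linear_combination ((-1) ^ k * (k.factorial : ℚ_[p])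
      * (((res p (-α)).choose k : ℚ_[p]) + p * δ k) * (z * v ^ 2) ^ k) * h4
end

section
/- Let p be an odd prime and α, z ∈ ℤ_p such that z(1−z) is a unit of ℤ_p. Set λ = λ_p^{(2)}(α). Then ∑_{k=0}^{p−1} (α)_k²/(k!)² · z^{2k} − z^{1−2λ} · ∑_{k=0}^{p−1} (α)_k²/(k!)² · z^{−2k} ≡ (1−z)^{1−2λ} · ∑_{k=0}^{p−1} (α)_k(1/2)_k/(k!)² · (−4z/(1−z)²)^k (mod p²). -/
open scoped BigOperators

open Polynomial in
/-- Comparison of the coefficients of `X ^ a` in the two expansions of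
`((1 + z² X) (1 + X)) ^ N = ((1 - z)² X + (1 + z X)²) ^ N`. -/
theorem sum_choose_mul_choose_eq {R : Type*} [CommRing R] (z : R) {N a : ℕ} (h : a ≤ N) :
    ∑ j ∈ Finset.range (a + 1), (N.choose (a - j) : R) * ((2 * (N - a) + 2 * j).choose j : R)
        * z ^ j * (1 - z) ^ (2 * (a - j))
      = ∑ k ∈ Finset.range (a + 1), (N.choose k : R) * (N.choose (a - k) : R) * z ^ (2 * k) := by
  have lin (M : ℕ) (w : R) (j : ℕ) :
      ((1 + C w * X : R[X]) ^ M).coeff j = (M.choose j : R) * w ^ j := by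
    have : (1 + C w * X : R[X]) ^ M = ((1 + X) ^ M : R[X]).comp (C w * X) := by simp
    rw [this, comp_C_mul_X_coeff, coeff_one_add_X_pow]
  have key : (1 + C (z ^ 2) * X : R[X]) ^ N * (1 + C 1 * X) ^ N
      = (X * C ((1 - z) ^ 2) + (1 + C z * X) ^ 2) ^ N := by
    rw [← mul_pow]; congr 1; simp only [map_pow, map_sub, map_one]; ring
  have term (m : ℕ) : ((X * C ((1 - z) ^ 2)) ^ m * ((1 + C z * X : R[X]) ^ 2) ^ (N - m)
        * (N.choose m : R[X])).coeff a
      = if m < a + 1 then (N.choose m : R) * ((2 * (N - m)).choose (a - m) : R) * z ^ (a - m)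
          * (1 - z) ^ (2 * m) else 0 := by
    rw [mul_pow, ← C_pow, ← pow_mul, ← pow_mul, ← map_natCast (C : R →+* R[X]), coeff_mul_C, mul_assoc,
      coeff_X_pow_mul', coeff_C_mul, lin]
    simp only [Nat.lt_succ_iff]
    split_ifs <;> ring
  have hc := congrArg (fun q => q.coeff a) key
  simp only [coeff_mul (p := (1 + C (z ^ 2) * X : R[X]) ^ N), lin, one_pow, mul_one,
    add_pow (X * C _), finsetSum_coeff, term] at hc
  rw [Finset.Nat.sum_antidiagonal_eq_sum_range_succ
    (fun i j => (N.choose i : R) * (z ^ 2) ^ i * (N.choose j : R)), ← Finset.sum_filter] at hc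
  have hf : (Finset.range (N + 1)).filter (fun m => m < a + 1) = Finset.range (a + 1) := by
    ext m; simp only [Finset.mem_filter, Finset.mem_range]; omega
  rw [hf] at hc
  refine Eq.trans ?_ (hc.symm.trans ?_)
  · rw [← Finset.sum_range_reflect]
    refine Finset.sum_congr rfl fun j hj => ?_
    have hj' : j ≤ a := Nat.lt_succ_iff.1 (Finset.mem_range.1 hj)
    rw [show a + 1 - 1 - j = a - j by omega, show a - (a - j) = j by omega,
      show 2 * (N - a) + 2 * (a - j) = 2 * (N - j) by omega]
  · refine Finset.sum_congr rfl fun k _ => ?_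
    rw [pow_mul]; ring

theorem factorial_mul_ascFactorial_eq_sq {R : Type*} [CommRing R] {p : ℕ} (h0 : (p : R) ^ 2 = 0)
    (j : ℕ) :
    (j.factorial : R) * ((2 * p + 1).ascFactorial j : R) = ((p + 1).ascFactorial j : R) ^ 2 := by
  induction j with
  | zero => simp
  | succ j ih =>
    rw [Nat.factorial_succ, Nat.ascFactorial_succ, Nat.ascFactorial_succ]
    push_cast
    linear_combination (j + 1 : R) * (2 * p + 1 + j) * ih
      - ((p + 1).ascFactorial j : R) ^ 2 * h0

theorem natCast_sq_eq_zero {p : ℕ} : (p : ZMod (p ^ 2)) ^ 2 = 0 := by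
  rw [← Nat.cast_pow]; exact ZMod.natCast_self _

/-- The case where the parameter is `-a` for a natural number `a < p`. -/
theorem quadratic_transformation_of_lt {p a : ℕ} (ha : a < p) {z zi vi : ZMod (p ^ 2)}
    (hzi : z * zi = 1) (hvi : (1 - z) * vi = 1) :
    ∑ k ∈ Finset.range p, (a.choose k : ZMod (p ^ 2)) ^ 2 * z ^ (2 * k)
      - z ^ (1 + 2 * a) * ∑ k ∈ Finset.range p, (a.choose k : ZMod (p ^ 2)) ^ 2 * zi ^ (2 * k)
      - (1 - z) ^ (1 + 2 * a) * ∑ k ∈ Finset.range p,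
          (a.choose k : ZMod (p ^ 2)) * (k.centralBinom : ZMod (p ^ 2)) * (z ^ k * vi ^ (2 * k)) = 0 := by
  have trunc (f : ℕ → ZMod (p ^ 2)) (hf : ∀ k, a < k → f k = 0) :
      ∑ k ∈ Finset.range p, f k = ∑ k ∈ Finset.range (a + 1), f k := by
    refine (Finset.sum_subset (Finset.range_mono ha) fun k _ hk => hf k ?_).symm
    simpa using hk
  rw [trunc, trunc, trunc]
  rotate_left
  iterate 3
    intro k hk
    simp [Nat.choose_eq_zero_of_lt hk]
  have h1 := sum_choose_mul_choose_eq z le_rfl (N := a)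
  have h2 : z ^ (1 + 2 * a) * ∑ k ∈ Finset.range (a + 1),
        (a.choose k : ZMod (p ^ 2)) ^ 2 * zi ^ (2 * k)
      = z * ∑ k ∈ Finset.range (a + 1), (a.choose k : ZMod (p ^ 2)) ^ 2 * z ^ (2 * k) := by
    rw [← Finset.sum_range_reflect (n := a + 1) (fun k => (a.choose k : ZMod (p ^ 2)) ^ 2 * z ^ (2 * k)),
      Finset.mul_sum, Finset.mul_sum]
    refine Finset.sum_congr rfl fun k hk => ?_
    have hk' : k ≤ a := Nat.lt_succ_iff.1 (Finset.mem_range.1 hk)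
    rw [show a + 1 - 1 - k = a - k by omega, Nat.choose_symm hk',
      show 1 + 2 * a = 1 + 2 * (a - k) + 2 * k by omega, pow_add _ _ (2 * k)]
    have : z ^ (2 * k) * zi ^ (2 * k) = 1 := by rw [← mul_pow, hzi, one_pow]
    linear_combination (z ^ (1 + 2 * (a - k)) * (a.choose k : ZMod (p ^ 2)) ^ 2) * this
  have h3 : (1 - z) ^ (1 + 2 * a) * ∑ k ∈ Finset.range (a + 1),
        (a.choose k : ZMod (p ^ 2)) * (k.centralBinom : ZMod (p ^ 2)) * (z ^ k * vi ^ (2 * k))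
      = (1 - z) * ∑ k ∈ Finset.range (a + 1), (a.choose k : ZMod (p ^ 2)) ^ 2 * z ^ (2 * k) := by
    have h4 : ∑ k ∈ Finset.range (a + 1), (a.choose k : ZMod (p ^ 2)) ^ 2 * z ^ (2 * k)
        = ∑ k ∈ Finset.range (a + 1), (a.choose k : ZMod (p ^ 2)) * (a.choose (a - k) : ZMod (p ^ 2))
            * z ^ (2 * k) := by
      refine Finset.sum_congr rfl fun k hk => ?_
      rw [Nat.choose_symm (Nat.lt_succ_iff.1 (Finset.mem_range.1 hk))]
      ring
    rw [h4, ← h1, Finset.mul_sum, Finset.mul_sum]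
    refine Finset.sum_congr rfl fun k hk => ?_
    have hk' : k ≤ a := Nat.lt_succ_iff.1 (Finset.mem_range.1 hk)
    rw [Nat.choose_symm hk', Nat.sub_self, mul_zero, zero_add, Nat.centralBinom,
      show 1 + 2 * a = 1 + 2 * (a - k) + 2 * k by omega, pow_add _ _ (2 * k)]
    have : (1 - z) ^ (2 * k) * vi ^ (2 * k) = 1 := by rw [← mul_pow, hvi, one_pow]
    linear_combination ((1 - z) ^ (1 + 2 * (a - k)) * (a.choose k : ZMod (p ^ 2))
      * ((2 * k).choose k : ZMod (p ^ 2)) * z ^ k) * this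
  rw [h2, h3]; ring

section ZModSq

variable {p : ℕ} [Fact p.Prime]

theorem isUnit_factorial {k : ℕ} (h : k < p) : IsUnit (k.factorial : ZMod (p ^ 2)) := by
  rw [ZMod.isUnit_iff_coprime]
  exact Nat.Coprime.pow_right 2 ((Fact.out : p.Prime).coprime_iff_not_dvd.2 fun hd =>
    h.not_ge (((Fact.out : p.Prime).dvd_factorial).1 hd)).symm

theorem choose_two_mul_self : ((2 * p).choose p : ZMod (p ^ 2)) = 2 := by
  have hp : p.Prime := Fact.out
  rw [← Nat.sum_range_choose_sq, Finset.sum_range_succ, ← Nat.sub_one_add_one hp.ne_zero,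
    Finset.sum_range_succ', Nat.sub_one_add_one hp.ne_zero]
  push_cast
  rw [Finset.sum_eq_zero]
  · norm_num
  · intro i hi
    obtain ⟨c, hc⟩ := hp.dvd_choose_self (k := i + 1) (by omega)
      (by have := Finset.mem_range.1 hi; omega)
    rw [hc, Nat.cast_mul, mul_pow, natCast_sq_eq_zero, zero_mul]

theorem choose_two_mul_add {j : ℕ} (hj : j < p) :
    ((2 * (p + j)).choose (p + j) : ZMod (p ^ 2)) = 2 * ((2 * p + 2 * j).choose j : ZMod (p ^ 2)) := by
  set D := (p + 1).ascFactorial j with hD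
  have hDu : IsUnit ((D : ZMod (p ^ 2)) ^ 2) := by
    refine IsUnit.pow 2 ?_
    rw [ZMod.isUnit_iff_coprime]
    refine Nat.Coprime.pow_right 2 ?_
    clear_value D
    subst hD
    induction j with
    | zero => simp
    | succ j ih =>
      rw [Nat.ascFactorial_succ]
      refine Nat.Coprime.mul_left ?_ (ih (by omega))
      have := Nat.coprime_of_lt_prime (n := j + 1) (by omega) hj (Fact.out : p.Prime)
      rw [show p + 1 + j = p + (j + 1) by ring]
      simpa using this.symm
  have h1 := Nat.choose_mul_factorial_mul_factorial (n := 2 * (p + j)) (k := p + j) (by omega)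
  have h2 := Nat.choose_mul_factorial_mul_factorial (n := 2 * p + 2 * j) (k := j) (by omega)
  have h3 := Nat.choose_mul_factorial_mul_factorial (n := 2 * p) (k := p) (by omega)
  rw [show 2 * (p + j) - (p + j) = p + j by omega, ← Nat.factorial_mul_ascFactorial p j,
    ← hD] at h1
  rw [show 2 * p + 2 * j - j = 2 * p + j by omega, ← Nat.factorial_mul_ascFactorial (2 * p) j,
    ← h3, show 2 * p - p = p by omega, ← Nat.mul_add, ← h1] at h2
  have h4 : D ^ 2 * (2 * (p + j)).choose (p + j) = (2 * (p + j)).choose j * ((2 * p).choose p)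
      * (j.factorial * (2 * p + 1).ascFactorial j) := by
    refine Nat.eq_of_mul_eq_mul_left (pow_pos p.factorial_pos 2) ?_
    linarith
  have h5 := congrArg (Nat.cast : ℕ → ZMod (p ^ 2)) h4
  push_cast at h5
  rw [factorial_mul_ascFactorial_eq_sq natCast_sq_eq_zero, choose_two_mul_self, ← hD] at h5
  refine hDu.mul_left_cancel ?_
  rw [h5, Nat.mul_add]; ring

/-- Sequences in `ℤ/p²` that are affine in the index with slope divisible by `p`. -/
def IsAffineSeq (p : ℕ) (f : ℕ → ZMod (p ^ 2)) : Prop :=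
  ∃ c d : ZMod (p ^ 2), ∀ m : ℕ, f m = c + (m : ZMod (p ^ 2)) * ((p : ZMod (p ^ 2)) * d)

namespace IsAffineSeq

variable {p : ℕ} {f g : ℕ → ZMod (p ^ 2)}

theorem const (c : ZMod (p ^ 2)) : IsAffineSeq p fun _ => c := ⟨c, 0, by simp⟩

theorem sub (hf : IsAffineSeq p f) (hg : IsAffineSeq p g) : IsAffineSeq p fun m => f m - g m := by
  obtain ⟨c, d, h⟩ := hf
  obtain ⟨c', d', h'⟩ := hg
  exact ⟨c - c', d - d', fun m => by simp only [h, h']; ring⟩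

theorem mul (hf : IsAffineSeq p f) (hg : IsAffineSeq p g) : IsAffineSeq p fun m => f m * g m := by
  obtain ⟨c, d, h⟩ := hf
  obtain ⟨c', d', h'⟩ := hg
  refine ⟨c * c', c * d' + d * c', fun m => ?_⟩
  simp only [h, h']
  linear_combination (m * m * d * d' : ZMod (p ^ 2)) * natCast_sq_eq_zero (p := p)

theorem sum {ι : Type*} (s : Finset ι) {F : ι → ℕ → ZMod (p ^ 2)}
    (h : ∀ i ∈ s, IsAffineSeq p (F i)) : IsAffineSeq p fun m => ∑ i ∈ s, F i m := by
  classical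
  induction s using Finset.induction_on with
  | empty => exact ⟨0, 0, by simp⟩
  | insert i s hi ih =>
    obtain ⟨c, d, h1⟩ := h i (Finset.mem_insert_self i s)
    obtain ⟨c', d', h2⟩ := ih fun j hj => h j (Finset.mem_insert_of_mem hj)
    refine ⟨c + c', d + d', fun m => ?_⟩
    have h3 := h2 m
    simp only [Finset.sum_insert hi, h1] at h3 ⊢
    rw [h3]; ring

theorem eq_zero (hf : IsAffineSeq p f) (h0 : f 0 = 0) (h1 : f 1 = 0) (m : ℕ) : f m = 0 := by
  obtain ⟨c, d, h⟩ := hf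
  have hc := h 0
  have hd := h 1
  push_cast at hc hd
  rw [h]
  linear_combination (1 - m : ZMod (p ^ 2)) * (h0 - hc) + (m : ZMod (p ^ 2)) * (h1 - hd)

theorem pow {u d : ZMod (p ^ 2)} (hu : u = 1 + (p : ZMod (p ^ 2)) * d) : IsAffineSeq p fun m => u ^ m := by
  refine ⟨1, d, fun m => ?_⟩
  induction m with
  | zero => simp
  | succ m ih =>
    simp only [pow_succ] at ih ⊢
    rw [ih]
    push_cast
    rw [hu]
    linear_combination (m * d * d : ZMod (p ^ 2)) * natCast_sq_eq_zero (p := p)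

theorem choose [Fact p.Prime] (a : ℕ) {k : ℕ} (hk : k < p) :
    IsAffineSeq p fun m => ((a + m * p).choose k : ZMod (p ^ 2)) := by
  have hdesc (i : ℕ) : IsAffineSeq p fun m =>
      (descPochhammer (ZMod (p ^ 2)) i).eval ((a + m * p : ℕ) : ZMod (p ^ 2)) := by
    induction i with
    | zero => simpa using const 1
    | succ i ih =>
      simp only [descPochhammer_succ_eval]
      exact ih.mul ⟨a - i, 1, fun m => by push_cast; ring⟩
  obtain ⟨u, hu⟩ := isUnit_factorial (p := p) hk
  convert (const (↑u⁻¹ : ZMod (p ^ 2))).mul (hdesc k) using 2 with m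
  rw [descPochhammer_eval_eq_descFactorial, Nat.descFactorial_eq_factorial_mul_choose,
    Nat.cast_mul, ← hu, Units.inv_mul_cancel_left]

end IsAffineSeq

theorem exists_choose_add_prime (a : ℕ) {k : ℕ} (hk : k < p) :
    ∃ e : ZMod (p ^ 2), ((a + p).choose k : ZMod (p ^ 2)) =
      (a.choose k : ZMod (p ^ 2)) + (p : ZMod (p ^ 2)) * e := by
  obtain ⟨c, d, h⟩ := IsAffineSeq.choose a hk
  have h0 := h 0
  have h1 := h 1
  simp only [zero_mul, add_zero, one_mul, Nat.cast_zero, Nat.cast_one] at h0 h1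
  exact ⟨d, by rw [h0, h1]⟩

/-- The case where the parameter is `-(a + p)` for a natural number `a < p`. -/
theorem quadratic_transformation_add_prime {a : ℕ} (ha : a < p) {z zi vi d : ZMod (p ^ 2)}
    (hzi : z * zi = 1) (hvi : (1 - z) * vi = 1)
    (hd : z ^ (p - 1) = 1 + (p : ZMod (p ^ 2)) * d) :
    ∑ k ∈ Finset.range p, ((a + p).choose k : ZMod (p ^ 2)) ^ 2 * z ^ (2 * k)
      - z ^ (1 + 2 * (a + (p - 1))) * ∑ k ∈ Finset.range p,
          ((a + p).choose k : ZMod (p ^ 2)) ^ 2 * zi ^ (2 * k)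
      - (1 - z) ^ (1 + 2 * (a + (p - 1))) * ∑ k ∈ Finset.range p,
          ((a + p).choose k : ZMod (p ^ 2)) * (k.centralBinom : ZMod (p ^ 2))
            * (z ^ k * vi ^ (2 * k)) = 0 := by
  have hp : 0 < p := (Fact.out : p.Prime).pos
  set q := z ^ (p - 1) with hq
  have hzp : z ^ p = z * q := by rw [hq, ← pow_succ', Nat.sub_one_add_one hp.ne']
  set x : ℕ → ZMod (p ^ 2) := fun k => ((a + p).choose k : ZMod (p ^ 2)) with hx
  have hsq (c : ZMod (p ^ 2)) : ((p : ZMod (p ^ 2)) * c) ^ 2 = 0 := by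
    rw [mul_pow, natCast_sq_eq_zero, zero_mul]
  have trunc (w : ZMod (p ^ 2)) : ∑ k ∈ Finset.range p, x k ^ 2 * w ^ (2 * k)
      = ∑ k ∈ Finset.range (a + 1), x k ^ 2 * w ^ (2 * k) := by
    refine (Finset.sum_subset (Finset.range_mono ha) fun k hk hk' => ?_).symm
    obtain ⟨e, he⟩ := exists_choose_add_prime a (Finset.mem_range.1 hk)
    have hak : a < k := by simpa using hk'
    simp only [hx]
    rw [he, Nat.choose_eq_zero_of_lt hak, Nat.cast_zero, zero_add, hsq, zero_mul]
  set S := ∑ k ∈ Finset.range (a + 1), x k ^ 2 * z ^ (2 * k) with hS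
  set B := ∑ k ∈ Finset.range (a + 1), x (a - k) ^ 2 * z ^ (2 * k) with hB
  set A := ∑ k ∈ Finset.range (a + 1), x k * x (a - k) * z ^ (2 * k) with hA
  set V := ∑ k ∈ Finset.range p, x k * (k.centralBinom : ZMod (p ^ 2)) * (z ^ k * vi ^ (2 * k))
    with hV
  have hsquare : S - 2 * q * A + q ^ 2 * B = 0 := by
    have : S - 2 * q * A + q ^ 2 * B
        = ∑ k ∈ Finset.range (a + 1), (x k - q * x (a - k)) ^ 2 * z ^ (2 * k) := by
      rw [hS, hA, hB, Finset.mul_sum, Finset.mul_sum, ← Finset.sum_sub_distrib,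
        ← Finset.sum_add_distrib]
      exact Finset.sum_congr rfl fun k _ => by ring
    rw [this]
    refine Finset.sum_eq_zero fun k hk => ?_
    have hk' : k ≤ a := Nat.lt_succ_iff.1 (Finset.mem_range.1 hk)
    obtain ⟨e, he⟩ := exists_choose_add_prime a (hk'.trans_lt ha)
    obtain ⟨e', he'⟩ := exists_choose_add_prime a ((Nat.sub_le a k).trans_lt ha)
    rw [Nat.choose_symm hk'] at he'
    have h : x k - q * x (a - k) = (p : ZMod (p ^ 2)) *
        (e - e' - d * ((a.choose k : ZMod (p ^ 2)) + (p : ZMod (p ^ 2)) * e')) := by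
      simp only [hx]
      rw [he, he', hd]; ring
    rw [h, hsq, zero_mul]
  have hrefl : z ^ (1 + 2 * (a + (p - 1))) * ∑ k ∈ Finset.range (a + 1), x k ^ 2 * zi ^ (2 * k)
      = z * q ^ 2 * B := by
    rw [hB, ← Finset.sum_range_reflect (n := a + 1) (fun k => x (a - k) ^ 2 * z ^ (2 * k)),
      Finset.mul_sum, Finset.mul_sum]
    refine Finset.sum_congr rfl fun k hk => ?_
    have hk' : k ≤ a := Nat.lt_succ_iff.1 (Finset.mem_range.1 hk)
    have : z ^ (2 * k) * zi ^ (2 * k) = 1 := by rw [← mul_pow, hzi, one_pow]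
    rw [show a + 1 - 1 - k = a - k by omega, show a - (a - k) = k by omega,
      show 1 + 2 * (a + (p - 1)) = 1 + (p - 1) * 2 + 2 * (a - k) + 2 * k by omega,
      pow_add _ _ (2 * k), pow_add _ _ (2 * (a - k)), pow_add, pow_mul z (p - 1), ← hq]
    linear_combination (z * q ^ 2 * z ^ (2 * (a - k)) * x k ^ 2) * this
  have hU : (1 - z) * ((1 - z) ^ (1 + 2 * (a + (p - 1))) * V)
      = ∑ k ∈ Finset.range p, x k * (k.centralBinom : ZMod (p ^ 2)) * z ^ k
          * (1 - z) ^ (2 * (a + p - k)) := by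
    rw [hV, Finset.mul_sum, Finset.mul_sum]
    refine Finset.sum_congr rfl fun k hk => ?_
    have hk' := Finset.mem_range.1 hk
    have : (1 - z) ^ (2 * k) * vi ^ (2 * k) = 1 := by rw [← mul_pow, hvi, one_pow]
    rw [← mul_assoc, ← pow_succ',
      show 1 + 2 * (a + (p - 1)) + 1 = 2 * (a + p - k) + 2 * k by omega, pow_add]
    linear_combination ((1 - z) ^ (2 * (a + p - k)) * x k * (k.centralBinom : ZMod (p ^ 2))
      * z ^ k) * this
  have hfull := sum_choose_mul_choose_eq z le_rfl (N := a + p)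
  rw [show a + p + 1 = p + (a + 1) by omega, Finset.sum_range_add _ p (a + 1),
    Finset.sum_range_add _ p (a + 1)] at hfull
  have e1 : ∑ j ∈ Finset.range p, ((a + p).choose (a + p - j) : ZMod (p ^ 2)) *
        ((2 * (a + p - (a + p)) + 2 * j).choose j : ZMod (p ^ 2)) * z ^ j
          * (1 - z) ^ (2 * (a + p - j))
      = ∑ k ∈ Finset.range p, x k * (k.centralBinom : ZMod (p ^ 2)) * z ^ k
          * (1 - z) ^ (2 * (a + p - k)) := by
    refine Finset.sum_congr rfl fun k hk => ?_
    have hk' := Finset.mem_range.1 hk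
    rw [Nat.choose_symm (by omega), Nat.sub_self, mul_zero, zero_add, Nat.centralBinom]
  have e2 : ∑ j ∈ Finset.range (a + 1), ((a + p).choose (a + p - (p + j)) : ZMod (p ^ 2)) *
        ((2 * (a + p - (a + p)) + 2 * (p + j)).choose (p + j) : ZMod (p ^ 2)) * z ^ (p + j)
          * (1 - z) ^ (2 * (a + p - (p + j)))
      = 2 * (z * q) * A := by
    rw [hA, ← sum_choose_mul_choose_eq z (Nat.le_add_right a p), Finset.mul_sum]
    refine Finset.sum_congr rfl fun j hj => ?_
    have hj' : j ≤ a := Nat.lt_succ_iff.1 (Finset.mem_range.1 hj)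
    rw [Nat.sub_self, mul_zero, zero_add, choose_two_mul_add (hj'.trans_lt ha),
      show a + p - (p + j) = a - j by omega, show a + p - a = p by omega, pow_add, hzp]
    ring
  have e3 : ∑ k ∈ Finset.range p, ((a + p).choose k : ZMod (p ^ 2)) *
        ((a + p).choose (a + p - k) : ZMod (p ^ 2)) * z ^ (2 * k) = S := by
    rw [hS, ← trunc]
    refine Finset.sum_congr rfl fun k hk => ?_
    have hk' := Finset.mem_range.1 hk
    rw [Nat.choose_symm (by omega)]
    ring
  have e4 : ∑ k ∈ Finset.range (a + 1), ((a + p).choose (p + k) : ZMod (p ^ 2)) *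
        ((a + p).choose (a + p - (p + k)) : ZMod (p ^ 2)) * z ^ (2 * (p + k))
      = (z * q) ^ 2 * B := by
    rw [hB, Finset.mul_sum]
    refine Finset.sum_congr rfl fun k hk => ?_
    have hk' : k ≤ a := Nat.lt_succ_iff.1 (Finset.mem_range.1 hk)
    rw [← Nat.choose_symm (n := a + p) (k := p + k) (by omega),
      show a + p - (p + k) = a - k by omega, mul_add, pow_add, mul_comm 2 p, pow_mul, hzp]
    ring
  rw [e1, e2, e3, e4, ← hU] at hfull
  rw [trunc, trunc, hrefl]
  linear_combination vi * (-z * hsquare - hfull)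
    - (S - z * q ^ 2 * B - (1 - z) ^ (1 + 2 * (a + (p - 1))) * V) * hvi

/-- The transformation with parameter `-(a + m p)`, where `a < p`. -/
theorem quadratic_transformation {a : ℕ} (ha : a < p) {z zi vi d d' : ZMod (p ^ 2)}
    (hzi : z * zi = 1) (hvi : (1 - z) * vi = 1)
    (hd : z ^ (p - 1) = 1 + (p : ZMod (p ^ 2)) * d)
    (hd' : (1 - z) ^ (p - 1) = 1 + (p : ZMod (p ^ 2)) * d') (m : ℕ) :
    ∑ k ∈ Finset.range p, ((a + m * p).choose k : ZMod (p ^ 2)) ^ 2 * z ^ (2 * k)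
      - z ^ (1 + 2 * (a + m * (p - 1))) * ∑ k ∈ Finset.range p,
          ((a + m * p).choose k : ZMod (p ^ 2)) ^ 2 * zi ^ (2 * k)
      - (1 - z) ^ (1 + 2 * (a + m * (p - 1))) * ∑ k ∈ Finset.range p,
          ((a + m * p).choose k : ZMod (p ^ 2)) * (k.centralBinom : ZMod (p ^ 2))
            * (z ^ k * vi ^ (2 * k)) = 0 := by
  have hpow {w e : ZMod (p ^ 2)} (he : w ^ (p - 1) = 1 + (p : ZMod (p ^ 2)) * e) :
      IsAffineSeq p fun m => w ^ (1 + 2 * (a + m * (p - 1))) := by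
    have h := IsAffineSeq.pow he
    convert (IsAffineSeq.const (w ^ (1 + 2 * a))).mul (h.mul h) using 2 with m
    rw [← pow_mul, ← pow_add, ← pow_add]
    congr 1; ring
  have hsq (w : ZMod (p ^ 2)) : IsAffineSeq p fun m =>
      ∑ k ∈ Finset.range p, ((a + m * p).choose k : ZMod (p ^ 2)) ^ 2 * w ^ (2 * k) := by
    refine IsAffineSeq.sum _ fun k hk => ?_
    have h := IsAffineSeq.choose a (Finset.mem_range.1 hk)
    simp only [sq]
    exact (h.mul h).mul (IsAffineSeq.const _)
  refine IsAffineSeq.eq_zero (((hsq z).sub ((hpow hd).mul (hsq zi))).sub ((hpow hd').mul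
    (IsAffineSeq.sum _ fun k hk => ((IsAffineSeq.choose a (Finset.mem_range.1 hk)).mul
      (IsAffineSeq.const _)).mul (IsAffineSeq.const _)))) ?_ ?_ m
  · simpa only [zero_mul, add_zero] using quadratic_transformation_of_lt ha hzi hvi
  · simpa only [one_mul] using quadratic_transformation_add_prime ha hzi hvi hd

end ZModSq

theorem ascPochhammer_eval_half_mul_four_pow {K : Type*} [Field K] [CharZero K] (k : ℕ) :
    (ascPochhammer K k).eval (1 / 2) * 4 ^ k = (k.centralBinom : K) * (k.factorial : K) := by
  induction k with
  | zero => simp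
  | succ k ih =>
    have h := congrArg (Nat.cast : ℕ → K) (Nat.succ_mul_centralBinom_succ k)
    push_cast at h
    rw [ascPochhammer_succ_eval, Nat.factorial_succ, pow_succ]
    push_cast
    linear_combination (1 / 2 + k : K) * 4 * ih - (k.factorial : K) * h

section PadicInt

variable {p : ℕ} [Fact p.Prime]

theorem exists_pow_prime_sub_one_eq {z : ℤ_[p]} (hz : IsUnit z) :
    ∃ d : ℤ_[p], z ^ (p - 1) = 1 + p * d := by
  have h : z ^ (p - 1) - 1 ∈ RingHom.ker (PadicInt.toZMod (p := p)) := by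
    rw [RingHom.mem_ker, map_sub, map_pow, map_one,
      ZMod.pow_card_sub_one_eq_one (hz.map _).ne_zero, sub_self]
  rw [PadicInt.ker_toZMod, PadicInt.maximalIdeal_eq_span_p, Ideal.mem_span_singleton] at h
  obtain ⟨d, hd⟩ := h
  exact ⟨d, by linear_combination hd⟩

theorem res_eq_res2_mod (x : ℤ_[p]) : res p x = res2 p x % p := by
  have h : x - (res2 p x : ℤ_[p]) ∈ RingHom.ker (PadicInt.toZModPow (p := p) 2) := by
    rw [RingHom.mem_ker, map_sub, map_natCast, res2, ZMod.natCast_zmod_val, sub_self]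
  rw [PadicInt.ker_toZModPow, Ideal.mem_span_singleton] at h
  obtain ⟨c, hc⟩ := h
  have h2 := congrArg (PadicInt.toZMod (p := p)) hc
  rw [map_sub, map_mul, map_pow, map_natCast, map_natCast, ZMod.natCast_self,
    zero_pow two_ne_zero, zero_mul, sub_eq_zero] at h2
  rw [res, h2, ZMod.val_natCast]

theorem lam2_eq (α : ℤ_[p]) :
    lam2 p α = -((res p (-α) + res2 p (-α) / p * (p - 1) : ℕ) : ℤ) := by
  have hp : 0 < p := (Fact.out : p.Prime).pos
  have h := Nat.mod_add_div (res2 p (-α)) p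
  rw [← res_eq_res2_mod] at h
  have h' : (res p (-α) : ℤ) - (res2 p (-α) : ℤ) = (p : ℤ) * -((res2 p (-α) / p : ℕ) : ℤ) := by
    zify at h
    push_cast
    linear_combination h
  rw [lam2, h', Int.mul_ediv_cancel_left _ (by exact_mod_cast hp.ne')]
  push_cast [Nat.cast_sub (show 1 ≤ p from hp)]
  ring

theorem exists_factorial_mul_eq (α : ℤ_[p]) {k : ℕ} (hk : k < p) :
    ∃ b : ℤ_[p], (k.factorial : ℤ_[p]) * b = (ascPochhammer ℤ_[p] k).eval α := by
  have hu : IsUnit (k.factorial : ℤ_[p]) := by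
    rw [PadicInt.isUnit_iff, PadicInt.norm_natCast_eq_one_iff,
      (Fact.out : p.Prime).coprime_iff_not_dvd]
    exact fun hd => hk.not_ge (((Fact.out : p.Prime).dvd_factorial).1 hd)
  exact (hu.dvd).imp fun b hb => hb.symm

theorem toZModPow_eq_choose {α b : ℤ_[p]} {k : ℕ} (hk : k < p)
    (hb : (k.factorial : ℤ_[p]) * b = (ascPochhammer ℤ_[p] k).eval α) :
    PadicInt.toZModPow 2 b = (-1) ^ k * ((res2 p (-α)).choose k : ZMod (p ^ 2)) := by
  have h := congrArg (PadicInt.toZModPow (p := p) 2) hb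
  rw [map_mul, map_natCast, ← Polynomial.eval₂_at_apply, ← ascPochhammer_eval₂,
    show PadicInt.toZModPow 2 α = -((res2 p (-α) : ℕ) : ZMod (p ^ 2)) by
      rw [res2, ZMod.natCast_zmod_val, map_neg, neg_neg],
    ascPochhammer_eval_neg_eq_descPochhammer, descPochhammer_eval_eq_descFactorial,
    Nat.descFactorial_eq_factorial_mul_choose] at h
  refine (isUnit_factorial hk).mul_left_cancel ?_
  rw [h]; push_cast; ring

theorem poch_div_factorial_eq {α b : ℤ_[p]} {k : ℕ}
    (hb : (k.factorial : ℤ_[p]) * b = (ascPochhammer ℤ_[p] k).eval α) :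
    poch p (α : ℚ_[p]) k = (k.factorial : ℚ_[p]) * (b : ℚ_[p]) := by
  have h := congrArg (PadicInt.Coe.ringHom (p := p)) hb
  rw [map_mul, map_natCast, ← Polynomial.eval₂_at_apply, ← ascPochhammer_eval₂] at h
  exact h.symm

end PadicInt

/-- p-adic analogue of `₂F₁[α,α;1|z²] = (1−z)^{−2α} ₂F₁[α,1/2;1|−4z/(1−z)²]` mod `p²`. -/
theorem padic_quadratic_transformation_VI
    (p : ℕ) [Fact p.Prime] (hp : Odd p) (α z : ℤ_[p]) (hz : IsUnit (z * (1 - z))) :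
    ‖(∑ k ∈ Finset.range p,
        poch p (α : ℚ_[p]) k ^ 2 / (Nat.factorial k : ℚ_[p]) ^ 2 * (z : ℚ_[p]) ^ (2 * k))
      - (z : ℚ_[p]) ^ (1 - 2 * lam2 p α) *
          ∑ k ∈ Finset.range p,
            poch p (α : ℚ_[p]) k ^ 2 / (Nat.factorial k : ℚ_[p]) ^ 2 * (z : ℚ_[p]) ^ (-(2 * k : ℤ))
      - (1 - (z : ℚ_[p])) ^ (1 - 2 * lam2 p α) *
          ∑ k ∈ Finset.range p,
            poch p (α : ℚ_[p]) k * poch p ((1 : ℚ_[p]) / 2) k / (Nat.factorial k : ℚ_[p]) ^ 2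
              * (-4 * (z : ℚ_[p]) / (1 - (z : ℚ_[p])) ^ 2) ^ k‖
      ≤ (p : ℝ) ^ (-2 : ℤ) := by
  obtain ⟨hzu, hvu⟩ := IsUnit.mul_iff.1 hz
  obtain ⟨zi, hzi⟩ := hzu.exists_right_inv
  obtain ⟨vi, hvi⟩ := hvu.exists_right_inv
  obtain ⟨d, hd⟩ := exists_pow_prime_sub_one_eq hzu
  obtain ⟨d', hd'⟩ := exists_pow_prime_sub_one_eq hvu
  have hz0 : (z : ℚ_[p]) ≠ 0 := by
    simpa using hzu.ne_zero
  have hv0 : 1 - (z : ℚ_[p]) ≠ 0 := by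
    have := hvu.ne_zero
    rw [← PadicInt.coe_ne_zero] at this
    simpa using this
  have hziQ : (zi : ℚ_[p]) = (z : ℚ_[p])⁻¹ := by
    refine eq_inv_of_mul_eq_one_right ?_
    rw [← PadicInt.coe_mul, hzi, PadicInt.coe_one]
  have hviQ : (vi : ℚ_[p]) = (1 - (z : ℚ_[p]))⁻¹ := by
    refine eq_inv_of_mul_eq_one_right ?_
    rw [← PadicInt.coe_one, ← PadicInt.coe_sub, ← PadicInt.coe_mul, hvi]
  have hex (k : ℕ) : ∃ b : ℤ_[p], k < p →
      (k.factorial : ℤ_[p]) * b = (ascPochhammer ℤ_[p] k).eval α := by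
    by_cases hk : k < p
    · exact (exists_factorial_mul_eq α hk).imp fun b hb _ => hb
    · exact ⟨0, fun h => absurd h hk⟩
  choose b hb using hex
  set m := res2 p (-α) / p with hm
  set a := res p (-α) with ha
  have hN : res2 p (-α) = a + m * p := by
    rw [ha, res_eq_res2_mod, hm, mul_comm, Nat.mod_add_div]
  set n := a + m * (p - 1) with hn
  have hexp : 1 - 2 * lam2 p α = ((1 + 2 * n : ℕ) : ℤ) := by
    rw [lam2_eq, ← ha, ← hm, ← hn]; push_cast; ring
  have hfac (k : ℕ) : (k.factorial : ℚ_[p]) ≠ 0 := by exact_mod_cast k.factorial_ne_zero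
  set X : ℤ_[p] := ∑ k ∈ Finset.range p, b k ^ 2 * z ^ (2 * k)
    - z ^ (1 + 2 * n) * ∑ k ∈ Finset.range p, b k ^ 2 * zi ^ (2 * k)
    - (1 - z) ^ (1 + 2 * n) * ∑ k ∈ Finset.range p,
        b k * ((-1) ^ k * (k.centralBinom : ℤ_[p])) * (z ^ k * vi ^ (2 * k)) with hX
  have hXker : X ∈ RingHom.ker (PadicInt.toZModPow (p := p) 2) := by
    have key := quadratic_transformation (p := p) (a := a) (ZMod.val_lt _)
      (z := PadicInt.toZModPow 2 z) (zi := PadicInt.toZModPow 2 zi)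
      (vi := PadicInt.toZModPow 2 vi) (d := PadicInt.toZModPow 2 d)
      (d' := PadicInt.toZModPow 2 d') (by simp [← map_mul, hzi])
      (by rw [← map_one (PadicInt.toZModPow (p := p) 2), ← map_sub, ← map_mul, hvi])
      (by rw [← map_pow, hd]; simp)
      (by rw [← map_one (PadicInt.toZModPow (p := p) 2), ← map_sub, ← map_pow, hd']; simp) m
    rw [RingHom.mem_ker, ← key, hX]
    simp only [map_sub, map_mul, map_sum, map_pow, map_one, map_neg, map_natCast]
    have hsq (w : ZMod (p ^ 2)) :
        ∑ k ∈ Finset.range p, PadicInt.toZModPow 2 (b k) ^ 2 * w ^ (2 * k)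
          = ∑ k ∈ Finset.range p, ((a + m * p).choose k : ZMod (p ^ 2)) ^ 2 * w ^ (2 * k) := by
      refine Finset.sum_congr rfl fun k hk => ?_
      have hk' := Finset.mem_range.1 hk
      rw [toZModPow_eq_choose hk' (hb k hk'), hN, mul_pow, ← pow_mul, mul_comm k, pow_mul]
      simp
    rw [hsq, hsq]
    congr 2
    refine Finset.sum_congr rfl fun k hk => ?_
    have hk' := Finset.mem_range.1 hk
    have h1 : ((-1) ^ k * (-1) ^ k : ZMod (p ^ 2)) = 1 := by rw [← mul_pow]; simp
    rw [toZModPow_eq_choose hk' (hb k hk'), hN]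
    linear_combination (((a + m * p).choose k : ZMod (p ^ 2)) * (k.centralBinom : ZMod (p ^ 2))
      * (PadicInt.toZModPow 2 z ^ k * PadicInt.toZModPow 2 vi ^ (2 * k))) * h1
  rw [PadicInt.ker_toZModPow, ← PadicInt.norm_le_pow_iff_mem_span_pow] at hXker
  refine le_of_eq_of_le ?_ hXker
  rw [PadicInt.norm_def, hX, hexp, zpow_natCast, zpow_natCast]
  simp only [PadicInt.coe_sub, PadicInt.coe_mul, PadicInt.coe_pow, PadicInt.coe_sum,
    PadicInt.coe_one, PadicInt.coe_neg, PadicInt.coe_natCast]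
  congr 2
  · congr 1
    · refine Finset.sum_congr rfl fun k hk => ?_
      rw [poch_div_factorial_eq (hb k (Finset.mem_range.1 hk)), mul_pow,
        mul_div_cancel_left₀ _ (pow_ne_zero 2 (hfac k))]
    · congr 1
      refine Finset.sum_congr rfl fun k hk => ?_
      rw [poch_div_factorial_eq (hb k (Finset.mem_range.1 hk)), mul_pow,
        mul_div_cancel_left₀ _ (pow_ne_zero 2 (hfac k)), hziQ, zpow_neg, inv_pow]
      norm_cast
  · congr 1
    refine Finset.sum_congr rfl fun k hk => ?_
    have h4 := ascPochhammer_eval_half_mul_four_pow (K := ℚ_[p]) k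
    have hf := hfac k
    rw [poch_div_factorial_eq (hb k (Finset.mem_range.1 hk)), hviQ, div_pow, mul_pow,
      neg_pow (4 : ℚ_[p]) k, inv_pow, ← pow_mul]
    have h5 : poch p (1 / 2) k * 4 ^ k = (k.centralBinom : ℚ_[p]) * (k.factorial : ℚ_[p]) := h4
    field_simp
    linear_combination (b k : ℚ_[p]) * h5
end

section
/- Let p be an odd prime and α, z ∈ ℤ_p with ⟨−α⟩_p even and z − 1 a unit of ℤ_p. Write a = ⟨−α⟩_p. Then ∑_{k=0}^{p−1} (α)_k(1/2)_k/(k!)² · z^k + (1−z)^a · ∑_{k=0}^{p−1} (α)_k(1/2)_k/(k!)² · (z/(z−1))^k ≡ 2·(1−z)^{a/2} · ∑_{k=0}^{p−1} (α/2)_k((1−α)/2)_k/(k!)² · (z²/(4z−4))^k (mod p²). -/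
open scoped BigOperators

section BinomialIdentities

variable {R : Type*} [CommRing R] [BinomialRing R]

theorem succ_mul_ringChoose_succ (r : R) (k : ℕ) :
    ((k : R) + 1) * Ring.choose r (k + 1) = (r - k) * Ring.choose r k := by
  have h := Ring.choose_smul_choose r (Nat.le_succ k)
  rw [Nat.succ_eq_add_one, Nat.choose_succ_self_right, nsmul_eq_mul, Nat.add_sub_cancel_left,
    Ring.choose_one_right] at h
  push_cast at h
  rw [h, mul_comm]

theorem succ_sq_mul_left_cancel {n : ℕ} {x y : R}
    (h : ((n : R) + 1) ^ 2 * x = ((n : R) + 1) ^ 2 * y) : x = y := by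
  have := BinomialRing.toIsAddTorsionFree (R := R)
  refine (nsmul_right_inj (pow_ne_zero 2 n.succ_ne_zero)).mp ?_
  simpa [nsmul_eq_mul] using h

/-- Coefficients of Pfaff's transformation for a `₂F₁` with parameters `-s, 1/2; 1`. -/
theorem sum_choose_pfaff {h : R} (hh : 2 * h = 1) (s : R) (n : ℕ) :
    ∑ k ∈ Finset.range (n + 1),
        Ring.choose s k * Ring.choose (-h) k * Ring.choose (s - k) (n - k)
      = (-1) ^ n * (Ring.choose s n * Ring.choose (-h) n) := by
  have key : ∑ k ∈ Finset.range (n + 1), (n.choose k : R) * Ring.choose (-h) k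
      = (-1) ^ n * Ring.choose (-h) n := by
    have hv := Ring.add_choose_eq n (Commute.all (-h) (n : R))
    rw [Finset.Nat.sum_antidiagonal_eq_sum_range_succ_mk] at hv
    have hn := Ring.choose_neg h n
    rw [show h + n - 1 = -h + n by linear_combination hh, hv] at hn
    have hsgn : ∀ y : R, Int.negOnePow n • y = (-1) ^ n * y := by
      intro y
      rw [Units.smul_def, zsmul_eq_mul]
      simp
    rw [hsgn] at hn
    rw [hn, ← mul_assoc, ← mul_pow]
    simp only [neg_mul_neg, one_mul, one_pow]
    refine Finset.sum_congr rfl fun k hk => ?_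
    rw [Ring.choose_natCast, Nat.choose_symm (Nat.lt_succ_iff.mp (Finset.mem_range.mp hk)),
      mul_comm]
  rw [mul_left_comm, ← key, Finset.mul_sum]
  refine Finset.sum_congr rfl fun k hk => ?_
  have := Ring.choose_smul_choose s (Nat.lt_succ_iff.mp (Finset.mem_range.mp hk))
  rw [nsmul_eq_mul] at this
  linear_combination -Ring.choose (-h) k * this

/-- Summand of the coefficient identity for the quadratic transformation. -/
noncomputable def quadTerm (h x : R) (n k : ℕ) : R :=
  Ring.choose x (n - k) * ((n - k).choose k : R) * Ring.choose (-h - x) k * (-h ^ 2) ^ k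

theorem quadTerm_of_lt (h x : R) {n k : ℕ} (hk : n < 2 * k) : quadTerm h x n k = 0 := by
  rw [quadTerm, Nat.choose_eq_zero_of_lt (by omega)]
  simp

theorem quadTerm_eq (h x : R) {n k : ℕ} (hk : 2 * k ≤ n) :
    quadTerm h x n k = Ring.choose x k * Ring.choose (-h - x) k * (-h ^ 2) ^ k
      * Ring.choose (x - k) (n - 2 * k) := by
  have := Ring.choose_smul_choose x (n := n - k) (k := k) (by omega)
  rw [nsmul_eq_mul, show n - k - k = n - 2 * k by omega] at this
  rw [quadTerm]
  linear_combination Ring.choose (-h - x) k * (-h ^ 2) ^ k * this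

theorem quadTerm_telescope {h : R} (hh : 2 * h = 1) (x : R) (n k : ℕ) :
    ((n : R) + 1) ^ 2 * quadTerm h x (n + 1) k - (2 * x - n) * (n + h) * quadTerm h x n k
      = 4 * (k : R) ^ 2 * quadTerm h x (n + 1) k
        - 4 * ((k + 1 : ℕ) : R) ^ 2 * quadTerm h x (n + 1) (k + 1) := by
  rcases lt_or_ge (n + 1) (2 * k) with h1 | h1
  · rw [quadTerm_of_lt h x h1, quadTerm_of_lt h x (show n < 2 * k by omega),
      quadTerm_of_lt h x (show n + 1 < 2 * (k + 1) by omega)]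
    ring
  rcases h1.eq_or_lt with h1 | h1
  · rw [quadTerm_of_lt h x (show n < 2 * k by omega),
      quadTerm_of_lt h x (show n + 1 < 2 * (k + 1) by omega)]
    have : (2 : R) * k = n + 1 := by simpa using congrArg (Nat.cast : ℕ → R) h1
    linear_combination -(2 * (k : R) + n + 1) * quadTerm h x (n + 1) k * this
  obtain ⟨j, rfl⟩ : ∃ j, n = 2 * k + j := ⟨n - 2 * k, by omega⟩
  rcases j with _ | j
  · rw [quadTerm_of_lt h x (show 2 * k + 0 + 1 < 2 * (k + 1) by omega)]
    simp only [quadTerm, show 2 * k + 0 - k = k by omega, show 2 * k + 0 + 1 - k = k + 1 by omega]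
    have := succ_mul_ringChoose_succ x k
    simp only [Nat.choose_self, Nat.choose_succ_self_right]
    push_cast
    linear_combination (4 * (k : R) + 1) * Ring.choose (-h - x) k * (-h ^ 2) ^ k * this
      - (x - k) * Ring.choose x k * Ring.choose (-h - x) k * (-h ^ 2) ^ k * hh
  · simp only [quadTerm, show 2 * k + (j + 1) - k = k + j + 1 by omega,
      show 2 * k + (j + 1) + 1 - k = k + j + 2 by omega,
      show 2 * k + (j + 1) + 1 - (k + 1) = k + j + 1 by omega]
    have hx := succ_mul_ringChoose_succ x (k + j + 1)
    have hy := succ_mul_ringChoose_succ (-h - x) k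
    have hc1 : (((k + j + 2).choose k : ℕ) : R) * (j + 2)
        = (k + j + 2) * ((k + j + 1).choose k : ℕ) := by
      have := Nat.choose_mul_succ_eq (k + j + 1) k
      rw [show k + j + 1 + 1 - k = j + 2 by omega] at this
      have h' := congrArg (Nat.cast : ℕ → R) this
      push_cast at h'
      linear_combination -h'
    have hc2 : (((k + j + 1).choose (k + 1) : ℕ) : R) * (k + 1)
        = (j + 1) * ((k + j + 1).choose k : ℕ) := by
      have := Nat.choose_succ_right_eq (k + j + 1) k
      rw [show k + j + 1 - k = j + 1 by omega] at this
      have h' := congrArg (Nat.cast : ℕ → R) this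
      push_cast at h'
      linear_combination h'
    push_cast at hx ⊢
    rw [show k + j + 1 + 1 = k + j + 2 by ring] at hx
    set X1 := Ring.choose x (k + j + 1)
    set X2 := Ring.choose x (k + j + 2)
    set Y := Ring.choose (-h - x) k
    set Y1 := Ring.choose (-h - x) (k + 1)
    set c := (((k + j + 1).choose k : ℕ) : R)
    set c1 := (((k + j + 2).choose k : ℕ) : R)
    set c2 := (((k + j + 1).choose (k + 1) : ℕ) : R)
    rw [pow_succ (-h ^ 2) k]
    set q := (-h ^ 2) ^ k
    have hU : ((j : R) + 2) * (X2 * c1) = (x - (k + j + 1)) * (X1 * c) := by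
      linear_combination X2 * hc1 + c * hx
    have hV : ((k : R) + 1) ^ 2 * (c2 * Y1) = (j + 1) * c * ((-h - x - k) * Y) := by
      linear_combination (k + 1) * Y1 * hc2 + (j + 1) * c * hy
    have h4 : 4 * h ^ 2 = 1 := by linear_combination (2 * h + 1) * hh
    linear_combination (4 * k + j + 2) * Y * q * hU - 4 * h ^ 2 * X1 * q * hV
      - (j + 1) * (-h - x - k) * (X1 * c * Y * q) * h4
      - (x - k - j - 1) * (X1 * c * Y * q) * hh

/-- Coefficients of the quadratic transformation
`₂F₁[-2x, 1/2; 1 | z] = (1 - z) ^ x ₂F₁[-x, 1/2 + x; 1 | z² / (4z - 4)]`. -/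
theorem sum_quadTerm {h : R} (hh : 2 * h = 1) (x : R) (n : ℕ) :
    ∀ m, n < 2 * m → ∑ k ∈ Finset.range m, quadTerm h x n k
      = (-1) ^ n * (Ring.choose (2 * x) n * Ring.choose (-h) n) := by
  induction n with
  | zero =>
    intro m hm
    obtain ⟨m, rfl⟩ : ∃ m', m = m' + 1 := ⟨m - 1, by omega⟩
    rw [Finset.sum_range_succ', Finset.sum_eq_zero fun k _ => quadTerm_of_lt h x (by omega)]
    simp [quadTerm]
  | succ n ih =>
    intro m hm
    apply succ_sq_mul_left_cancel (n := n)
    have htel := Finset.sum_range_sub' (fun k : ℕ => 4 * (k : R) ^ 2 * quadTerm h x (n + 1) k) m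
    rw [← Finset.sum_congr rfl fun k _ => quadTerm_telescope hh x n k, Finset.sum_sub_distrib,
      ← Finset.mul_sum, ← Finset.mul_sum, ih m (by omega), quadTerm_of_lt h x hm] at htel
    have h1 := succ_mul_ringChoose_succ (2 * x) n
    have h2 := succ_mul_ringChoose_succ (-h) n
    push_cast at htel
    rw [pow_succ]
    linear_combination htel + (-1) ^ n * (n + 1) * Ring.choose (2 * x) (n + 1) * h2
      + (-1) ^ n * (-h - n) * Ring.choose (-h) n * h1

end BinomialIdentities

section TruncatedSeries

open PowerSeries

variable {R : Type*} [CommRing R]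

theorem mem_span_C_X_pow_iff {d : R} {N : ℕ} {f : R⟦X⟧} :
    f ∈ Ideal.span {C d, (X : R⟦X⟧) ^ N} ↔ ∀ n < N, d ∣ coeff n f := by
  rw [Ideal.mem_span_pair]
  constructor
  · rintro ⟨a, b, rfl⟩ n hn
    rw [map_add, coeff_mul_C, coeff_mul_X_pow', if_neg (by omega), add_zero]
    exact dvd_mul_left _ _
  · intro hf
    choose g hg using hf
    let G : R⟦X⟧ := PowerSeries.mk fun n => if hn : n < N then g n hn else 0
    have hX : X ^ N ∣ f - G * C d := by
      rw [X_pow_dvd_iff]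
      intro n hn
      rw [map_sub, coeff_mul_C, coeff_mk, dif_pos hn, hg n hn]
      ring
    obtain ⟨b, hb⟩ := hX
    exact ⟨G, b, by linear_combination -hb⟩

theorem sq_mem_span_C_sq_X_pow {d : R} {N : ℕ} {f : R⟦X⟧}
    (hf : f ∈ Ideal.span {C d, (X : R⟦X⟧) ^ N}) :
    f ^ 2 ∈ Ideal.span {C (d ^ 2), (X : R⟦X⟧) ^ N} := by
  rw [Ideal.mem_span_pair] at hf ⊢
  obtain ⟨a, b, rfl⟩ := hf
  exact ⟨a ^ 2, 2 * a * b * C d + b ^ 2 * X ^ N, by rw [map_pow]; ring⟩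

theorem dvd_sum_range_sub_sum_range {S : Type*} [CommRing S] {d : S} {f : ℕ → S} {K n : ℕ}
    (hK : K < n) (hd : ∀ k, K < k → k < n → d ∣ f k) :
    d ∣ ∑ k ∈ Finset.range n, f k - ∑ k ∈ Finset.range (K + 1), f k := by
  rw [← Finset.sum_Ico_eq_sub _ hK]
  refine Finset.dvd_sum fun k hk => ?_
  rw [Finset.mem_Ico] at hk
  exact hd k hk.1 hk.2

variable [BinomialRing R]

theorem coeff_sum_pfaff {h : R} (hh : 2 * h = 1) (s : R) {n p : ℕ} (hn : n < p) :
    coeff n (∑ k ∈ Finset.range p, C (Ring.choose s k * Ring.choose (-h) k) * X ^ k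
        * binomialSeries R (s - k))
      = (-1) ^ n * (Ring.choose s n * Ring.choose (-h) n) := by
  rw [map_sum, ← sum_choose_pfaff hh, ← Finset.sum_subset (Finset.range_subset_range.mpr hn)]
  · refine Finset.sum_congr rfl fun k hk => ?_
    rw [mul_assoc, coeff_C_mul, coeff_X_pow_mul', if_pos (by simpa [Nat.lt_succ_iff] using hk)]
    simp
  · intro k _ hk
    rw [mul_assoc, coeff_C_mul, coeff_X_pow_mul', if_neg (by simpa [Nat.lt_succ_iff] using hk),
      mul_zero]

theorem coeff_sum_quadratic {h : R} (hh : 2 * h = 1) (x : R) {n p : ℕ} (hn : n < p) :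
    coeff n (∑ k ∈ Finset.range p,
        C (Ring.choose x k * Ring.choose (-h - x) k * (-h ^ 2) ^ k) * X ^ (2 * k)
        * binomialSeries R (x - k))
      = (-1) ^ n * (Ring.choose (2 * x) n * Ring.choose (-h) n) := by
  rw [map_sum, ← sum_quadTerm hh x n p (by omega)]
  refine Finset.sum_congr rfl fun k _ => ?_
  rw [mul_assoc, coeff_C_mul, coeff_X_pow_mul']
  split_ifs with hk
  · rw [quadTerm_eq h x hk]
    simp
  · rw [quadTerm_of_lt h x (not_le.mp hk), mul_zero]

/-- The two sides of the quadratic transformation, truncated and cleared of denominators, as a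
polynomial in `X = -z`. -/
noncomputable def truncatedPoly (h s : R) (b N : ℕ) : Polynomial R :=
  (1 + Polynomial.X) ^ N * ∑ k ∈ Finset.range (2 * b + N + 1),
      Polynomial.C (Ring.choose s k * Ring.choose (-h) k) * (-Polynomial.X) ^ k
    + ∑ k ∈ Finset.range (2 * b + N + 1),
      Polynomial.C (Ring.choose s k * Ring.choose (-h) k) * Polynomial.X ^ k
        * (1 + Polynomial.X) ^ (2 * b + N - k)
    - 2 * ∑ k ∈ Finset.range (b + N + 1),
      Polynomial.C (Ring.choose (h * s) k * Ring.choose (-h - h * s) k * (-h ^ 2) ^ k)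
        * Polynomial.X ^ (2 * k) * (1 + Polynomial.X) ^ (b + N - k)

theorem coe_truncatedPoly_mem_span {h : R} (hh : 2 * h = 1) {d s e : R} {b N p : ℕ}
    (hs : s = 2 * b + e) (hK : 2 * b + N < p)
    (hA : ∀ k, 2 * b + N < k → k < p → d ^ 2 ∣ Ring.choose s k * Ring.choose (-h) k)
    (hB : ∀ k, b + N < k → k < p → d ^ 2 ∣ Ring.choose (h * s) k * Ring.choose (-h - h * s) k)
    (hE : ∀ n, 0 < n → n < p → d ∣ Ring.choose (-(h * e)) n) :
    (truncatedPoly h s b N : R⟦X⟧) ∈ Ideal.span {C (d ^ 2), (X : R⟦X⟧) ^ p} := by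
  set J : Ideal R⟦X⟧ := Ideal.span {C (d ^ 2), (X : R⟦X⟧) ^ p}
  have hCJ : ∀ f, C (d ^ 2) ∣ f → f ∈ J := fun f hf =>
    J.mem_of_dvd hf (Ideal.subset_span (by simp))
  have hXJ : ∀ f, X ^ p ∣ f → f ∈ J := fun f hf =>
    J.mem_of_dvd hf (Ideal.subset_span (by simp))
  let P : R → R⟦X⟧ := binomialSeries R
  have hP : ∀ r t : R, P (r + t) = P r * P t := fun r t => binomialSeries_add r t
  have hPn : ∀ n : ℕ, P n = (1 + X) ^ n := fun n => binomialSeries_nat n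
  let f₁ : ℕ → R⟦X⟧ := fun k => C (Ring.choose s k * Ring.choose (-h) k) * (-X) ^ k
  let f₂ : ℕ → R⟦X⟧ := fun k => C (Ring.choose s k * Ring.choose (-h) k) * X ^ k * P (s - k)
  let f₃ : ℕ → R⟦X⟧ := fun k =>
    C (Ring.choose (h * s) k * Ring.choose (-h - h * s) k * (-h ^ 2) ^ k) * X ^ (2 * k)
      * P (h * s - k)
  set w := P (-(h * e)) with hw
  have hw2 : w ^ 2 = P (-e) := by
    rw [sq, hw, ← hP]
    congr 1
    linear_combination -e * hh
  have hQ : (truncatedPoly h s b N : R⟦X⟧)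
      = (1 + X) ^ N * ∑ k ∈ Finset.range (2 * b + N + 1), f₁ k
        + (1 + X) ^ N * w ^ 2 * ∑ k ∈ Finset.range (2 * b + N + 1), f₂ k
        - 2 * ((1 + X) ^ N * w * ∑ k ∈ Finset.range (b + N + 1), f₃ k) := by
    have h2 : ∀ k ∈ Finset.range (2 * b + N + 1),
        C (Ring.choose s k * Ring.choose (-h) k) * X ^ k * (1 + X) ^ (2 * b + N - k)
          = (1 + X) ^ N * w ^ 2 * f₂ k := by
      intro k hk
      have hk' : k ≤ 2 * b + N := Nat.lt_succ_iff.mp (Finset.mem_range.mp hk)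
      rw [← hPn, ← hPn, hw2, Nat.cast_sub hk']
      push_cast
      rw [show (2 * b + N - k : R) = N + -e + (s - k) by rw [hs]; ring, hP, hP]
      ring
    have h3 : ∀ k ∈ Finset.range (b + N + 1),
        C (Ring.choose (h * s) k * Ring.choose (-h - h * s) k * (-h ^ 2) ^ k) * X ^ (2 * k)
            * (1 + X) ^ (b + N - k)
          = (1 + X) ^ N * w * f₃ k := by
      intro k hk
      have hk' : k ≤ b + N := Nat.lt_succ_iff.mp (Finset.mem_range.mp hk)
      rw [← hPn, ← hPn, Nat.cast_sub hk']
      push_cast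
      rw [show (b + N - k : R) = N + -(h * e) + (h * s - k) by
        rw [hs]; linear_combination -(b : R) * hh, hP, hP]
      ring
    rw [Finset.mul_sum _ f₂, Finset.mul_sum _ f₃, ← Finset.sum_congr rfl h2,
      ← Finset.sum_congr rfl h3, truncatedPoly]
    simp only [← Polynomial.coeToPowerSeries.ringHom_apply, map_add, map_sub, map_mul, map_sum,
      map_pow, map_neg, map_one, map_ofNat]
    simp [f₁]
  have d1 : ∑ k ∈ Finset.range p, f₁ k - ∑ k ∈ Finset.range (2 * b + N + 1), f₁ k ∈ J :=
    hCJ _ <| dvd_sum_range_sub_sum_range hK fun k hk hkp =>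
      (map_dvd C (hA k hk hkp)).mul_right _
  have d2 : ∑ k ∈ Finset.range p, f₂ k - ∑ k ∈ Finset.range (2 * b + N + 1), f₂ k ∈ J :=
    hCJ _ <| dvd_sum_range_sub_sum_range hK fun k hk hkp =>
      ((map_dvd C (hA k hk hkp)).mul_right _).mul_right _
  have d3 : ∑ k ∈ Finset.range p, f₃ k - ∑ k ∈ Finset.range (b + N + 1), f₃ k ∈ J :=
    hCJ _ <| dvd_sum_range_sub_sum_range (by omega) fun k hk hkp =>
      ((map_dvd C ((hB k hk hkp).mul_right _)).mul_right _).mul_right _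
  have hcoeff₁ : ∀ n < p, coeff n (∑ k ∈ Finset.range p, f₁ k)
      = (-1) ^ n * (Ring.choose s n * Ring.choose (-h) n) := by
    intro n hn
    rw [map_sum, Finset.sum_eq_single_of_mem n (Finset.mem_range.mpr hn)]
    · rw [coeff_C_mul, neg_pow, ← map_one C, ← map_neg C, ← map_pow C, coeff_C_mul, coeff_X_pow_self]
      ring
    · intro k _ hk
      rw [coeff_C_mul, neg_pow, ← map_one C, ← map_neg C, ← map_pow C, coeff_C_mul, coeff_X_pow,
        if_neg hk.symm]
      ring
  have d4 : ∑ k ∈ Finset.range p, f₂ k - ∑ k ∈ Finset.range p, f₁ k ∈ J := by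
    refine hXJ _ (X_pow_dvd_iff.mpr fun n hn => ?_)
    rw [map_sub, hcoeff₁ n hn, coeff_sum_pfaff hh s hn, sub_self]
  have d5 : ∑ k ∈ Finset.range p, f₃ k - ∑ k ∈ Finset.range p, f₁ k ∈ J := by
    refine hXJ _ (X_pow_dvd_iff.mpr fun n hn => ?_)
    rw [map_sub, hcoeff₁ n hn, coeff_sum_quadratic hh (h * s) hn, ← mul_assoc 2 h s, hh, one_mul,
      sub_self]
  have d6 : (1 - w) ^ 2 ∈ J := by
    refine sq_mem_span_C_sq_X_pow (mem_span_C_X_pow_iff.mpr fun n hn => ?_)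
    rcases n.eq_zero_or_pos with rfl | hn0
    · simp [w, P]
    · rw [map_sub, coeff_one, if_neg hn0.ne', zero_sub, dvd_neg]
      simpa [w, P] using hE n hn0 hn
  have hmem := J.add_mem (J.sub_mem
    (J.add_mem
      (J.mul_mem_left ((1 + X) ^ N * ∑ k ∈ Finset.range p, f₁ k) d6)
      (J.mul_mem_left ((1 + X) ^ N * w ^ 2) (J.sub_mem d4 d2)))
    (J.mul_mem_left (2 * ((1 + X) ^ N * w)) (J.sub_mem d5 d3)))
    (J.mul_mem_left (-(1 + X) ^ N) d1)
  rw [hQ]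
  convert hmem using 1
  ring

theorem natDegree_truncatedPoly_le (h s : R) (b N : ℕ) :
    (truncatedPoly h s b N).natDegree ≤ 2 * b + 2 * N := by
  rw [truncatedPoly, Finset.mul_sum, Finset.mul_sum]
  refine (Polynomial.natDegree_sub_le_of_le (Polynomial.natDegree_add_le_of_degree_le
    (Polynomial.natDegree_sum_le_of_forall_le _ _ fun k hk => ?_)
    (Polynomial.natDegree_sum_le_of_forall_le _ _ fun k hk => ?_))
    (Polynomial.natDegree_sum_le_of_forall_le _ _ fun k hk => ?_)).trans (max_self _).le
  · have := Finset.mem_range.mp hk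
    compute_degree
    omega
  · have := Finset.mem_range.mp hk
    compute_degree
    omega
  · have := Finset.mem_range.mp hk
    compute_degree
    omega

theorem sq_dvd_eval_truncatedPoly {h : R} (hh : 2 * h = 1) {d s e : R} {b N p : ℕ}
    (hs : s = 2 * b + e) (hK : 2 * b + 2 * N < p)
    (hA : ∀ k, 2 * b + N < k → k < p → d ^ 2 ∣ Ring.choose s k * Ring.choose (-h) k)
    (hB : ∀ k, b + N < k → k < p → d ^ 2 ∣ Ring.choose (h * s) k * Ring.choose (-h - h * s) k)
    (hE : ∀ n, 0 < n → n < p → d ∣ Ring.choose (-(h * e)) n) (u : R) :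
    d ^ 2 ∣ (truncatedPoly h s b N).eval u := by
  have hmem := mem_span_C_X_pow_iff.mp
    (coe_truncatedPoly_mem_span hh hs (by omega) hA hB hE)
  have hdvd : Polynomial.C (d ^ 2) ∣ truncatedPoly h s b N := by
    rw [Polynomial.C_dvd_iff_dvd_coeff]
    intro n
    rcases lt_or_ge n p with hn | hn
    · simpa using hmem n hn
    · rw [Polynomial.coeff_eq_zero_of_natDegree_lt
        ((natDegree_truncatedPoly_le h s b N).trans_lt (by omega))]
      exact dvd_zero _
  simpa using Polynomial.eval_dvd (x := u) hdvd

end TruncatedSeries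

section PadicEvaluation

variable {p : ℕ} [Fact p.Prime]

theorem padicInt_dvd_choose {r : ℤ_[p]} {j : ℕ} (hr : (p : ℤ_[p]) ∣ r - j) :
    ∀ k, j < k → k < p → (p : ℤ_[p]) ∣ Ring.choose r k := by
  intro k
  induction k with
  | zero => intro h; omega
  | succ k ih =>
    intro hj hk
    have hmul : (p : ℤ_[p]) ∣ ((k + 1 : ℕ) : ℤ_[p]) * Ring.choose r (k + 1) := by
      push_cast
      rw [succ_mul_ringChoose_succ]
      rcases (Nat.lt_succ_iff.mp hj).eq_or_lt with rfl | hjk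
      · exact hr.mul_right _
      · exact (ih hjk (by omega)).mul_left _
    refine (PadicInt.prime_p.dvd_or_dvd hmul).resolve_left fun hdvd => ?_
    have h' : (p : ℤ) ∣ ((k + 1 : ℕ) : ℤ) := by
      have := PadicInt.pow_p_dvd_int_iff (p := p) 1 ((k + 1 : ℕ) : ℤ)
      simp only [pow_one] at this
      exact this.mp (by exact_mod_cast hdvd)
    exact absurd (Nat.le_of_dvd (by omega) (Int.natCast_dvd_natCast.mp h')) (by omega)

theorem padicInt_coe_choose_neg (r : ℤ_[p]) (k : ℕ) :
    ((Ring.choose (-r) k : ℤ_[p]) : ℚ_[p]) = (-1) ^ k * poch p r k / (k.factorial : ℚ_[p]) := by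
  induction k with
  | zero => simp [poch]
  | succ k ih =>
    have hk : ((k : ℚ_[p]) + 1) ≠ 0 := by exact_mod_cast k.succ_ne_zero
    have hf : (k.factorial : ℚ_[p]) ≠ 0 := by exact_mod_cast k.factorial_ne_zero
    have h : ((((k : ℤ_[p]) + 1) * Ring.choose (-r) (k + 1) : ℤ_[p]) : ℚ_[p])
        = (((-r - k) * Ring.choose (-r) k : ℤ_[p]) : ℚ_[p]) := by
      rw [succ_mul_ringChoose_succ]
    push_cast at h
    rw [ih] at h
    apply mul_left_cancel₀ hk
    rw [h, Nat.factorial_succ, poch, poch, ascPochhammer_succ_eval]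
    push_cast
    field_simp
    ring

theorem poch_mul_poch_div (x y : ℤ_[p]) (k : ℕ) :
    poch p x k * poch p y k / (k.factorial : ℚ_[p]) ^ 2
      = ((Ring.choose (-x) k * Ring.choose (-y) k : ℤ_[p]) : ℚ_[p]) := by
  rw [PadicInt.coe_mul, padicInt_coe_choose_neg, padicInt_coe_choose_neg]
  have : ((-1 : ℚ_[p]) ^ k) ^ 2 = 1 := by rw [← pow_mul, mul_comm, pow_mul]; simp
  linear_combination -(poch p x k * poch p y k / (k.factorial : ℚ_[p]) ^ 2) * this

theorem padicInt_dvd_sub_res (x : ℤ_[p]) : (p : ℤ_[p]) ∣ x - (res p x : ℕ) := by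
  rw [← Ideal.mem_span_singleton, ← PadicInt.maximalIdeal_eq_span_p, ← PadicInt.ker_toZMod,
    RingHom.mem_ker, map_sub, map_natCast, res, ZMod.natCast_zmod_val, sub_self]

theorem padicInt_transformation {h : ℤ_[p]} (hh : 2 * h = 1) (hp : Odd p) {s z v : ℤ_[p]} {b : ℕ}
    (hv : (1 - z) * v = 1) (hb : 2 * b < p) (hs : (p : ℤ_[p]) ∣ s - 2 * b) :
    (p : ℤ_[p]) ^ 2 ∣
      ∑ k ∈ Finset.range p, Ring.choose s k * Ring.choose (-h) k * z ^ k
      + (1 - z) ^ (2 * b) * ∑ k ∈ Finset.range p,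
          Ring.choose s k * Ring.choose (-h) k * (-(z * v)) ^ k
      - 2 * (1 - z) ^ b * ∑ k ∈ Finset.range p,
          Ring.choose (h * s) k * Ring.choose (-h - h * s) k * (-(h ^ 2 * z ^ 2 * v)) ^ k := by
  obtain ⟨m, hm⟩ := hp
  have hpm : (p : ℤ_[p]) = 2 * m + 1 := by exact_mod_cast congrArg (Nat.cast : ℕ → ℤ_[p]) hm
  set N := m - 2 * b with hN
  have dh : (p : ℤ_[p]) ∣ -h - m := ⟨-h, by rw [hpm]; linear_combination (m : ℤ_[p]) * hh⟩
  have dx : (p : ℤ_[p]) ∣ h * s - b := by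
    rw [show h * s - b = h * (s - 2 * b) by linear_combination (b : ℤ_[p]) * hh]
    exact hs.mul_left _
  have dy : (p : ℤ_[p]) ∣ -h - h * s - (m - b : ℕ) := by
    rw [Nat.cast_sub (by omega),
      show -h - h * s - ((m : ℤ_[p]) - b) = -h - m - (h * s - b) by ring]
    exact dvd_sub dh dx
  have hA : ∀ k, 2 * b + N < k → k < p →
      (p : ℤ_[p]) ^ 2 ∣ Ring.choose s k * Ring.choose (-h) k := by
    intro k hk hkp
    rw [sq]
    exact mul_dvd_mul
      (padicInt_dvd_choose (j := 2 * b) (by exact_mod_cast hs) k (by omega) hkp)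
      (padicInt_dvd_choose dh k (by omega) hkp)
  have hB : ∀ k, b + N < k → k < p →
      (p : ℤ_[p]) ^ 2 ∣ Ring.choose (h * s) k * Ring.choose (-h - h * s) k := by
    intro k hk hkp
    rw [sq]
    exact mul_dvd_mul (padicInt_dvd_choose dx k (by omega) hkp)
      (padicInt_dvd_choose dy k (by omega) hkp)
  have hE : ∀ n, 0 < n → n < p → (p : ℤ_[p]) ∣ Ring.choose (-(h * (s - 2 * b))) n :=
    fun n => padicInt_dvd_choose (j := 0) (by simpa using hs.mul_left h) n
  have hQ := sq_dvd_eval_truncatedPoly hh (s := s) (e := s - 2 * b) (b := b) (N := N) (by ring)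
    (by omega) hA hB hE (-z)
  have d1 := dvd_sum_range_sub_sum_range (n := p)
    (f := fun k => Ring.choose s k * Ring.choose (-h) k * z ^ k)
    (show 2 * b + N < p by omega) fun k hk hkp => (hA k hk hkp).mul_right _
  have d2 := dvd_sum_range_sub_sum_range (n := p)
    (f := fun k => Ring.choose s k * Ring.choose (-h) k * (-(z * v)) ^ k)
    (show 2 * b + N < p by omega) fun k hk hkp => (hA k hk hkp).mul_right _
  have d3 := dvd_sum_range_sub_sum_range (n := p)
    (f := fun k => Ring.choose (h * s) k * Ring.choose (-h - h * s) k
      * (-(h ^ 2 * z ^ 2 * v)) ^ k)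
    (show b + N < p by omega) fun k hk hkp => (hB k hk hkp).mul_right _
  have hpow : ∀ {k n : ℕ}, k ≤ n → (1 - z) ^ n * v ^ k = (1 - z) ^ (n - k) := by
    intro k n hkn
    obtain ⟨j, rfl⟩ := Nat.exists_eq_add_of_le hkn
    rw [pow_add, Nat.add_sub_cancel_left, mul_right_comm, ← mul_pow, hv, one_pow, one_mul]
  have h2 : ∀ k ∈ Finset.range (2 * b + N + 1),
      Ring.choose s k * Ring.choose (-h) k * (-z) ^ k * (1 - z) ^ (2 * b + N - k)
        = (1 - z) ^ (2 * b + N) * (Ring.choose s k * Ring.choose (-h) k * (-(z * v)) ^ k) := by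
    intro k hk
    rw [← hpow (Nat.lt_succ_iff.mp (Finset.mem_range.mp hk)), ← neg_mul, mul_pow]
    ring
  have h3 : ∀ k ∈ Finset.range (b + N + 1),
      Ring.choose (h * s) k * Ring.choose (-h - h * s) k * (-h ^ 2) ^ k * (-z) ^ (2 * k)
          * (1 - z) ^ (b + N - k)
        = (1 - z) ^ (b + N) * (Ring.choose (h * s) k * Ring.choose (-h - h * s) k
          * (-(h ^ 2 * z ^ 2 * v)) ^ k) := by
    intro k hk
    rw [← hpow (Nat.lt_succ_iff.mp (Finset.mem_range.mp hk)), ← neg_mul, ← neg_mul, mul_pow,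
      mul_pow, pow_mul, neg_sq]
    ring
  have heval : (truncatedPoly h s b N).eval (-z)
      = (1 - z) ^ N * ∑ k ∈ Finset.range (2 * b + N + 1),
          Ring.choose s k * Ring.choose (-h) k * z ^ k
        + (1 - z) ^ (2 * b + N) * ∑ k ∈ Finset.range (2 * b + N + 1),
          Ring.choose s k * Ring.choose (-h) k * (-(z * v)) ^ k
        - 2 * ((1 - z) ^ (b + N) * ∑ k ∈ Finset.range (b + N + 1),
          Ring.choose (h * s) k * Ring.choose (-h - h * s) k * (-(h ^ 2 * z ^ 2 * v)) ^ k) := by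
    rw [Finset.mul_sum (Finset.range (2 * b + N + 1)) _ ((1 - z) ^ (2 * b + N)),
      Finset.mul_sum (Finset.range (b + N + 1)) _ ((1 - z) ^ (b + N)),
      ← Finset.sum_congr rfl h2, ← Finset.sum_congr rfl h3, truncatedPoly]
    simp only [Polynomial.eval_add, Polynomial.eval_sub, Polynomial.eval_mul,
      Polynomial.eval_finsetSum, Polynomial.eval_pow, Polynomial.eval_neg, Polynomial.eval_X,
      Polynomial.eval_C, Polynomial.eval_one, Polynomial.eval_ofNat, neg_neg, ← sub_eq_add_neg]
  have hunit : (1 - z) ^ N * v ^ N = 1 := by rw [← mul_pow, hv, one_pow]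
  have htotal := ((hQ.add (d1.mul_left ((1 - z) ^ N))).add
    ((d2.mul_left ((1 - z) ^ (2 * b + N))))).sub (d3.mul_left (2 * (1 - z) ^ (b + N)))
  have := htotal.mul_left (v ^ N)
  rw [heval] at this
  convert this using 1
  rw [pow_add, pow_add]
  set S1 := ∑ k ∈ Finset.range p, Ring.choose s k * Ring.choose (-h) k * z ^ k
  set S2 := ∑ k ∈ Finset.range p, Ring.choose s k * Ring.choose (-h) k * (-(z * v)) ^ k
  set S3 := ∑ k ∈ Finset.range p,
    Ring.choose (h * s) k * Ring.choose (-h - h * s) k * (-(h ^ 2 * z ^ 2 * v)) ^ k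
  linear_combination -(S1 + (1 - z) ^ (2 * b) * S2 - 2 * (1 - z) ^ b * S3) * hunit

end PadicEvaluation

/-- p-adic analogue of `₂F₁[α,1/2;1|z] = (1−z)^{−α/2} ₂F₁[α/2,(1−α)/2;1|z²/(4z−4)]` mod `p²`. -/
theorem padic_quadratic_transformation_VII
    (p : ℕ) [Fact p.Prime] (hp : Odd p) (α z : ℤ_[p]) (hα : Even (res p (-α)))
    (hz1 : IsUnit (z - 1)) :
    ‖(∑ k ∈ Finset.range p,
        poch p (α : ℚ_[p]) k * poch p ((1 : ℚ_[p]) / 2) k / (Nat.factorial k : ℚ_[p]) ^ 2 * (z : ℚ_[p]) ^ k)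
      + (1 - (z : ℚ_[p])) ^ (res p (-α)) *
          ∑ k ∈ Finset.range p,
            poch p (α : ℚ_[p]) k * poch p ((1 : ℚ_[p]) / 2) k / (Nat.factorial k : ℚ_[p]) ^ 2
              * ((z : ℚ_[p]) / ((z : ℚ_[p]) - 1)) ^ k
      - 2 * (1 - (z : ℚ_[p])) ^ (res p (-α) / 2) *
          ∑ k ∈ Finset.range p,
            poch p ((α : ℚ_[p]) / 2) k * poch p ((1 - (α : ℚ_[p])) / 2) k / (Nat.factorial k : ℚ_[p]) ^ 2
              * ((z : ℚ_[p]) ^ 2 / (4 * (z : ℚ_[p]) - 4)) ^ k‖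
      ≤ (p : ℝ) ^ (-2 : ℤ) := by
  obtain ⟨h, hh⟩ : ∃ h : ℤ_[p], 2 * h = 1 := by
    obtain ⟨m, hm⟩ := hp
    have hpm : (p : ℤ_[p]) = 2 * m + 1 := by exact_mod_cast congrArg (Nat.cast : ℕ → ℤ_[p]) hm
    have hu : IsUnit (1 - (p : ℤ_[p])) :=
      IsLocalRing.isUnit_one_sub_self_of_mem_nonunits _ PadicInt.p_nonunit
    obtain ⟨w, hw⟩ := hu.exists_right_inv
    exact ⟨-m * w, by rw [← hw, hpm]; ring⟩
  obtain ⟨w, hw⟩ := hz1.exists_right_inv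
  obtain ⟨b, hb⟩ := even_iff_two_dvd.mp hα
  have hlt : 2 * b < p := hb ▸ ZMod.val_lt _
  have hs := padicInt_dvd_sub_res (-α)
  rw [hb] at hs
  push_cast at hs
  have main := padicInt_transformation hh hp (z := z) (v := -w) (by linear_combination hw) hlt hs
  rw [← Ideal.mem_span_singleton, ← PadicInt.norm_le_pow_iff_mem_span_pow, PadicInt.norm_def]
    at main
  have hhQ : (h : ℚ_[p]) = 1 / 2 := by
    have : (2 : ℚ_[p]) * h = 1 := by exact_mod_cast congrArg PadicInt.Coe.ringHom hh
    linear_combination this / 2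
  have hwQ : ((z : ℚ_[p]) - 1) * w = 1 := by
    exact_mod_cast congrArg PadicInt.Coe.ringHom hw
  have hwinv : (w : ℚ_[p]) = ((z : ℚ_[p]) - 1)⁻¹ := eq_inv_of_mul_eq_one_right hwQ
  have hA : ∀ k, poch p (α : ℚ_[p]) k * poch p ((1 : ℚ_[p]) / 2) k / (k.factorial : ℚ_[p]) ^ 2
      = ((Ring.choose (-α) k * Ring.choose (-h) k : ℤ_[p]) : ℚ_[p]) := fun k => by
    rw [← hhQ, poch_mul_poch_div]
  have hB : ∀ k, poch p ((α : ℚ_[p]) / 2) k * poch p ((1 - (α : ℚ_[p])) / 2) k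
        / (k.factorial : ℚ_[p]) ^ 2
      = ((Ring.choose (h * -α) k * Ring.choose (-h - h * -α) k : ℤ_[p]) : ℚ_[p]) := fun k => by
    rw [show (α : ℚ_[p]) / 2 = ((h * α : ℤ_[p]) : ℚ_[p]) by push_cast; rw [hhQ]; ring,
      show (1 - (α : ℚ_[p])) / 2 = ((h - h * α : ℤ_[p]) : ℚ_[p]) by push_cast; rw [hhQ]; ring,
      poch_mul_poch_div, show h * -α = -(h * α) by ring,
      show -h - -(h * α) = -(h - h * α) by ring]
  have hz2 : (z : ℚ_[p]) / ((z : ℚ_[p]) - 1) = ((-(z * -w) : ℤ_[p]) : ℚ_[p]) := by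
    push_cast
    rw [hwinv, div_eq_mul_inv]
    ring
  have hz3 : (z : ℚ_[p]) ^ 2 / (4 * (z : ℚ_[p]) - 4)
      = ((-(h ^ 2 * z ^ 2 * -w) : ℤ_[p]) : ℚ_[p]) := by
    push_cast
    rw [hwinv, hhQ, show 4 * (z : ℚ_[p]) - 4 = 4 * ((z : ℚ_[p]) - 1) by ring]
    field_simp
    norm_num
  simp only [hA, hB, hz2, hz3, hb, show 2 * b / 2 = b by omega]
  convert main using 2
  · push_cast [PadicInt.coe_sum]
    rfl
  · norm_num
end

section
/- Let p be an odd prime, α, β ∈ ℤ_p, and z ∈ ℤ_p^× with z − 1 ∈ ℤ_p^×. Assume: (i) ⟨−α⟩_p ≤ ⟨−β⟩_p; (ii) p + ⟨−α⟩_p > 2⟨−β⟩_p; (iii) (α−β+1)_{p−1} ≢ 0 (mod p²). Set λ = λ_p^{(2)}(α). Then ∑_{k=0}^{p−1} (α)_k²(β)_k/((k!)²(α−β+1)_k) · z^k + (−z)^{1−λ} · ∑_{k=0}^{p−1} (α)_k²(β)_k/((k!)²(α−β+1)_k) · z^{−k} ≡ (1−z)^{1−λ} · ∑_{k=0}^{p−1}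 (1−β)_k(α/2)_k((α+1)/2)_k/((k!)²(α−β+1)_k) · (−4z/(1−z)²)^k (mod p²). -/
open scoped BigOperators

open Finset

/-- The rising factorial `x (x + 1) ⋯ (x + k - 1)`. -/
def risingFactorial {R : Type*} [CommRing R] (x : R) (k : ℕ) : R :=
  ∏ i ∈ range k, (x + i)

section risingFactorial

variable {R : Type*} [CommRing R]

lemma risingFactorial_succ (x : R) (k : ℕ) :
    risingFactorial x (k + 1) = risingFactorial x k * (x + k) := by
  simp [risingFactorial, prod_range_succ]

lemma risingFactorial_succ' (x : R) (k : ℕ) :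
    risingFactorial x (k + 1) = x * risingFactorial (x + 1) k := by
  simp only [risingFactorial, prod_range_succ', Nat.cast_add, Nat.cast_one, Nat.cast_zero, add_zero]
  rw [mul_comm]
  congr 1
  exact prod_congr rfl fun i _ => by ring

lemma map_risingFactorial {S : Type*} [CommRing S] (f : R →+* S) (x : R) (k : ℕ) :
    f (risingFactorial x k) = risingFactorial (f x) k := by
  simp [risingFactorial, map_prod]

lemma ascPochhammer_eval_eq_risingFactorial (x : R) (k : ℕ) :
    (ascPochhammer R k).eval x = risingFactorial x k := by
  induction k with
  | zero => simp [risingFactorial]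
  | succ k ih => rw [ascPochhammer_succ_eval, ih, risingFactorial_succ]

lemma add_natCast_dvd_risingFactorial (x : R) {i k : ℕ} (h : i < k) :
    x + i ∣ risingFactorial x k :=
  dvd_prod_of_mem (fun i : ℕ => x + i) (mem_range.2 h)

lemma mul_dvd_risingFactorial (x : R) {i j k : ℕ} (hij : i ≠ j) (hi : i < k) (hj : j < k) :
    (x + i) * (x + j) ∣ risingFactorial x k := by
  rw [← prod_pair (f := fun i : ℕ => x + i) hij]
  exact prod_dvd_prod_of_subset _ _ _ (by
    intro t ht
    simp only [mem_insert, mem_singleton] at ht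
    rcases ht with rfl | rfl <;> simpa)

lemma risingFactorial_dvd_of_le (x : R) {k m : ℕ} (h : k ≤ m) :
    risingFactorial x k ∣ risingFactorial x m :=
  prod_dvd_prod_of_subset _ _ _ (range_mono h)

lemma isUnit_risingFactorial {x : R} {k : ℕ} (h : ∀ i < k, IsUnit (x + i)) :
    IsUnit (risingFactorial x k) := by
  rw [risingFactorial, IsUnit.prod_iff]
  exact fun i hi => h i (mem_range.1 hi)

lemma risingFactorial_sub_natCast (x : R) {k n : ℕ} (h : k ≤ n) :
    risingFactorial (x - k) n
      = (-1) ^ k * risingFactorial (1 - x) k * risingFactorial x (n - k) := by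
  induction k generalizing n with
  | zero => simp [risingFactorial]
  | succ k ih =>
    obtain ⟨m, rfl⟩ := Nat.exists_eq_add_of_le' (show 1 ≤ n by omega)
    have e : x - ((k + 1 : ℕ) : R) + 1 = x - k := by push_cast; ring
    rw [risingFactorial_succ', e, ih (by omega), risingFactorial_succ, Nat.add_sub_add_right]
    push_cast
    ring

lemma risingFactorial_neg_natCast {n k : ℕ} (h : k ≤ n) :
    risingFactorial (-(n : R)) k = (-1) ^ k * (n.choose k * k.factorial : ℕ) := by
  induction k with
  | zero => simp [risingFactorial]
  | succ k ih =>
    rw [risingFactorial_succ, ih (by omega)]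
    have : n.choose (k + 1) * (k + 1).factorial = n.choose k * k.factorial * (n - k) := by
      rw [Nat.factorial_succ]
      linear_combination k.factorial * Nat.choose_succ_right_eq n k
    rw [this]
    push_cast [Nat.cast_sub (show k ≤ n by omega)]
    ring

lemma risingFactorial_neg_natCast_of_lt {n k : ℕ} (h : n < k) :
    risingFactorial (-(n : R)) k = 0 :=
  prod_eq_zero (mem_range.2 h) (by ring)

lemma risingFactorial_one_sub_sub (x : R) {k n : ℕ} (h : k ≤ n) :
    risingFactorial (1 - n - x) k * risingFactorial x (n - k) = (-1) ^ k * risingFactorial x n := by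
  induction k with
  | zero => simp [risingFactorial]
  | succ k ih =>
    obtain ⟨m, rfl⟩ := Nat.exists_eq_add_of_le h
    have e1 : k + 1 + m - (k + 1) = m := by omega
    have e2 : k + 1 + m - k = m + 1 := by omega
    have ih' := ih (by omega)
    rw [e2, risingFactorial_succ x] at ih'
    rw [e1, risingFactorial_succ]
    push_cast at ih' ⊢
    linear_combination -ih'

end risingFactorial

section Whipple

variable {R : Type*} [CommRing R]

lemma succ_mul_sum_choose_risingFactorial (x : R) (m l : ℕ) :
    ((m : R) + 1) * ∑ k ∈ range (m + 2),
        ((m + 1).choose k * l.choose k : ℕ) * risingFactorial (x - k) (m + l + 1)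
      = (m + l + 1) * (x + m) * ∑ k ∈ range (m + 1),
        (m.choose k * l.choose k : ℕ) * risingFactorial (x - k) (m + l) := by
  have step (k : ℕ) : ((m : R) + l + 1) * (x + m) * risingFactorial (x - k) (m + l)
      = (m + k + 1) * risingFactorial (x - k) (m + l + 1)
        + (l - k) * risingFactorial (x - (k + 1 : ℕ)) (m + l + 1) := by
    rw [risingFactorial_succ, risingFactorial_succ']
    have : x - ((k + 1 : ℕ) : R) + 1 = x - k := by push_cast; ring
    rw [this]
    push_cast
    ring
  have hr : ∀ k, ((m : R) + l + 1) * (x + m) *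
      ((m.choose k * l.choose k : ℕ) * risingFactorial (x - k) (m + l))
      = (m.choose k * l.choose k : ℕ) * (m + k + 1) * risingFactorial (x - k) (m + l + 1)
        + (m.choose k * l.choose k : ℕ) * (l - k)
          * risingFactorial (x - (k + 1 : ℕ)) (m + l + 1) := by
    intro k
    linear_combination (m.choose k * l.choose k : ℕ) * step k
  rw [mul_sum, mul_sum, sum_congr rfl fun k _ => hr k, sum_add_distrib,
    sum_range_succ' _ (m + 1)]
  have h0 := sum_range_succ' (fun k : ℕ => ((m.choose k * l.choose k : ℕ) : R) * (m + k + 1) *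
      risingFactorial (x - k) (m + l + 1)) (m + 1)
  rw [sum_range_succ] at h0
  simp only [Nat.choose_succ_self, zero_mul, Nat.cast_zero, add_zero] at h0
  rw [h0, add_right_comm (∑ k ∈ range (m + 1), _), ← sum_add_distrib]
  congr 1
  · refine sum_congr rfl fun k _ => ?_
    have a1 : ((m + 1).choose (k + 1) : R) = m.choose k + m.choose (k + 1) := by
      rw [Nat.choose_succ_succ]; push_cast; ring
    have a2 : (m.choose (k + 1) : R) * (k + 1) = m.choose k * (m - k) := by
      rcases le_or_gt k m with h | h
      · have := congrArg (Nat.cast (R := R)) (Nat.choose_succ_right_eq m k)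
        push_cast [Nat.cast_sub h] at this
        exact this
      · simp [Nat.choose_eq_zero_of_lt h, Nat.choose_eq_zero_of_lt (Nat.lt_succ_of_lt h)]
    have a3 : (l.choose (k + 1) : R) * (k + 1) = l.choose k * (l - k) := by
      rcases le_or_gt k l with h | h
      · have := congrArg (Nat.cast (R := R)) (Nat.choose_succ_right_eq l k)
        push_cast [Nat.cast_sub h] at this
        exact this
      · simp [Nat.choose_eq_zero_of_lt h, Nat.choose_eq_zero_of_lt (Nat.lt_succ_of_lt h)]
    push_cast
    rw [a1]
    linear_combination risingFactorial (x - ((k : R) + 1)) (m + l + 1) *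
      (-(l.choose (k + 1) : R) * a2 + (m.choose k : R) * a3)
  · simp

lemma choose_mul_risingFactorial_mul_risingFactorial [IsDomain R] [CharZero R] (x : R) (m l : ℕ) :
    ((m + l).choose m : R) * risingFactorial x m * risingFactorial x l
      = ∑ k ∈ range (m + 1),
        (m.choose k * l.choose k : ℕ) * risingFactorial (x - k) (m + l) := by
  induction m with
  | zero => simp [risingFactorial]
  | succ m ih =>
    have h := succ_mul_sum_choose_risingFactorial x m l
    rw [← ih] at h
    have hm : (m : R) + 1 ≠ 0 := by exact_mod_cast Nat.succ_ne_zero m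
    apply mul_left_cancel₀ hm
    rw [show m + 1 + l = m + l + 1 by ring, h, risingFactorial_succ]
    have hc := congrArg (Nat.cast (R := R)) (Nat.add_one_mul_choose_eq (m + l) m)
    push_cast at hc
    linear_combination -(risingFactorial x m * (x + m) * risingFactorial x l) * hc

lemma choose_mul_choose_mul_choose_sub {n m k : ℕ} (hk : k ≤ m) (hm : m ≤ n) :
    n.choose (2 * k) * (2 * k).choose k * (n - 2 * k).choose (m - k)
      = n.choose m * (m.choose k * (n - m).choose k) := by
  rcases le_or_gt k (n - m) with h | h
  · obtain ⟨i, rfl⟩ := Nat.exists_eq_add_of_le hk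
    obtain ⟨j, hj⟩ := Nat.exists_eq_add_of_le h
    have e : n = k + i + (k + j) := by omega
    subst e
    have e1 : k + i + (k + j) - 2 * k = i + j := by omega
    have e2 : k + i + (k + j) - (k + i) = k + j := by omega
    have e3 : k + i - k = i := by omega
    rw [e1, e2, e3]
    have f1 := Nat.add_choose_mul_factorial_mul_factorial (2 * k) (i + j)
    have f2 := Nat.add_choose_mul_factorial_mul_factorial k k
    have f3 := Nat.add_choose_mul_factorial_mul_factorial i j
    have f4 := Nat.add_choose_mul_factorial_mul_factorial (k + i) (k + j)
    have f5 := Nat.add_choose_mul_factorial_mul_factorial k i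
    have f6 := Nat.add_choose_mul_factorial_mul_factorial k j
    rw [← Nat.choose_symm_add] at f1 f3 f4 f5 f6
    rw [← two_mul] at f2
    have e4 : 2 * k + (i + j) = k + i + (k + j) := by ring
    rw [e4] at f1
    have hpos : 0 < k.factorial * k.factorial * i.factorial * j.factorial := by positivity
    apply Nat.eq_of_mul_eq_mul_right hpos
    rw [← f2, ← f3] at f1
    rw [← f5, ← f6] at f4
    calc _ = (k + i + (k + j)).factorial := by rw [← f1]; ring
      _ = _ := by rw [← f4]; ring
  · rw [Nat.choose_eq_zero_of_lt h]
    rcases le_or_gt (2 * k) n with h2 | h2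
    · rw [Nat.choose_eq_zero_of_lt (show n - 2 * k < m - k by omega)]; simp
    · rw [Nat.choose_eq_zero_of_lt h2]; simp

/-- Whipple's quadratic transformation of a terminating well-poised `₃F₂`, cleared of
denominators. -/
theorem whipple_quadratic_terminating [IsDomain R] [CharZero R] (x z : R) {n N : ℕ}
    (hN : n < 2 * N) :
    ∑ m ∈ range (n + 1), (n.choose m : R) ^ 2 * (-1) ^ m * risingFactorial x m
        * risingFactorial x (n - m) * z ^ m
      = ∑ k ∈ range N, (n.choose (2 * k) * (2 * k).choose k : ℕ) * risingFactorial (1 - x) k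
        * risingFactorial x (n - k) * z ^ k * (1 - z) ^ (n - 2 * k) := by
  have expand (k : ℕ) (hk : 2 * k ≤ n) : z ^ k * (1 - z) ^ (n - 2 * k)
      = ∑ m ∈ range (n + 1), if k ≤ m then
        ((n - 2 * k).choose (m - k) : R) * (-1) ^ (m - k) * z ^ m else 0 := by
    rw [← sum_filter]
    have hf : (range (n + 1)).filter (fun m => k ≤ m) = Ico k (n + 1) := by
      ext; simp; omega
    rw [hf, sum_Ico_eq_sum_range, show 1 - z = -z + 1 by ring, add_pow, mul_sum]
    have := eventually_constant_sum (N := n - 2 * k + 1) (n := n + 1 - k)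
      (u := fun i => ((n - 2 * k).choose (k + i - k) : R) * (-1) ^ (k + i - k) * z ^ (k + i))
      (by
        intro i hi
        rw [Nat.choose_eq_zero_of_lt (show n - 2 * k < k + i - k by omega)]; simp)
      (by omega)
    rw [this]
    refine sum_congr rfl fun i _ => ?_
    rw [Nat.add_sub_cancel_left, neg_pow z i, pow_add]
    ring
  have rhs : ∀ k ∈ range N, (n.choose (2 * k) * (2 * k).choose k : ℕ) * risingFactorial (1 - x) k
        * risingFactorial x (n - k) * z ^ k * (1 - z) ^ (n - 2 * k)
      = ∑ m ∈ range (n + 1), (n.choose m : R) * (-1) ^ m * z ^ m *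
        ((m.choose k * (n - m).choose k : ℕ) * risingFactorial (x - k) n) := by
    intro k _
    rcases le_or_gt (2 * k) n with h | h
    · rw [mul_assoc _ (z ^ k), expand k h, mul_sum]
      refine sum_congr rfl fun m hm => ?_
      rw [mem_range] at hm
      split_ifs with hkm
      · rw [risingFactorial_sub_natCast x (show k ≤ n by omega)]
        have c := congrArg (Nat.cast (R := R))
          (choose_mul_choose_mul_choose_sub hkm (show m ≤ n by omega))
        obtain ⟨i, rfl⟩ := Nat.exists_eq_add_of_le hkm
        have s : ((-1 : R)) ^ k * (-1) ^ k = 1 := by rw [← mul_pow]; simp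
        rw [Nat.add_sub_cancel_left] at c ⊢
        push_cast at c ⊢
        rw [pow_add (-1 : R)]
        linear_combination (risingFactorial (1 - x) k * risingFactorial x (n - k) * (-1) ^ i
          * z ^ (k + i)) * c - ((n.choose (k + i) : R) * (-1) ^ i * z ^ (k + i) *
          ((k + i).choose k * (n - (k + i)).choose k) * risingFactorial (1 - x) k *
          risingFactorial x (n - k)) * s
      · rw [Nat.choose_eq_zero_of_lt (show m < k by omega)]; simp
    · rw [Nat.choose_eq_zero_of_lt h]
      symm
      simp only [zero_mul, Nat.cast_zero]
      refine sum_eq_zero fun m hm => ?_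
      rcases lt_or_ge m k with h' | h'
      · rw [Nat.choose_eq_zero_of_lt h']; simp
      · rw [Nat.choose_eq_zero_of_lt (show n - m < k by omega)]; simp
  rw [sum_congr rfl rhs, sum_comm]
  refine sum_congr rfl fun m hm => ?_
  rw [mem_range] at hm
  rw [← mul_sum]
  have hs : ∑ k ∈ range N, ((m.choose k * (n - m).choose k : ℕ) : R) * risingFactorial (x - k) n
      = ∑ k ∈ range (m + 1),
        ((m.choose k * (n - m).choose k : ℕ) : R) * risingFactorial (x - k) n := by
    have hz : ∀ k ≥ min N (m + 1),
        ((m.choose k * (n - m).choose k : ℕ) : R) * risingFactorial (x - k) n = 0 := by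
      intro k hk
      rcases lt_or_ge m k with h' | h'
      · rw [Nat.choose_eq_zero_of_lt h']; simp
      · rw [Nat.choose_eq_zero_of_lt (show n - m < k by omega)]; simp
    rw [eventually_constant_sum hz (min_le_left _ _), eventually_constant_sum hz (min_le_right _ _)]
  have key := choose_mul_risingFactorial_mul_risingFactorial x m (n - m)
  rw [Nat.add_sub_cancel' (show m ≤ n by omega)] at key
  rw [hs, ← key]
  ring

end Whipple

section Defect

variable {R : Type*} [CommRing R]

/-- The cofactor of `(k!)² (c)_k` in `(M!)² (c)_M`. -/
def denomTail (M k : ℕ) (c : R) : R :=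
  ∏ i ∈ Ico k M, (((i : R) + 1) ^ 2 * (c + i))

/-- The first `N` terms of the well-poised `₃F₂(α, α, β; 1, α - β + 1; x)`, multiplied by
`(M!)² (α - β + 1)_M`. -/
def wellPoisedSum (M N : ℕ) (α β x : R) : R :=
  ∑ k ∈ range N, risingFactorial α k ^ 2 * risingFactorial β k * denomTail M k (α - β + 1) * x ^ k

/-- The first `M + 1` terms of `₃F₂(1 - β, α / 2, (α + 1) / 2; 1, α - β + 1; 4 w)`, multiplied by
`(M!)² (α - β + 1)_M`. -/
def quadraticSum (M : ℕ) (α β w : R) : R :=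
  ∑ k ∈ range (M + 1),
    risingFactorial (1 - β) k * risingFactorial α (2 * k) * denomTail M k (α - β + 1) * w ^ k

/-- The difference of the two sides of the truncated Whipple transformation, multiplied by
`(M!)² (α - β + 1)_M`. Here `u` and `y` stand for the inverses of `z` and `1 - z`. -/
def whippleDefect (M a e : ℕ) (α β z u y : R) : R :=
  wellPoisedSum M (a + 1) α β z + (-z) ^ e * wellPoisedSum M (a + 1) α β u
    - (1 - z) ^ e * quadraticSum M α β (-(z * y ^ 2))

section map

variable {S : Type*} [CommRing S] (f : R →+* S)

lemma map_denomTail (M k : ℕ) (c : R) : f (denomTail M k c) = denomTail M k (f c) := by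
  simp [denomTail, map_prod]

lemma map_wellPoisedSum (M N : ℕ) (α β x : R) :
    f (wellPoisedSum M N α β x) = wellPoisedSum M N (f α) (f β) (f x) := by
  simp [wellPoisedSum, map_sum, map_denomTail, map_risingFactorial]

lemma map_quadraticSum (M : ℕ) (α β w : R) :
    f (quadraticSum M α β w) = quadraticSum M (f α) (f β) (f w) := by
  simp [quadraticSum, map_sum, map_denomTail, map_risingFactorial]

lemma map_whippleDefect (M a e : ℕ) (α β z u y : R) :
    f (whippleDefect M a e α β z u y) = whippleDefect M a e (f α) (f β) (f z) (f u) (f y) := by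
  simp [whippleDefect, map_wellPoisedSum, map_quadraticSum]

end map

lemma denomTail_mul {M k : ℕ} (h : k ≤ M) (c : R) :
    denomTail M k c * ((k.factorial : R) ^ 2 * risingFactorial c k) = denomTail M 0 c := by
  have hk : (k.factorial : R) ^ 2 * risingFactorial c k
      = ∏ i ∈ range k, (((i : R) + 1) ^ 2 * (c + i)) := by
    rw [prod_mul_distrib, prod_pow, risingFactorial, ← prod_range_add_one_eq_factorial]
    push_cast
    rfl
  rw [hk, denomTail, denomTail, mul_comm, prod_range_mul_prod_Ico _ h, range_eq_Ico]

/-- The coefficient of `z ^ k` in the denominator-free terminating well-poised `₃F₂`. -/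
def wellPoisedCoeff (n : ℕ) (β : R) (k : ℕ) : R :=
  (n.choose k : R) ^ 2 * (-1) ^ k * risingFactorial β k * risingFactorial β (n - k)

lemma wellPoisedCoeff_sub {n k : ℕ} (h : k ≤ n) (β : R) :
    wellPoisedCoeff n β (n - k) = (-1) ^ n * wellPoisedCoeff n β k := by
  obtain ⟨m, rfl⟩ := Nat.exists_eq_add_of_le h
  have s : ((-1 : R)) ^ k * (-1) ^ k = 1 := by rw [← mul_pow]; simp
  rw [wellPoisedCoeff, wellPoisedCoeff, Nat.choose_symm h, Nat.add_sub_cancel_left,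
    Nat.add_sub_cancel, pow_add]
  linear_combination (-((k + m).choose k : R) ^ 2 * (-1) ^ m * risingFactorial β k
    * risingFactorial β m) * s

lemma risingFactorial_mul_wellPoised_term {M n k : ℕ} (hM : k ≤ M) (hn : k ≤ n) (β : R) :
    risingFactorial β n * (risingFactorial (-(n : R)) k ^ 2 * risingFactorial β k
        * denomTail M k (-(n : R) - β + 1))
      = denomTail M 0 (-(n : R) - β + 1) * wellPoisedCoeff n β k := by
  have h := risingFactorial_one_sub_sub β hn
  rw [show 1 - (n : R) - β = -n - β + 1 by ring] at h
  rw [risingFactorial_neg_natCast hn, ← denomTail_mul hM, wellPoisedCoeff]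
  push_cast
  linear_combination (-(n.choose k : R) ^ 2 * (-1) ^ k * (k.factorial : R) ^ 2 *
    risingFactorial β k * denomTail M k (-(n : R) - β + 1)) * h

lemma risingFactorial_mul_wellPoisedSum {M n N : ℕ} (hM : N ≤ M + 1) (hn : N ≤ n + 1) (β x : R) :
    risingFactorial β n * wellPoisedSum M N (-(n : R)) β x
      = denomTail M 0 (-(n : R) - β + 1) * ∑ k ∈ range N, wellPoisedCoeff n β k * x ^ k := by
  rw [wellPoisedSum, mul_sum, mul_sum]
  refine sum_congr rfl fun k hk => ?_
  rw [mem_range] at hk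
  linear_combination x ^ k * risingFactorial_mul_wellPoised_term (show k ≤ M by omega)
    (show k ≤ n by omega) β

lemma risingFactorial_mul_quadraticSum [IsDomain R] [CharZero R] {M n : ℕ} (hM : n < 2 * (M + 1))
    (β : R) {z y : R} (hy : (1 - z) * y = 1) :
    risingFactorial β n * ((1 - z) ^ n * quadraticSum M (-(n : R)) β (-(z * y ^ 2)))
      = denomTail M 0 (-(n : R) - β + 1) *
        ∑ k ∈ range (n + 1), wellPoisedCoeff n β k * z ^ k := by
  simp only [wellPoisedCoeff]
  rw [whipple_quadratic_terminating β z hM, quadraticSum, mul_sum, mul_sum, mul_sum]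
  refine sum_congr rfl fun k hk => ?_
  rw [mem_range] at hk
  rcases le_or_gt (2 * k) n with h | h
  · have h1 := risingFactorial_one_sub_sub β (show k ≤ n by omega)
    rw [show 1 - (n : R) - β = -n - β + 1 by ring] at h1
    have hf : ((2 * k).factorial : R) = (2 * k).choose k * k.factorial ^ 2 := by
      have := Nat.add_choose_mul_factorial_mul_factorial k k
      rw [← two_mul] at this
      rw [← this]
      push_cast
      ring
    have hpow : (1 - z) ^ n * (-(z * y ^ 2)) ^ k = (-1) ^ k * z ^ k * (1 - z) ^ (n - 2 * k) := by
      obtain ⟨m, rfl⟩ := Nat.exists_eq_add_of_le h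
      have : ((1 - z) * y) ^ (2 * k) = 1 := by rw [hy, one_pow]
      rw [mul_pow, pow_mul y] at this
      rw [Nat.add_sub_cancel_left, neg_pow, mul_pow, pow_add]
      linear_combination (-1) ^ k * z ^ k * (1 - z) ^ m * this
    rw [risingFactorial_neg_natCast h, ← denomTail_mul (show k ≤ M by omega), pow_mul, neg_one_sq,
      one_pow]
    push_cast
    rw [hf]
    set c : R := (n.choose (2 * k) : R)
    set d : R := ((2 * k).choose k : R)
    set D := denomTail M k (-(n : R) - β + 1)
    linear_combination (risingFactorial β n * risingFactorial (1 - β) k * c * d *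
      (k.factorial : R) ^ 2 * D) * hpow - (D * (k.factorial : R) ^ 2 * c * d *
      risingFactorial (1 - β) k * z ^ k * (1 - z) ^ (n - 2 * k)) * h1
  · rw [risingFactorial_neg_natCast_of_lt h, Nat.choose_eq_zero_of_lt h]
    simp

lemma pow_mul_sum_wellPoisedCoeff {n N : ℕ} (hn : N ≤ n + 1) (β : R) {z u : R} (hu : z * u = 1) :
    (-z) ^ n * ∑ k ∈ range N, wellPoisedCoeff n β k * u ^ k
      = ∑ k ∈ Ico (n + 1 - N) (n + 1), wellPoisedCoeff n β k * z ^ k := by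
  have hr := sum_Ico_reflect (fun k => wellPoisedCoeff n β k * z ^ k) 0 hn
  rw [Nat.sub_zero] at hr
  rw [← hr, ← range_eq_Ico, mul_sum]
  refine sum_congr rfl fun k hk => ?_
  rw [mem_range] at hk
  have hk' : k ≤ n := by omega
  rw [wellPoisedCoeff_sub hk']
  obtain ⟨m, rfl⟩ := Nat.exists_eq_add_of_le hk'
  have : (z * u) ^ k = 1 := by rw [hu, one_pow]
  rw [mul_pow] at this
  rw [Nat.add_sub_cancel_left, neg_pow, pow_add z]
  linear_combination ((-1) ^ (k + m) * z ^ m * wellPoisedCoeff (k + m) β k) * this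

lemma whippleDefect_eq_zero [IsDomain R] [CharZero R] {M a : ℕ} (hM : a ≤ M) {β z u y : R}
    (hβ : risingFactorial β a ≠ 0) (hu : z * u = 1) (hy : (1 - z) * y = 1) :
    whippleDefect M a (1 + a) (-(a : R)) β z u y = 0 := by
  apply (mul_eq_zero.1 _).resolve_left hβ
  have h1 := risingFactorial_mul_wellPoisedSum (show a + 1 ≤ M + 1 by omega) le_rfl β z
  have h2 := risingFactorial_mul_wellPoisedSum (show a + 1 ≤ M + 1 by omega) le_rfl β u
  have h3 := risingFactorial_mul_quadraticSum (show a < 2 * (M + 1) by omega) β hy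
  have h4 := pow_mul_sum_wellPoisedCoeff (le_refl (a + 1)) β hu
  rw [Nat.sub_self, ← range_eq_Ico] at h4
  rw [whippleDefect, pow_add, pow_add]
  linear_combination h1 - z * (-z) ^ a * h2 - (1 - z) * h3
    - z * denomTail M 0 (-(a : R) - β + 1) * h4

lemma sq_dvd_whippleDefect [IsDomain R] [CharZero R] {p M a b : ℕ} (hp : p.Prime) (hM : a ≤ M)
    (hMp : a + p < 2 * (M + 1)) (hab : a ≤ b) (hb : 2 * b < p + a) {β z u y : R}
    (hβ : β + b ≠ 0) (hβu : ∀ i < a + p, i ≠ b → IsUnit (β + i))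
    (hu : z * u = 1) (hy : (1 - z) * y = 1) :
    (p : R) ^ 2 ∣ whippleDefect M a (a + p) (-((a + p : ℕ) : R)) β z u y := by
  set n := a + p with hn
  have h1 := risingFactorial_mul_wellPoisedSum (show a + 1 ≤ M + 1 by omega)
    (show a + 1 ≤ n + 1 by omega) β z
  have h2 := risingFactorial_mul_wellPoisedSum (show a + 1 ≤ M + 1 by omega)
    (show a + 1 ≤ n + 1 by omega) β u
  have h3 := risingFactorial_mul_quadraticSum hMp β hy
  have h4 := pow_mul_sum_wellPoisedCoeff (show a + 1 ≤ n + 1 by omega) β hu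
  rw [show n + 1 - (a + 1) = p by omega] at h4
  have h5 : ∑ k ∈ range (n + 1), wellPoisedCoeff n β k * z ^ k
      = ∑ k ∈ range (a + 1), wellPoisedCoeff n β k * z ^ k
        + ∑ k ∈ Ico (a + 1) p, wellPoisedCoeff n β k * z ^ k
        + ∑ k ∈ Ico p (n + 1), wellPoisedCoeff n β k * z ^ k := by
    rw [sum_range_add_sum_Ico _ (show a + 1 ≤ p by omega),
      sum_range_add_sum_Ico _ (show p ≤ n + 1 by omega)]
  have key : risingFactorial β n * whippleDefect M a n (-(n : R)) β z u y
      = -denomTail M 0 (-(n : R) - β + 1) *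
        ∑ k ∈ Ico (a + 1) p, wellPoisedCoeff n β k * z ^ k := by
    rw [whippleDefect]
    linear_combination h1 + (-z) ^ n * h2 - h3 + denomTail M 0 (-(n : R) - β + 1) * (h4 - h5)
  have hdvd : (β + b) * (p : R) ^ 2 ∣
      risingFactorial β n * whippleDefect M a n (-(n : R)) β z u y := by
    rw [key]
    refine Dvd.dvd.mul_left (dvd_sum fun k hk => Dvd.dvd.mul_right ?_ _) _
    rw [mem_Ico] at hk
    have hc : (p : R) ∣ (n.choose k : R) := by
      have := hp.dvd_choose_add (a := k) (b := n - k) (by omega) (by omega) (by omega)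
      rw [show k + (n - k) = n by omega] at this
      exact_mod_cast Nat.cast_dvd_cast (α := R) this
    have hbk : β + b ∣ risingFactorial β k * risingFactorial β (n - k) := by
      rcases lt_or_ge b k with h | h
      · exact (add_natCast_dvd_risingFactorial β h).mul_right _
      · exact (add_natCast_dvd_risingFactorial β (show b < n - k by omega)).mul_left _
    have := mul_dvd_mul hbk (pow_dvd_pow_of_dvd hc 2)
    rw [wellPoisedCoeff]
    refine this.trans ⟨(-1) ^ k, by ring⟩
  have hfac : risingFactorial β n = (β + b) * ∏ i ∈ (range n).erase b, (β + i) :=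
    (mul_prod_erase (range n) (fun i : ℕ => β + i) (mem_range.2 (by omega))).symm
  have hunit : IsUnit (∏ i ∈ (range n).erase b, (β + i)) := by
    rw [IsUnit.prod_iff]
    intro i hi
    rw [mem_erase, mem_range] at hi
    exact hβu i hi.2 hi.1
  rw [hfac, mul_assoc] at hdvd
  exact (hunit.dvd_mul_left).1 ((mul_dvd_mul_iff_left hβ).1 hdvd)

end Defect

section Interpolation

variable {R : Type*} [CommRing R]

/-- `f` agrees modulo `q ^ 2` with a function `r ↦ A + q r B`. -/
def IsAffineModSq (q : R) (f : ℕ → R) : Prop :=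
  ∃ A B : R, ∃ c : ℕ → R, ∀ r, f r = A + q * r * B + q ^ 2 * c r

namespace IsAffineModSq

variable {q : R} {f g : ℕ → R}

lemma const (q a : R) : IsAffineModSq q fun _ => a :=
  ⟨a, 0, 0, fun r => by simp⟩

lemma add (hf : IsAffineModSq q f) (hg : IsAffineModSq q g) :
    IsAffineModSq q fun r => f r + g r := by
  obtain ⟨A, B, c, h⟩ := hf
  obtain ⟨A', B', c', h'⟩ := hg
  refine ⟨A + A', B + B', fun r => c r + c' r, fun r => ?_⟩
  beta_reduce
  rw [h, h']
  ring

lemma mul (hf : IsAffineModSq q f) (hg : IsAffineModSq q g) :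
    IsAffineModSq q fun r => f r * g r := by
  obtain ⟨A, B, c, h⟩ := hf
  obtain ⟨A', B', c', h'⟩ := hg
  refine ⟨A * A', A * B' + B * A', fun r => f r * c' r + c r * (A' + q * r * B')
    + r ^ 2 * B * B', fun r => ?_⟩
  beta_reduce
  rw [h' r]
  linear_combination (A' + q * r * B') * h r

lemma sub (hf : IsAffineModSq q f) (hg : IsAffineModSq q g) :
    IsAffineModSq q fun r => f r - g r := by
  simpa [sub_eq_add_neg] using hf.add ((const q (-1)).mul hg)

lemma pow {v : R} (hv : q ∣ v - 1) : IsAffineModSq q fun r => v ^ r := by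
  obtain ⟨t, ht⟩ := hv
  have h (r : ℕ) : ∃ c, v ^ r = 1 + q * r * t + q ^ 2 * c := by
    induction r with
    | zero => exact ⟨0, by simp⟩
    | succ r ih =>
      obtain ⟨c, hc⟩ := ih
      refine ⟨c * v + r * t ^ 2, ?_⟩
      rw [pow_succ, hc]
      push_cast
      linear_combination (1 + q * r * t) * ht
  choose c hc using h
  exact ⟨1, t, c, hc⟩

lemma polynomial_eval (q a : R) (P : Polynomial R) :
    IsAffineModSq q fun r => P.eval (a + q * r) := by
  refine ⟨P.eval a, P.derivative.eval a, fun r => r ^ 2 * (P.binomExpansion a (q * r)).1,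
    fun r => ?_⟩
  linear_combination (P.binomExpansion a (q * r)).2

lemma sq_dvd (hf : IsAffineModSq q f) (h0 : q ^ 2 ∣ f 0) (h1 : q ^ 2 ∣ f 1) (r : ℕ) :
    q ^ 2 ∣ f r := by
  obtain ⟨A, B, c, h⟩ := hf
  obtain ⟨s, hs⟩ := h0
  obtain ⟨t, ht⟩ := h1
  have e0 := h 0
  have e1 := h 1
  push_cast at e0 e1
  refine ⟨s - c 0 + r * (t - c 1 - s + c 0) + c r, ?_⟩
  linear_combination h r + (1 - (r : R)) * (hs - e0) + r * (ht - e1)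

end IsAffineModSq

lemma isAffineModSq_wellPoisedSum (M N : ℕ) (q a β x : R) :
    IsAffineModSq q fun r => wellPoisedSum M N (a + q * r) β x := by
  have h (t : R) : (wellPoisedSum M N Polynomial.X (Polynomial.C β) (Polynomial.C x)).eval t
      = wellPoisedSum M N t β x := by
    rw [← Polynomial.coe_evalRingHom, map_wellPoisedSum]
    simp
  simpa only [h] using IsAffineModSq.polynomial_eval q a
    (wellPoisedSum M N Polynomial.X (Polynomial.C β) (Polynomial.C x))

lemma isAffineModSq_quadraticSum (M : ℕ) (q a β w : R) :
    IsAffineModSq q fun r => quadraticSum M (a + q * r) β w := by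
  have h (t : R) : (quadraticSum M Polynomial.X (Polynomial.C β) (Polynomial.C w)).eval t
      = quadraticSum M t β w := by
    rw [← Polynomial.coe_evalRingHom, map_quadraticSum]
    simp
  simpa only [h] using IsAffineModSq.polynomial_eval q a
    (quadraticSum M Polynomial.X (Polynomial.C β) (Polynomial.C w))

lemma isAffineModSq_whippleDefect (M a d m : ℕ) {q α β z u y : R} (hz : q ∣ (-z) ^ d - 1)
    (hz1 : q ∣ (1 - z) ^ d - 1) :
    IsAffineModSq q fun r => whippleDefect M a (m + d * r) (α + q * r) β z u y := by
  simp only [whippleDefect, pow_add, pow_mul]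
  exact ((isAffineModSq_wellPoisedSum ..).add ((((IsAffineModSq.const q _).mul
    (IsAffineModSq.pow hz)).mul (isAffineModSq_wellPoisedSum ..)))).sub
    (((IsAffineModSq.const q _).mul (IsAffineModSq.pow hz1)).mul
      (isAffineModSq_quadraticSum ..))

end Interpolation

section Field

variable {K : Type*} [Field K]

lemma denomTail_eq_div {M k : ℕ} (h : k ≤ M) {c : K} (h0 : denomTail M 0 c ≠ 0) :
    denomTail M k c = denomTail M 0 c / ((k.factorial : K) ^ 2 * risingFactorial c k) := by
  have := denomTail_mul h c
  rw [eq_div_iff, this]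
  intro hz
  exact h0 (by rw [← this, hz, mul_zero])

lemma wellPoisedSum_eq_mul_sum {M N : ℕ} (h : N ≤ M + 1) {α β : K} (x : K)
    (h0 : denomTail M 0 (α - β + 1) ≠ 0) :
    wellPoisedSum M N α β x = denomTail M 0 (α - β + 1) * ∑ k ∈ range N,
      risingFactorial α k ^ 2 * risingFactorial β k
        / ((k.factorial : K) ^ 2 * risingFactorial (α - β + 1) k) * x ^ k := by
  rw [wellPoisedSum, mul_sum]
  refine sum_congr rfl fun k hk => ?_
  rw [mem_range] at hk
  rw [denomTail_eq_div (show k ≤ M by omega) h0]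
  ring

lemma quadraticSum_eq_mul_sum {M : ℕ} {α β : K} (w : K)
    (h0 : denomTail M 0 (α - β + 1) ≠ 0) :
    quadraticSum M α β w = denomTail M 0 (α - β + 1) * ∑ k ∈ range (M + 1),
      risingFactorial (1 - β) k * risingFactorial α (2 * k)
        / ((k.factorial : K) ^ 2 * risingFactorial (α - β + 1) k) * w ^ k := by
  rw [quadraticSum, mul_sum]
  refine sum_congr rfl fun k hk => ?_
  rw [mem_range] at hk
  rw [denomTail_eq_div (show k ≤ M by omega) h0]
  ring

lemma risingFactorial_half_mul_half (h2 : (2 : K) ≠ 0) (x : K) (k : ℕ) :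
    risingFactorial (x / 2) k * risingFactorial ((x + 1) / 2) k * 4 ^ k
      = risingFactorial x (2 * k) := by
  induction k with
  | zero => simp [risingFactorial]
  | succ k ih =>
    rw [Nat.mul_succ, risingFactorial_succ, risingFactorial_succ, risingFactorial_succ,
      risingFactorial_succ, ← ih]
    push_cast
    field_simp
    ring

end Field

section Padic

variable {p : ℕ} [hp : Fact p.Prime]

lemma PadicInt.toZMod_eq_zero_iff_dvd (x : ℤ_[p]) : PadicInt.toZMod x = 0 ↔ (p : ℤ_[p]) ∣ x := by
  rw [← RingHom.mem_ker, PadicInt.ker_toZMod, PadicInt.maximalIdeal_eq_span_p,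
    Ideal.mem_span_singleton]

lemma PadicInt.toZModPow_eq_zero_iff_dvd (n : ℕ) (x : ℤ_[p]) :
    PadicInt.toZModPow n x = 0 ↔ (p : ℤ_[p]) ^ n ∣ x := by
  rw [← RingHom.mem_ker, PadicInt.ker_toZModPow, Ideal.mem_span_singleton]

lemma PadicInt.isUnit_iff_not_dvd (x : ℤ_[p]) : IsUnit x ↔ ¬ (p : ℤ_[p]) ∣ x := by
  rw [← Ideal.mem_span_singleton, ← PadicInt.maximalIdeal_eq_span_p,
    IsLocalRing.mem_maximalIdeal, mem_nonunits_iff, not_not]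

lemma PadicInt.natCast_dvd_intCast (m : ℤ) : (p : ℤ_[p]) ∣ (m : ℤ_[p]) ↔ (p : ℤ) ∣ m := by
  simpa using PadicInt.pow_p_dvd_int_iff 1 m

lemma PadicInt.isUnit_intCast_of_pos_of_lt {m : ℤ} (h0 : 0 < m) (h : m < p) :
    IsUnit (m : ℤ_[p]) := by
  rw [PadicInt.isUnit_iff_not_dvd, PadicInt.natCast_dvd_intCast]
  exact fun hd => absurd (Int.le_of_dvd h0 hd) (by omega)

lemma PadicInt.isUnit_of_dvd_sub {x : ℤ_[p]} {m : ℤ} (hx : (p : ℤ_[p]) ∣ x - m)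
    (hm : ¬ (p : ℤ) ∣ m) : IsUnit x := by
  rw [PadicInt.isUnit_iff_not_dvd]
  intro h
  apply hm
  rw [← PadicInt.natCast_dvd_intCast]
  simpa using dvd_sub h hx

lemma PadicInt.dvd_pow_sub_one {v : ℤ_[p]} (hv : IsUnit v) : (p : ℤ_[p]) ∣ v ^ (p - 1) - 1 := by
  rw [← PadicInt.toZMod_eq_zero_iff_dvd, map_sub, map_pow, map_one,
    ZMod.pow_card_sub_one_eq_one, sub_self]
  rw [Ne, PadicInt.toZMod_eq_zero_iff_dvd, ← PadicInt.isUnit_iff_not_dvd]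
  exact hv

lemma dvd_add_res_neg (x : ℤ_[p]) : (p : ℤ_[p]) ∣ x + res p (-x) := by
  rw [← PadicInt.toZMod_eq_zero_iff_dvd, map_add, map_natCast, res, ZMod.natCast_zmod_val, map_neg,
    add_neg_cancel]

lemma res_lt (x : ℤ_[p]) : res p x < p :=
  ZMod.val_lt _

lemma sq_dvd_add_res2_neg (x : ℤ_[p]) : (p : ℤ_[p]) ^ 2 ∣ x + res2 p (-x) := by
  have : NeZero (p ^ 2) := ⟨pow_ne_zero _ hp.out.ne_zero⟩
  rw [← PadicInt.toZModPow_eq_zero_iff_dvd, map_add, map_natCast, res2, ZMod.natCast_zmod_val,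
    map_neg, add_neg_cancel]

lemma res2_eq_res_add_mul (x : ℤ_[p]) : ∃ r : ℕ, res2 p x = res p x + p * r := by
  have h1 := dvd_add_res_neg (-x)
  have h2 := (dvd_pow_self (p : ℤ_[p]) two_ne_zero).trans (sq_dvd_add_res2_neg (-x))
  rw [neg_neg] at h1 h2
  have h3 : (p : ℤ) ∣ (res2 p x : ℤ) - res p x := by
    rw [← PadicInt.natCast_dvd_intCast]
    simpa using dvd_sub h2 h1
  have h4 : res p x % p = res2 p x % p := (Nat.modEq_iff_dvd).2 h3
  rw [Nat.mod_eq_of_lt (res_lt x)] at h4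
  exact ⟨res2 p x / p, by rw [h4, Nat.mod_add_div]⟩

lemma sq_dvd_whippleDefect_of_ne_zero {M a b : ℕ} (hap : a ≤ M)
    (hM : a + p < 2 * (M + 1)) (hab : a ≤ b) (hbp : b < p) (hb : 2 * b < p + a) {β z u y : ℤ_[p]}
    (hβ : (p : ℤ_[p]) ∣ β + b) (hβ0 : β + b ≠ 0) (hu : z * u = 1) (hy : (1 - z) * y = 1) (r : ℕ) :
    (p : ℤ_[p]) ^ 2 ∣
      whippleDefect M a (1 + a + (p - 1) * r) (-(a : ℤ_[p]) + -p * r) β z u y := by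
  have hz : IsUnit (-z) := (IsUnit.of_mul_eq_one _ hu).neg
  have hz1 : IsUnit (1 - z) := IsUnit.of_mul_eq_one _ hy
  have hunit : ∀ i < a + p, i ≠ b → IsUnit (β + i) := by
    intro i hi hib
    refine PadicInt.isUnit_of_dvd_sub (m := (i : ℤ) - b) ?_ ?_
    · push_cast
      convert hβ using 1
      ring
    · intro hd
      have := Int.eq_zero_of_abs_lt_dvd hd (by rw [abs_lt]; omega)
      omega
  have haff := isAffineModSq_whippleDefect M a (p - 1) (1 + a) (α := -(a : ℤ_[p])) (β := β)
    (u := u) (y := y) (neg_dvd.2 (PadicInt.dvd_pow_sub_one hz))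
    (neg_dvd.2 (PadicInt.dvd_pow_sub_one hz1))
  rw [← neg_sq]
  refine haff.sq_dvd ?_ ?_ r
  · have h := whippleDefect_eq_zero hap (β := β)
      (isUnit_risingFactorial fun i hi => hunit i (by omega) (by omega)).ne_zero hu hy
    simp [h]
  · have h := sq_dvd_whippleDefect hp.out hap hM hab hb hβ0 hunit hu hy
    have e : 1 + a + (p - 1) * 1 = a + p := by have := hp.out.pos; omega
    have e' : -(a : ℤ_[p]) + -p * (1 : ℕ) = -((a + p : ℕ) : ℤ_[p]) := by push_cast; ring
    rw [e, e', neg_sq]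
    exact h

lemma sq_dvd_whippleDefect_padicInt {M a b r : ℕ} (hap : a ≤ M)
    (hM : a + p < 2 * (M + 1)) (hab : a ≤ b) (hbp : b < p) (hb : 2 * b < p + a)
    {α β z u y : ℤ_[p]} (hα : (p : ℤ_[p]) ^ 2 ∣ α + (a + p * r : ℕ))
    (hβ : (p : ℤ_[p]) ∣ β + b) (hu : z * u = 1) (hy : (1 - z) * y = 1) :
    (p : ℤ_[p]) ^ 2 ∣ whippleDefect M a (1 + a + (p - 1) * r) α β z u y := by
  have hp2 : (p : ℤ_[p]) ^ 2 ≠ 0 := pow_ne_zero _ (Nat.cast_ne_zero.2 hp.out.ne_zero)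
  obtain ⟨β', hβ', h0⟩ : ∃ β', (p : ℤ_[p]) ^ 2 ∣ β - β' ∧ β' + b ≠ 0 := by
    by_cases h : β + b = 0
    · exact ⟨β + (p : ℤ_[p]) ^ 2, by simp, by rwa [add_right_comm, h, zero_add]⟩
    · exact ⟨β, by simp, h⟩
  have hβb : (p : ℤ_[p]) ∣ β' + b := by
    have := dvd_sub hβ ((dvd_pow_self (p : ℤ_[p]) two_ne_zero).trans hβ')
    convert this using 1
    ring
  have key := sq_dvd_whippleDefect_of_ne_zero hap hM hab hbp hb hβb h0 hu hy r
  rw [← PadicInt.toZModPow_eq_zero_iff_dvd, map_whippleDefect] at key ⊢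
  have e1 : PadicInt.toZModPow 2 α
      = PadicInt.toZModPow 2 (-(a : ℤ_[p]) + -(p : ℤ_[p]) * (r : ℤ_[p])) := by
    rw [← sub_eq_zero, ← map_sub, PadicInt.toZModPow_eq_zero_iff_dvd]
    convert hα using 1
    push_cast
    ring
  have e2 : PadicInt.toZModPow 2 β = PadicInt.toZModPow 2 β' := by
    rwa [← sub_eq_zero, ← map_sub, PadicInt.toZModPow_eq_zero_iff_dvd]
  rw [e1, e2]
  exact key

lemma norm_le_mul_norm {x y : ℤ_[p]}
    (h : (p : ℤ_[p]) ^ 2 ∣ x ∧ IsUnit y ∨ (p : ℤ_[p]) ^ 3 ∣ x ∧ ¬ (p : ℤ_[p]) ^ 2 ∣ y) :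
    ‖x‖ ≤ (p : ℝ) ^ (-2 : ℤ) * ‖y‖ := by
  rcases h with ⟨hx, hy⟩ | ⟨hx, hy⟩
  · rw [PadicInt.isUnit_iff.1 hy, mul_one]
    exact_mod_cast (PadicInt.norm_le_pow_iff_mem_span_pow x 2).2 (Ideal.mem_span_singleton.2 hx)
  · have h1 : ‖x‖ ≤ (p : ℝ) ^ (-3 : ℤ) := by
      exact_mod_cast (PadicInt.norm_le_pow_iff_mem_span_pow x 3).2 (Ideal.mem_span_singleton.2 hx)
    have h2 : (p : ℝ) ^ (-1 : ℤ) ≤ ‖y‖ := by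
      by_contra! hlt
      apply hy
      rw [← Ideal.mem_span_singleton, ← PadicInt.norm_le_pow_iff_mem_span_pow]
      have := (PadicInt.norm_le_pow_iff_norm_lt_pow_add_one y (-2)).2 (by simpa using hlt)
      exact_mod_cast this
    have hp0 : (0 : ℝ) < p := by exact_mod_cast hp.out.pos
    calc ‖x‖ ≤ (p : ℝ) ^ (-3 : ℤ) := h1
      _ = (p : ℝ) ^ (-2 : ℤ) * (p : ℝ) ^ (-1 : ℤ) := by rw [← zpow_add₀ hp0.ne']; norm_num
      _ ≤ _ := by gcongr

lemma norm_factorial_eq_one {k : ℕ} (hk : k < p) : ‖(k.factorial : ℚ_[p])‖ = 1 := by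
  rw [Padic.norm_natCast_eq_one_iff, hp.out.coprime_iff_not_dvd, hp.out.dvd_factorial]
  omega

lemma norm_div_factorial_mul_pow_le {x y : ℤ_[p]} {w : ℚ_[p]} {k : ℕ} (hk : k < p) (hw : ‖w‖ = 1)
    (h : (p : ℤ_[p]) ^ 2 ∣ x ∧ IsUnit y ∨ (p : ℤ_[p]) ^ 3 ∣ x ∧ ¬ (p : ℤ_[p]) ^ 2 ∣ y) :
    ‖(x : ℚ_[p]) / ((k.factorial : ℚ_[p]) ^ 2 * y) * w ^ k‖ ≤ (p : ℝ) ^ (-2 : ℤ) := by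
  have hy : y ≠ 0 := by
    rcases h with h | h
    · exact h.2.ne_zero
    · rintro rfl
      exact h.2 (dvd_zero _)
  simp only [norm_mul, norm_div, norm_pow, norm_factorial_eq_one hk, hw, one_pow, mul_one, one_mul]
  rw [div_le_iff₀ (by simpa using hy)]
  exact norm_le_mul_norm h

lemma coe_risingFactorial (x : ℤ_[p]) (k : ℕ) :
    ((risingFactorial x k : ℤ_[p]) : ℚ_[p]) = risingFactorial (x : ℚ_[p]) k :=
  map_risingFactorial PadicInt.Coe.ringHom x k

lemma norm_sum_sub_sum_le {f : ℕ → ℚ_[p]} {m n : ℕ} {c : ℝ} (hc : 0 ≤ c) (hmn : m ≤ n)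
    (h : ∀ k, m ≤ k → k < n → ‖f k‖ ≤ c) :
    ‖∑ k ∈ range n, f k - ∑ k ∈ range m, f k‖ ≤ c := by
  rw [← sum_range_add_sum_Ico f hmn, add_sub_cancel_left]
  refine IsUltrametricDist.norm_sum_le_of_forall_le_of_nonneg hc fun k hk => ?_
  rw [mem_Ico] at hk
  exact h k hk.1 hk.2

lemma norm_add_mul_sub_mul_le {S₁ S₂ S₃ T₁ T₂ T₃ v w : ℚ_[p]} {c : ℝ} (hv : ‖v‖ = 1)
    (hw : ‖w‖ = 1) (h₁ : ‖S₁ - T₁‖ ≤ c) (h₂ : ‖S₂ - T₂‖ ≤ c) (h₃ : ‖S₃ - T₃‖ ≤ c)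
    (h : ‖T₁ + v * T₂ - w * T₃‖ ≤ c) : ‖S₁ + v * S₂ - w * S₃‖ ≤ c := by
  have e : S₁ + v * S₂ - w * S₃ = (S₁ - T₁) + v * (S₂ - T₂) + -w * (S₃ - T₃)
    + (T₁ + v * T₂ - w * T₃) := by ring
  rw [e]
  refine (IsUltrametricDist.norm_add_le_max _ _).trans (max_le ?_ h)
  refine (IsUltrametricDist.norm_add_le_max _ _).trans (max_le ?_ (by simpa [hw] using h₃))
  exact (IsUltrametricDist.norm_add_le_max _ _).trans (max_le h₁ (by simpa [hv] using h₂))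

end Padic

section Truncation

variable {p : ℕ} [hp : Fact p.Prime]

lemma isUnit_sub_add_one_add {a b i : ℕ} {α β : ℤ_[p]} (hα : (p : ℤ_[p]) ∣ α + a)
    (hβ : (p : ℤ_[p]) ∣ β + b) (hab : a ≤ b) (hi : i + b < p + a - 1) :
    IsUnit (α - β + 1 + i) := by
  refine PadicInt.isUnit_of_dvd_sub (m := (b : ℤ) - a + 1 + i) ?_ fun hd => ?_
  · convert dvd_sub hα hβ using 1
    push_cast
    ring
  · have := Int.le_of_dvd (by omega) hd
    omega

lemma isUnit_denomTail_zero {M a b : ℕ} {α β : ℤ_[p]} (hα : (p : ℤ_[p]) ∣ α + a)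
    (hβ : (p : ℤ_[p]) ∣ β + b) (hab : a ≤ b) (hM : M + b < p + a) :
    IsUnit (denomTail M 0 (α - β + 1)) := by
  rw [denomTail, IsUnit.prod_iff]
  intro i hi
  rw [mem_Ico] at hi
  refine IsUnit.mul (IsUnit.pow 2 ?_) (isUnit_sub_add_one_add hα hβ hab (by omega))
  have := PadicInt.isUnit_intCast_of_pos_of_lt (p := p) (m := (i : ℤ) + 1) (by omega) (by omega)
  simpa using this

lemma wellPoised_tail_dvd {a b k : ℕ} {α β : ℤ_[p]} (hα : (p : ℤ_[p]) ∣ α + a)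
    (hβ : (p : ℤ_[p]) ∣ β + b) (hab : a ≤ b) (hb : 2 * b < p + a)
    (h3 : ¬ (p : ℤ_[p]) ^ 2 ∣ risingFactorial (α - β + 1) (p - 1)) (hak : a < k) (hk : k < p) :
    (p : ℤ_[p]) ^ 2 ∣ risingFactorial α k ^ 2 * risingFactorial β k
        ∧ IsUnit (risingFactorial (α - β + 1) k) ∨
      (p : ℤ_[p]) ^ 3 ∣ risingFactorial α k ^ 2 * risingFactorial β k
        ∧ ¬ (p : ℤ_[p]) ^ 2 ∣ risingFactorial (α - β + 1) k := by
  have h := pow_dvd_pow_of_dvd (hα.trans (add_natCast_dvd_risingFactorial α hak)) 2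
  rcases lt_or_ge (k + b) (p + a) with hkb | hkb
  · exact .inl ⟨h.mul_right _, isUnit_risingFactorial fun i hi =>
      isUnit_sub_add_one_add hα hβ hab (by omega)⟩
  · refine .inr ⟨?_, fun hd => h3 (hd.trans (risingFactorial_dvd_of_le _ (by omega)))⟩
    rw [pow_succ]
    exact mul_dvd_mul h (hβ.trans (add_natCast_dvd_risingFactorial β (by omega)))

lemma quadratic_tail_dvd {a b k : ℕ} {α β : ℤ_[p]} (hα : (p : ℤ_[p]) ∣ α + a)
    (hβ : (p : ℤ_[p]) ∣ β + b) (hbp : b < p) (hb : 2 * b < p + a)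
    (h3 : ¬ (p : ℤ_[p]) ^ 2 ∣ risingFactorial (α - β + 1) (p - 1)) (hkb : p + a ≤ k + b)
    (hk : k < p) :
    (p : ℤ_[p]) ^ 3 ∣ risingFactorial (1 - β) k * risingFactorial α (2 * k)
        ∧ ¬ (p : ℤ_[p]) ^ 2 ∣ risingFactorial (α - β + 1) k := by
  refine ⟨?_, fun hd => h3 (hd.trans (risingFactorial_dvd_of_le _ (by omega)))⟩
  rw [pow_succ']
  refine mul_dvd_mul ?_ ?_
  · refine dvd_trans ?_ (add_natCast_dvd_risingFactorial (1 - β) (show p - 1 - b < k by omega))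
    convert dvd_sub (dvd_refl (p : ℤ_[p])) hβ using 1
    rw [Nat.cast_sub (by omega), Nat.cast_sub hp.out.one_le]
    push_cast
    ring
  · rw [pow_two]
    refine (mul_dvd_mul hα ?_).trans (mul_dvd_risingFactorial α
      (show a ≠ a + p by have := hp.out.pos; omega) (by omega) (by omega))
    convert dvd_add hα (dvd_refl (p : ℤ_[p])) using 1
    push_cast
    ring

lemma one_sub_lam2 (α : ℤ_[p]) {r : ℕ} (hr : res2 p (-α) = res p (-α) + p * r) :
    1 - lam2 p α = ((1 + res p (-α) + (p - 1) * r : ℕ) : ℤ) := by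
  have hp0 : (p : ℤ) ≠ 0 := by exact_mod_cast hp.out.ne_zero
  have : ((res p (-α) : ℤ) - (res p (-α) + p * r : ℕ)) = p * (-r) := by push_cast; ring
  rw [lam2, hr, this, Int.mul_ediv_cancel_left _ hp0]
  push_cast [Nat.cast_sub hp.out.one_le]
  ring

lemma norm_truncated_whipple_le {M a b r : ℕ} (haM : a ≤ M) (hM : a + p < 2 * (M + 1))
    (hMb : M + b < p + a) (hab : a ≤ b) (hbp : b < p) (hb : 2 * b < p + a)
    {α β z : ℤ_[p]} (hα : (p : ℤ_[p]) ^ 2 ∣ α + (a + p * r : ℕ))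
    (hβ : (p : ℤ_[p]) ∣ β + b) (hz : IsUnit z) (hz1 : IsUnit (1 - z)) :
    ‖(∑ k ∈ range (a + 1), risingFactorial (α : ℚ_[p]) k ^ 2 * risingFactorial (β : ℚ_[p]) k
          / ((k.factorial : ℚ_[p]) ^ 2 * risingFactorial ((α : ℚ_[p]) - β + 1) k) * (z : ℚ_[p]) ^ k)
      + (-(z : ℚ_[p])) ^ (1 + a + (p - 1) * r) * ∑ k ∈ range (a + 1),
          risingFactorial (α : ℚ_[p]) k ^ 2 * risingFactorial (β : ℚ_[p]) k
          / ((k.factorial : ℚ_[p]) ^ 2 * risingFactorial ((α : ℚ_[p]) - β + 1) k)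
          * ((z : ℚ_[p])⁻¹) ^ k
      - (1 - (z : ℚ_[p])) ^ (1 + a + (p - 1) * r) * ∑ k ∈ range (M + 1),
          risingFactorial (1 - (β : ℚ_[p])) k * risingFactorial (α : ℚ_[p]) (2 * k)
          / ((k.factorial : ℚ_[p]) ^ 2 * risingFactorial ((α : ℚ_[p]) - β + 1) k)
          * (-(z : ℚ_[p]) / (1 - (z : ℚ_[p])) ^ 2) ^ k‖ ≤ (p : ℝ) ^ (-2 : ℤ) := by
  obtain ⟨u, hu⟩ := hz.exists_right_inv
  obtain ⟨y, hy⟩ := hz1.exists_right_inv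
  have hαp : (p : ℤ_[p]) ∣ α + a := by
    have := dvd_sub ((dvd_pow_self (p : ℤ_[p]) two_ne_zero).trans hα)
      (dvd_mul_right (p : ℤ_[p]) r)
    convert this using 1
    push_cast
    ring
  have hdvd := sq_dvd_whippleDefect_padicInt haM hM hab hbp hb hα hβ hu hy
  have hnorm : ‖whippleDefect M a (1 + a + (p - 1) * r) α β z u y‖ ≤ (p : ℝ) ^ (-2 : ℤ) := by
    exact_mod_cast (PadicInt.norm_le_pow_iff_mem_span_pow _ 2).2 (Ideal.mem_span_singleton.2 hdvd)
  have hD := isUnit_denomTail_zero hαp hβ hab hMb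
  have hcoe : ((denomTail M 0 (α - β + 1) : ℤ_[p]) : ℚ_[p])
      = denomTail M 0 ((α : ℚ_[p]) - β + 1) := by
    have h : ((denomTail M 0 (α - β + 1) : ℤ_[p]) : ℚ_[p])
        = denomTail M 0 ((α - β + 1 : ℤ_[p]) : ℚ_[p]) := map_denomTail PadicInt.Coe.ringHom _ _ _
    rw [h]
    push_cast
    rfl
  have hDn : ‖denomTail M 0 ((α : ℚ_[p]) - β + 1)‖ = 1 := by
    rw [← hcoe]
    exact PadicInt.isUnit_iff.1 hD
  have hD0 : denomTail M 0 ((α : ℚ_[p]) - β + 1) ≠ 0 := by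
    intro h
    simp [h] at hDn
  have hu' : (u : ℚ_[p]) = (z : ℚ_[p])⁻¹ :=
    eq_inv_of_mul_eq_one_right (by exact_mod_cast congrArg ((↑) : ℤ_[p] → ℚ_[p]) hu)
  have hy' : (y : ℚ_[p]) = (1 - (z : ℚ_[p]))⁻¹ :=
    eq_inv_of_mul_eq_one_right (by exact_mod_cast congrArg ((↑) : ℤ_[p] → ℚ_[p]) hy)
  have hmap : ((whippleDefect M a (1 + a + (p - 1) * r) α β z u y : ℤ_[p]) : ℚ_[p])
      = whippleDefect M a (1 + a + (p - 1) * r) (α : ℚ_[p]) β z u y :=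
    map_whippleDefect PadicInt.Coe.ringHom ..
  rw [PadicInt.norm_def, hmap, whippleDefect,
    wellPoisedSum_eq_mul_sum (by omega) _ hD0, wellPoisedSum_eq_mul_sum (by omega) _ hD0,
    quadraticSum_eq_mul_sum _ hD0, hu', hy'] at hnorm
  have hmul (x : ℚ_[p]) : ‖x‖ = ‖denomTail M 0 ((α : ℚ_[p]) - β + 1) * x‖ := by
    rw [norm_mul, hDn, one_mul]
  rw [hmul]
  convert hnorm using 2
  rw [inv_pow, ← div_eq_mul_inv, ← neg_div]
  ring

end Truncation

/-- p-adic analogue of Whipple's quadratic `₃F₂` transformation mod `p²`. -/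
theorem padic_whipple_quadratic_3F2
    (p : ℕ) [Fact p.Prime] (hp : Odd p) (α β z : ℤ_[p])
    (hz : IsUnit z) (hz1 : IsUnit (z - 1))
    (h1 : res p (-α) ≤ res p (-β))
    (h2 : p + res p (-α) > 2 * res p (-β))
    (h3 : ¬ ((p : ℤ_[p]) ^ 2 ∣ (ascPochhammer ℤ_[p] (p - 1)).eval (α - β + 1))) :
    ‖(∑ k ∈ Finset.range p,
        poch p (α : ℚ_[p]) k ^ 2 * poch p (β : ℚ_[p]) k
          / ((Nat.factorial k : ℚ_[p]) ^ 2 * poch p ((α : ℚ_[p]) - (β : ℚ_[p]) + 1) k) * (z : ℚ_[p]) ^ k)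
      + (-(z : ℚ_[p])) ^ (1 - lam2 p α) *
          ∑ k ∈ Finset.range p,
            poch p (α : ℚ_[p]) k ^ 2 * poch p (β : ℚ_[p]) k
              / ((Nat.factorial k : ℚ_[p]) ^ 2 * poch p ((α : ℚ_[p]) - (β : ℚ_[p]) + 1) k)
              * (z : ℚ_[p]) ^ (-(k : ℤ))
      - (1 - (z : ℚ_[p])) ^ (1 - lam2 p α) *
          ∑ k ∈ Finset.range p,
            poch p (1 - (β : ℚ_[p])) k * poch p ((α : ℚ_[p]) / 2) k
              * poch p (((α : ℚ_[p]) + 1) / 2) k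
              / ((Nat.factorial k : ℚ_[p]) ^ 2 * poch p ((α : ℚ_[p]) - (β : ℚ_[p]) + 1) k)
              * (-4 * (z : ℚ_[p]) / (1 - (z : ℚ_[p])) ^ 2) ^ k‖
      ≤ (p : ℝ) ^ (-2 : ℤ) := by
  have hz1' : IsUnit (1 - z) := by rw [← neg_sub]; exact hz1.neg
  set a := res p (-α) with ha
  set b := res p (-β) with hbdef
  have hαa : (p : ℤ_[p]) ∣ α + a := dvd_add_res_neg α
  have hβb : (p : ℤ_[p]) ∣ β + b := dvd_add_res_neg β
  have hbp : b < p := res_lt _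
  obtain ⟨r, hr⟩ := res2_eq_res_add_mul (-α)
  have hα2 : (p : ℤ_[p]) ^ 2 ∣ α + (a + p * r : ℕ) := by
    rw [ha, ← hr]
    exact sq_dvd_add_res2_neg α
  have hlam := one_sub_lam2 α hr
  rw [← ha] at hlam
  rw [ascPochhammer_eval_eq_risingFactorial] at h3
  have h2p : (2 : ℚ_[p]) ≠ 0 := two_ne_zero
  have hzn : ‖(z : ℚ_[p])‖ = 1 := PadicInt.isUnit_iff.1 hz
  have hz1n : ‖1 - (z : ℚ_[p])‖ = 1 := by exact_mod_cast PadicInt.isUnit_iff.1 hz1'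
  have hcoe : (α : ℚ_[p]) - β + 1 = ((α - β + 1 : ℤ_[p]) : ℚ_[p]) := by push_cast; rfl
  have hcoe' : 1 - (β : ℚ_[p]) = ((1 - β : ℤ_[p]) : ℚ_[p]) := by push_cast; rfl
  have hc : (0 : ℝ) ≤ (p : ℝ) ^ (-2 : ℤ) := by positivity
  have hquad (k : ℕ) : risingFactorial (1 - (β : ℚ_[p])) k * risingFactorial ((α : ℚ_[p]) / 2) k
        * risingFactorial (((α : ℚ_[p]) + 1) / 2) k
        / ((k.factorial : ℚ_[p]) ^ 2 * risingFactorial ((α : ℚ_[p]) - β + 1) k)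
        * (-4 * (z : ℚ_[p]) / (1 - (z : ℚ_[p])) ^ 2) ^ k
      = risingFactorial (1 - (β : ℚ_[p])) k * risingFactorial (α : ℚ_[p]) (2 * k)
        / ((k.factorial : ℚ_[p]) ^ 2 * risingFactorial ((α : ℚ_[p]) - β + 1) k)
        * (-(z : ℚ_[p]) / (1 - (z : ℚ_[p])) ^ 2) ^ k := by
    rw [← risingFactorial_half_mul_half h2p, show -4 * (z : ℚ_[p]) / (1 - (z : ℚ_[p])) ^ 2
      = 4 * (-(z : ℚ_[p]) / (1 - (z : ℚ_[p])) ^ 2) by ring, mul_pow]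
    ring
  simp only [poch, ascPochhammer_eval_eq_risingFactorial, hquad, hlam, zpow_natCast, zpow_neg,
    ← inv_pow]
  have tail (w : ℚ_[p]) (hw : ‖w‖ = 1) := norm_sum_sub_sum_le (m := a + 1) (n := p) hc (by omega)
    (f := fun k => risingFactorial (α : ℚ_[p]) k ^ 2 * risingFactorial (β : ℚ_[p]) k
      / ((k.factorial : ℚ_[p]) ^ 2 * risingFactorial ((α : ℚ_[p]) - β + 1) k) * w ^ k)
    (fun k hak hk => by
      have := norm_div_factorial_mul_pow_le hk hw
        (wellPoised_tail_dvd hαa hβb h1 h2 h3 (by omega) hk)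
      simpa only [PadicInt.coe_mul, PadicInt.coe_pow, coe_risingFactorial, hcoe] using this)
  have tail1 := tail z hzn
  have tail2 := tail (z : ℚ_[p])⁻¹ (by rw [norm_inv, hzn, inv_one])
  have tail3 := norm_sum_sub_sum_le (m := p + a - b - 1 + 1) (n := p) hc (by omega)
    (f := fun k => risingFactorial (1 - (β : ℚ_[p])) k * risingFactorial (α : ℚ_[p]) (2 * k)
      / ((k.factorial : ℚ_[p]) ^ 2 * risingFactorial ((α : ℚ_[p]) - β + 1) k)
      * (-(z : ℚ_[p]) / (1 - (z : ℚ_[p])) ^ 2) ^ k)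
    (fun k hak hk => by
      have := norm_div_factorial_mul_pow_le (w := -(z : ℚ_[p]) / (1 - (z : ℚ_[p])) ^ 2) hk
        (by simp [hzn, hz1n]) (.inr (quadratic_tail_dvd hαa hβb hbp h2 h3 (by omega) hk))
      simpa only [PadicInt.coe_mul, coe_risingFactorial, hcoe, hcoe'] using this)
  have trunc := norm_truncated_whipple_le (M := p + a - b - 1) (by omega) (by omega) (by omega)
    h1 hbp h2 hα2 hβb hz hz1'
  set e := 1 + a + (p - 1) * r
  have hv : ‖(-(z : ℚ_[p])) ^ e‖ = 1 := by rw [norm_pow, norm_neg, hzn, one_pow]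
  have hv1 : ‖(1 - (z : ℚ_[p])) ^ e‖ = 1 := by rw [norm_pow, hz1n, one_pow]
  exact norm_add_mul_sub_mul_le hv hv1 tail1 tail2 tail3 trunc
end
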